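/- arXiv:2110.04927 — 8 statements merged into one kernel-verified Lean document; each statement's English description precedes it below -/
import Mathlib

section
/- Let β ∈ [0, 3/2] and C_N ≥ 0 be constants, and let 𝒩 ⊂ (ℤ³)³ be a set whose indicator function 1_𝒩 is symmetric with respect to all permutations of its three arguments. Define 𝒩₀ := {(n,k,m) ∈ 𝒩 : |ň| ≥ |ǩ| ≥ |m̌|}, and assume the counting condition: for every n ∈ ℤ³\{0}, Σ_{k ∈ ℤ³} 1_{𝒩₀}(n, k, −n−k) ≤ C_N |ň|^β. Then there exists an absolute constant C such that for all sequences u, v, w : ℤ³ → ℂ with u₀ = v₀ = w₀ = 0 and ‖u‖_{β/2}, ‖v‖_{β/2}, ‖w‖₀ finite, one has Σ_{n ∈ ℤ³} Σ_{k ∈ ℤ³} |u_n| |v_k| |w_{−n−k}| · 1_𝒩(n, k, −n−k) ≤ C √(C_N) ( ‖u‖₀ ‖v‖_{β/2} + ‖u‖_{β/2} ‖v‖₀ ) ‖w‖₀. -/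
open scoped BigOperators ENNReal

/-- Domain-adjusted wavevector `ň = (n₁/L₁, n₂/L₂, n₃)`. -/
noncomputable def cvec (L₁ L₂ : ℝ) (n : Fin 3 → ℤ) : Fin 3 → ℝ :=
  ![(n 0 : ℝ) / L₁, (n 1 : ℝ) / L₂, (n 2 : ℝ)]

/-- Euclidean norm `|ň|` of the domain-adjusted wavevector. -/
noncomputable def cnorm (L₁ L₂ : ℝ) (n : Fin 3 → ℤ) : ℝ :=
  Real.sqrt (cvec L₁ L₂ n 0 ^ 2 + cvec L₁ L₂ n 1 ^ 2 + cvec L₁ L₂ n 2 ^ 2)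

/-- Homogeneous Sobolev norm `‖u‖ₛ` of a scalar sequence of Fourier coefficients. -/
noncomputable def hnorm (L₁ L₂ s : ℝ) (u : (Fin 3 → ℤ) → ℂ) : ℝ :=
  Real.sqrt (∑' n : Fin 3 → ℤ, cnorm L₁ L₂ n ^ (2 * s) * ‖u n‖ ^ 2)

/-- Cauchy–Schwarz inequality for series of extended nonnegative reals. -/
theorem ENNReal.tsum_mul_le_sqrt_mul_sqrt {ι : Type*} (f g : ι → ℝ≥0∞) :
    ∑' i, f i * g i ≤ (∑' i, f i ^ 2) ^ (1 / 2 : ℝ) * (∑' i, g i ^ 2) ^ (1 / 2 : ℝ) := by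
  let : MeasurableSpace ι := ⊤
  simpa [MeasureTheory.lintegral_count] using
    ENNReal.lintegral_mul_le_Lp_mul_Lq (MeasureTheory.Measure.count : MeasureTheory.Measure ι)
      Real.HolderConjugate.two_two (f := f) (g := g)
      (measurable_from_top.aemeasurable) (measurable_from_top.aemeasurable)

/-- The involution `(n, k) ↦ (n, -n - k)`, exchanging the last two entries of a triad. -/
def triadSwap (ι : Type*) [AddCommGroup ι] : ι × ι ≃ ι × ι where
  toFun p := (p.1, -p.1 - p.2)
  invFun p := (p.1, -p.1 - p.2)
  left_inv p := by simp
  right_inv p := by simp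

/-- A trilinear convolution sum over a set of triads whose weighted fibres are bounded by `c`. -/
theorem tsum_triad_le {ι : Type*} [AddCommGroup ι] (S : Set (ι × ι)) (D f g h : ι → ℝ≥0∞)
    (c : ℝ≥0∞) (hS : ∀ n, f n ≠ 0 → (∑' k, S.indicator 1 (n, k)) * D n ^ 2 ≤ c) :
    ∑' p : ι × ι, S.indicator 1 p * D p.1 * f p.1 * (g p.2 * h (-p.1 - p.2)) ≤
      c ^ (1 / 2 : ℝ) * (∑' n, f n ^ 2) ^ (1 / 2 : ℝ) *
        ((∑' n, g n ^ 2) ^ (1 / 2 : ℝ) * (∑' n, h n ^ 2) ^ (1 / 2 : ℝ)) := by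
  refine (ENNReal.tsum_mul_le_sqrt_mul_sqrt _ _).trans ?_
  have half : (0 : ℝ) ≤ 1 / 2 := by norm_num
  refine mul_le_mul' ?_ ?_ <;> rw [← ENNReal.mul_rpow_of_nonneg _ _ half] <;>
    refine ENNReal.rpow_le_rpow ?_ half
  · rw [ENNReal.tsum_prod', ← ENNReal.tsum_mul_left]
    refine ENNReal.tsum_le_tsum fun n => ?_
    have sq : ∀ k, (S.indicator 1 (n, k) * D n * f n) ^ 2 =
        S.indicator 1 (n, k) * (D n ^ 2 * f n ^ 2) := by
      intro k
      by_cases hk : (n, k) ∈ S <;> simp [hk, mul_pow]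
    simp only [sq]
    rw [ENNReal.tsum_mul_right, ← mul_assoc]
    rcases eq_or_ne (f n) 0 with hf | hf
    · simp [hf]
    · gcongr
      exact hS n hf
  · refine le_of_eq ?_
    rw [← ((Equiv.prodComm ι ι).trans (triadSwap ι)).symm.tsum_eq]
    rw [ENNReal.tsum_prod', ← ENNReal.tsum_mul_right]
    refine tsum_congr fun n => ?_
    rw [← ENNReal.tsum_mul_left]
    refine tsum_congr fun k => ?_
    simp [triadSwap, mul_pow]

theorem cnorm_eq_norm (L₁ L₂ : ℝ) (n : Fin 3 → ℤ) :
    cnorm L₁ L₂ n = ‖WithLp.toLp 2 (cvec L₁ L₂ n)‖ := by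
  simp [cnorm, EuclideanSpace.norm_eq, Fin.sum_univ_three]

theorem cnorm_nonneg (L₁ L₂ : ℝ) (n : Fin 3 → ℤ) : 0 ≤ cnorm L₁ L₂ n :=
  Real.sqrt_nonneg _

theorem cnorm_le_add (L₁ L₂ : ℝ) (n k : Fin 3 → ℤ) :
    cnorm L₁ L₂ n ≤ cnorm L₁ L₂ k + cnorm L₁ L₂ (-n - k) := by
  have key : WithLp.toLp 2 (cvec L₁ L₂ n) =
      -(WithLp.toLp 2 (cvec L₁ L₂ k) + WithLp.toLp 2 (cvec L₁ L₂ (-n - k))) := by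
    ext i
    fin_cases i <;> simp [cvec] <;> ring
  simp only [cnorm_eq_norm]
  rw [key, norm_neg]
  exact norm_add_le _ _

theorem exists_pos_le_cnorm {L₁ L₂ : ℝ} (h₁ : 0 < L₁) (h₂ : 0 < L₂) :
    ∃ r, 0 < r ∧ ∀ n : Fin 3 → ℤ, n ≠ 0 → r ≤ cnorm L₁ L₂ n := by
  refine ⟨min (1 / L₁) (min (1 / L₂) 1), by positivity, fun n hn => ?_⟩
  have one_le : ∀ i, n i ≠ 0 → (1 : ℝ) ≤ |(n i : ℝ)| := fun i hi => by
    exact_mod_cast Int.one_le_abs hi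
  have coord : ∀ i, |cvec L₁ L₂ n i| ≤ cnorm L₁ L₂ n := fun i => by
    rw [cnorm_eq_norm]
    exact PiLp.norm_apply_le (WithLp.toLp 2 (cvec L₁ L₂ n)) i
  obtain ⟨i, hi⟩ := Function.ne_iff.mp hn
  refine le_trans ?_ (coord i)
  have hi' := one_le i hi
  fin_cases i
  · refine (min_le_left _ _).trans ?_
    simp only [cvec, abs_div, abs_of_pos h₁, Fin.zero_eta, Matrix.cons_val_zero]
    gcongr
    exact hi'
  · refine (min_le_right _ _).trans ((min_le_left _ _).trans ?_)
    simp only [cvec, Fin.mk_one, Matrix.cons_val_one, Matrix.cons_val_zero, abs_div,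
      abs_of_pos h₂]
    gcongr
    exact hi'
  · refine (min_le_right _ _).trans ((min_le_right _ _).trans ?_)
    simpa [cvec] using hi'

theorem hnorm_nonneg (L₁ L₂ s : ℝ) (u : (Fin 3 → ℤ) → ℂ) : 0 ≤ hnorm L₁ L₂ s u :=
  Real.sqrt_nonneg _

theorem cnorm_rpow_two_mul (L₁ L₂ s : ℝ) (n : Fin 3 → ℤ) :
    cnorm L₁ L₂ n ^ (2 * s) = (cnorm L₁ L₂ n ^ s) ^ 2 := by
  rw [mul_comm, Real.rpow_mul (cnorm_nonneg _ _ _)]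
  norm_num

theorem ofReal_hnorm {L₁ L₂ s : ℝ} {u : (Fin 3 → ℤ) → ℂ}
    (hu : Summable (fun n => cnorm L₁ L₂ n ^ (2 * s) * ‖u n‖ ^ 2)) :
    ENNReal.ofReal (hnorm L₁ L₂ s u) =
      (∑' n, ENNReal.ofReal (cnorm L₁ L₂ n ^ s * ‖u n‖) ^ 2) ^ (1 / 2 : ℝ) := by
  have nonneg : ∀ n, 0 ≤ cnorm L₁ L₂ n ^ (2 * s) * ‖u n‖ ^ 2 := fun n =>
    mul_nonneg (Real.rpow_nonneg (cnorm_nonneg _ _ _) _) (sq_nonneg _)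
  rw [hnorm, Real.sqrt_eq_rpow, ← ENNReal.ofReal_rpow_of_nonneg (tsum_nonneg nonneg) (by norm_num),
    ENNReal.ofReal_tsum_of_nonneg nonneg hu]
  congr 1
  refine tsum_congr fun n => ?_
  rw [← ENNReal.ofReal_pow (mul_nonneg (Real.rpow_nonneg (cnorm_nonneg _ _ _) _) (norm_nonneg _)),
    cnorm_rpow_two_mul, mul_pow]

theorem summable_hnorm_zero {L₁ L₂ s : ℝ} (h₁ : 0 < L₁) (h₂ : 0 < L₂) (hs : 0 ≤ s)
    {u : (Fin 3 → ℤ) → ℂ} (u0 : u 0 = 0)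
    (hu : Summable (fun n => cnorm L₁ L₂ n ^ (2 * s) * ‖u n‖ ^ 2)) :
    Summable (fun n => cnorm L₁ L₂ n ^ (2 * (0 : ℝ)) * ‖u n‖ ^ 2) := by
  obtain ⟨r, hr, hle⟩ := exists_pos_le_cnorm h₁ h₂
  refine Summable.of_nonneg_of_le (fun n => by simp) (fun n => ?_) (hu.mul_left (r ^ (2 * s))⁻¹)
  rcases eq_or_ne n 0 with rfl | hn
  · simp [u0]
  · have hpow : r ^ (2 * s) ≤ cnorm L₁ L₂ n ^ (2 * s) :=
      Real.rpow_le_rpow hr.le (hle n hn) (by positivity)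
    have hrpos : 0 < r ^ (2 * s) := Real.rpow_pos_of_pos hr _
    rw [mul_zero, Real.rpow_zero, ← mul_assoc]
    gcongr
    rw [inv_mul_eq_div, one_le_div hrpos]
    exact hpow

/-- The triads `(n, k, -n - k)` of `N` with `|ň| ≥ |ǩ| ≥ |m̌|`, where `m = -n - k`. -/
def orderedTriads (L₁ L₂ : ℝ) (N : Set ((Fin 3 → ℤ) × (Fin 3 → ℤ) × (Fin 3 → ℤ))) :
    Set ((Fin 3 → ℤ) × (Fin 3 → ℤ)) :=
  {p | (p.1, p.2, -p.1 - p.2) ∈ N ∧ cnorm L₁ L₂ p.2 ≤ cnorm L₁ L₂ p.1 ∧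
    cnorm L₁ L₂ (-p.1 - p.2) ≤ cnorm L₁ L₂ p.2}

theorem mem_orderedTriads {L₁ L₂ : ℝ} {N : Set ((Fin 3 → ℤ) × (Fin 3 → ℤ) × (Fin 3 → ℤ))}
    {n k : Fin 3 → ℤ} : (n, k) ∈ orderedTriads L₁ L₂ N ↔ (n, k, -n - k) ∈ N ∧
      cnorm L₁ L₂ k ≤ cnorm L₁ L₂ n ∧ cnorm L₁ L₂ (-n - k) ≤ cnorm L₁ L₂ k :=
  Iff.rfl

/-- The convolution sum restricted to ordered triads. -/
noncomputable def orderedSum (L₁ L₂ : ℝ) (N : Set ((Fin 3 → ℤ) × (Fin 3 → ℤ) × (Fin 3 → ℤ)))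
    (u v w : (Fin 3 → ℤ) → ℂ) : ℝ≥0∞ :=
  ∑' p : (Fin 3 → ℤ) × (Fin 3 → ℤ), (orderedTriads L₁ L₂ N).indicator
    (fun p => ENNReal.ofReal (‖u p.1‖ * ‖v p.2‖ * ‖w (-p.1 - p.2)‖)) p

/-- The counting condition on the fibres of the ordered triads. -/
def TriadCount (L₁ L₂ β CN : ℝ) (N : Set ((Fin 3 → ℤ) × (Fin 3 → ℤ) × (Fin 3 → ℤ))) : Prop :=
  ∀ n : Fin 3 → ℤ, n ≠ 0 →
      {k : Fin 3 → ℤ | (n, k, -n - k) ∈ N ∧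
          cnorm L₁ L₂ k ≤ cnorm L₁ L₂ n ∧
          cnorm L₁ L₂ (-n - k) ≤ cnorm L₁ L₂ k}.Finite ∧
      ({k : Fin 3 → ℤ | (n, k, -n - k) ∈ N ∧
          cnorm L₁ L₂ k ≤ cnorm L₁ L₂ n ∧
          cnorm L₁ L₂ (-n - k) ≤ cnorm L₁ L₂ k}.ncard : ℝ)
        ≤ CN * cnorm L₁ L₂ n ^ β

theorem TriadCount.tsum_indicator_le {L₁ L₂ β CN : ℝ}
    {N : Set ((Fin 3 → ℤ) × (Fin 3 → ℤ) × (Fin 3 → ℤ))} (hN : TriadCount L₁ L₂ β CN N)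
    {n : Fin 3 → ℤ} (hn : n ≠ 0) :
    ∑' k, (orderedTriads L₁ L₂ N).indicator (1 : (Fin 3 → ℤ) × (Fin 3 → ℤ) → ℝ≥0∞) (n, k) ≤
      ENNReal.ofReal (CN * cnorm L₁ L₂ n ^ β) := by
  obtain ⟨hfin, hcard⟩ := hN n hn
  set s := {k : Fin 3 → ℤ | (n, k, -n - k) ∈ N ∧
          cnorm L₁ L₂ k ≤ cnorm L₁ L₂ n ∧
          cnorm L₁ L₂ (-n - k) ≤ cnorm L₁ L₂ k}
  have fiber : ∀ k, (orderedTriads L₁ L₂ N).indicator (1 : (Fin 3 → ℤ) × (Fin 3 → ℤ) → ℝ≥0∞) (n, k) =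
      s.indicator 1 k := fun k => rfl
  simp only [fiber]
  rw [← tsum_subtype]
  simp only [Pi.one_apply, ENNReal.tsum_set_one]
  rw [← hfin.cast_ncard_eq]
  simpa using ENNReal.ofReal_le_ofReal hcard

/-- Bound for the ordered sum, with the Sobolev weight distributed over the two largest modes. -/
theorem orderedSum_le {L₁ L₂ β CN : ℝ} (h₁ : 0 < L₁) (h₂ : 0 < L₂) (hCN : 0 ≤ CN)
    {N : Set ((Fin 3 → ℤ) × (Fin 3 → ℤ) × (Fin 3 → ℤ))} (hN : TriadCount L₁ L₂ β CN N)
    {u v w : (Fin 3 → ℤ) → ℂ} (u0 : u 0 = 0) {a b M : ℝ} (hM : 0 ≤ M)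
    (hu : Summable (fun n => cnorm L₁ L₂ n ^ (2 * a) * ‖u n‖ ^ 2))
    (hv : Summable (fun n => cnorm L₁ L₂ n ^ (2 * b) * ‖v n‖ ^ 2))
    (hw : Summable (fun n => cnorm L₁ L₂ n ^ (2 * (0 : ℝ)) * ‖w n‖ ^ 2))
    (hab : ∀ p ∈ orderedTriads L₁ L₂ N, p.1 ≠ 0 → cnorm L₁ L₂ p.1 ^ (β / 2) ≤
      M * (cnorm L₁ L₂ p.1 ^ a * cnorm L₁ L₂ p.2 ^ b)) :
    orderedSum L₁ L₂ N u v w ≤ ENNReal.ofReal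
      (M * (√CN * hnorm L₁ L₂ a u * (hnorm L₁ L₂ b v * hnorm L₁ L₂ 0 w))) := by
  have cpos : ∀ n : Fin 3 → ℤ, n ≠ 0 → 0 < cnorm L₁ L₂ n := fun n hn => by
    obtain ⟨r, hr, hle⟩ := exists_pos_le_cnorm h₁ h₂
    exact hr.trans_le (hle n hn)
  have pow0 : ∀ (s : ℝ) n, 0 ≤ cnorm L₁ L₂ n ^ s := fun s n =>
    Real.rpow_nonneg (cnorm_nonneg _ _ _) _
  have key := tsum_triad_le (orderedTriads L₁ L₂ N)
    (fun n => ENNReal.ofReal (cnorm L₁ L₂ n ^ (-(β / 2))))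
    (fun n => ENNReal.ofReal (cnorm L₁ L₂ n ^ a * ‖u n‖))
    (fun n => ENNReal.ofReal (cnorm L₁ L₂ n ^ b * ‖v n‖))
    (fun n => ENNReal.ofReal (cnorm L₁ L₂ n ^ (0 : ℝ) * ‖w n‖))
    (ENNReal.ofReal CN) (by
      intro n hf
      have hn : n ≠ 0 := by
        rintro rfl
        simp [u0] at hf
      refine (mul_le_mul_left (hN.tsum_indicator_le hn) _).trans (le_of_eq ?_)
      rw [← ENNReal.ofReal_pow (pow0 _ _), ← cnorm_rpow_two_mul,
        ← ENNReal.ofReal_mul (mul_nonneg hCN (pow0 _ _)), mul_assoc, ← Real.rpow_add (cpos n hn)]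
      congr 1
      ring_nf
      simp)
  rw [← ofReal_hnorm hu, ← ofReal_hnorm hv, ← ofReal_hnorm hw,
    ENNReal.ofReal_rpow_of_nonneg hCN (by norm_num), ← Real.sqrt_eq_rpow,
    ← ENNReal.ofReal_mul (Real.sqrt_nonneg _), ← ENNReal.ofReal_mul (hnorm_nonneg _ _ _ _),
    ← ENNReal.ofReal_mul (mul_nonneg (Real.sqrt_nonneg _) (hnorm_nonneg _ _ _ _))] at key
  rw [ENNReal.ofReal_mul hM]
  refine le_trans ?_ (mul_le_mul_right key _)
  rw [orderedSum, ← ENNReal.tsum_mul_left]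
  refine ENNReal.tsum_le_tsum fun p => ?_
  by_cases hp : p ∈ orderedTriads L₁ L₂ N
  swap
  · simp [hp]
  rcases eq_or_ne p.1 0 with h0 | h0
  · simp [h0, u0, Set.indicator]
  have hc := cpos p.1 h0
  simp only [Set.indicator_of_mem hp, Pi.one_apply, one_mul]
  rw [← ENNReal.ofReal_mul (pow0 _ _), ← ENNReal.ofReal_mul (mul_nonneg (pow0 _ _) (norm_nonneg _)),
    ← ENNReal.ofReal_mul (mul_nonneg (pow0 _ _) (mul_nonneg (pow0 _ _) (norm_nonneg _))),
    ← ENNReal.ofReal_mul hM]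
  refine ENNReal.ofReal_le_ofReal ?_
  have hone : 1 ≤ cnorm L₁ L₂ p.1 ^ (-(β / 2)) *
      (M * (cnorm L₁ L₂ p.1 ^ a * cnorm L₁ L₂ p.2 ^ b)) := by
    rw [Real.rpow_neg hc.le, inv_mul_eq_div, one_le_div (Real.rpow_pos_of_pos hc _)]
    exact hab p hp h0
  calc _ ≤ _ := le_mul_of_one_le_left (by positivity) hone
    _ = _ := by rw [Real.rpow_zero]; ring

/-- Every triad of `N` is, up to a permutation, an ordered triad. -/
theorem tsum_triads_le_orderedSum {L₁ L₂ : ℝ}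
    {N : Set ((Fin 3 → ℤ) × (Fin 3 → ℤ) × (Fin 3 → ℤ))}
    (hsymm : ∀ n k m : Fin 3 → ℤ,
      ((n, k, m) ∈ N ↔ (n, m, k) ∈ N) ∧ ((n, k, m) ∈ N ↔ (k, n, m) ∈ N) ∧
      ((n, k, m) ∈ N ↔ (k, m, n) ∈ N) ∧ ((n, k, m) ∈ N ↔ (m, n, k) ∈ N) ∧
      ((n, k, m) ∈ N ↔ (m, k, n) ∈ N)) (u v w : (Fin 3 → ℤ) → ℂ) :
    (∑' p : (Fin 3 → ℤ) × (Fin 3 → ℤ),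
      ENNReal.ofReal (‖u p.1‖ * ‖v p.2‖ * ‖w (-p.1 - p.2)‖ *
        Set.indicator N (fun _ => (1 : ℝ)) (p.1, p.2, -p.1 - p.2))) ≤
      orderedSum L₁ L₂ N u v w + orderedSum L₁ L₂ N v u w + orderedSum L₁ L₂ N u w v +
      orderedSum L₁ L₂ N v w u + orderedSum L₁ L₂ N w u v + orderedSum L₁ L₂ N w v u := by
  classical
  set σ := Equiv.prodComm (Fin 3 → ℤ) (Fin 3 → ℤ)
  set τ := triadSwap (Fin 3 → ℤ)
  unfold orderedSum
  rw [← σ.tsum_eq (f := fun p => Set.indicator _ (fun p => ENNReal.ofReal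
      (‖v p.1‖ * ‖u p.2‖ * ‖w (-p.1 - p.2)‖)) p),
    ← τ.tsum_eq (f := fun p => Set.indicator _ (fun p => ENNReal.ofReal
      (‖u p.1‖ * ‖w p.2‖ * ‖v (-p.1 - p.2)‖)) p),
    ← (σ.trans τ).tsum_eq (f := fun p => Set.indicator _ (fun p => ENNReal.ofReal
      (‖v p.1‖ * ‖w p.2‖ * ‖u (-p.1 - p.2)‖)) p),
    ← (τ.trans σ).tsum_eq (f := fun p => Set.indicator _ (fun p => ENNReal.ofReal
      (‖w p.1‖ * ‖u p.2‖ * ‖v (-p.1 - p.2)‖)) p),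
    ← ((σ.trans τ).trans σ).tsum_eq (f := fun p => Set.indicator _ (fun p => ENNReal.ofReal
      (‖w p.1‖ * ‖v p.2‖ * ‖u (-p.1 - p.2)‖)) p)]
  simp only [← ENNReal.tsum_add]
  refine ENNReal.tsum_le_tsum fun ⟨n, k⟩ => ?_
  by_cases hp : (n, k, -n - k) ∈ N
  swap
  · simp [hp]
  obtain ⟨hN₁, hN₂, hN₃, hN₄, hN₅⟩ := hsymm n k (-n - k)
  have e₁ : -k - n = -n - k := by abel
  have e₂ : -(-n - k) - n = k := by abel
  have e₃ : -(-n - k) - k = n := by abel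
  have e₄ : -n - (-n - k) = k := by abel
  have e₅ : -k - (-n - k) = n := by abel
  simp only [σ, τ, triadSwap, Equiv.trans_apply, Equiv.coe_fn_mk, Equiv.prodComm_apply,
    Prod.swap_prod_mk, Set.indicator_of_mem hp, mul_one, Set.indicator_apply, mem_orderedTriads,
    e₁, e₂, e₃, e₄, e₅, ← hN₁, ← hN₂, ← hN₃, ← hN₄, ← hN₅, hp, true_and]
  have c₁ : ‖v k‖ * ‖u n‖ * ‖w (-n - k)‖ = ‖u n‖ * ‖v k‖ * ‖w (-n - k)‖ := by ring
  have c₂ : ‖u n‖ * ‖w (-n - k)‖ * ‖v k‖ = ‖u n‖ * ‖v k‖ * ‖w (-n - k)‖ := by ring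
  have c₃ : ‖v k‖ * ‖w (-n - k)‖ * ‖u n‖ = ‖u n‖ * ‖v k‖ * ‖w (-n - k)‖ := by ring
  have c₄ : ‖w (-n - k)‖ * ‖u n‖ * ‖v k‖ = ‖u n‖ * ‖v k‖ * ‖w (-n - k)‖ := by ring
  have c₅ : ‖w (-n - k)‖ * ‖v k‖ * ‖u n‖ = ‖u n‖ * ‖v k‖ * ‖w (-n - k)‖ := by ring
  simp only [c₁, c₂, c₃, c₄, c₅]
  generalize ENNReal.ofReal _ = x
  rcases le_total (cnorm L₁ L₂ n) (cnorm L₁ L₂ k) with h | h <;>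
  rcases le_total (cnorm L₁ L₂ k) (cnorm L₁ L₂ (-n - k)) with h' | h' <;>
  rcases le_total (cnorm L₁ L₂ n) (cnorm L₁ L₂ (-n - k)) with h'' | h'' <;>
  simp only [h, h', h'', and_self, if_true] <;>
  first
  | exact le_add_left le_rfl
  | exact le_add_right (le_add_left le_rfl)
  | exact le_add_right (le_add_right (le_add_left le_rfl))
  | exact le_add_right (le_add_right (le_add_right (le_add_left le_rfl)))
  | exact le_add_right (le_add_right (le_add_right (le_add_right (le_add_left le_rfl))))
  | exact le_add_right (le_add_right (le_add_right (le_add_right (le_add_right le_rfl))))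

theorem stmt0 :
    ∃ C : ℝ, ∀ (L₁ L₂ : ℝ), 0 < L₁ → 0 < L₂ →
    ∀ β : ℝ, 0 ≤ β → β ≤ 3 / 2 →
    ∀ CN : ℝ, 0 ≤ CN →
    ∀ N : Set ((Fin 3 → ℤ) × (Fin 3 → ℤ) × (Fin 3 → ℤ)),
    (∀ n k m : Fin 3 → ℤ,
      ((n, k, m) ∈ N ↔ (n, m, k) ∈ N) ∧ ((n, k, m) ∈ N ↔ (k, n, m) ∈ N) ∧
      ((n, k, m) ∈ N ↔ (k, m, n) ∈ N) ∧ ((n, k, m) ∈ N ↔ (m, n, k) ∈ N) ∧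
      ((n, k, m) ∈ N ↔ (m, k, n) ∈ N)) →
    (∀ n : Fin 3 → ℤ, n ≠ 0 →
      {k : Fin 3 → ℤ | (n, k, -n - k) ∈ N ∧
          cnorm L₁ L₂ k ≤ cnorm L₁ L₂ n ∧
          cnorm L₁ L₂ (-n - k) ≤ cnorm L₁ L₂ k}.Finite ∧
      ({k : Fin 3 → ℤ | (n, k, -n - k) ∈ N ∧
          cnorm L₁ L₂ k ≤ cnorm L₁ L₂ n ∧
          cnorm L₁ L₂ (-n - k) ≤ cnorm L₁ L₂ k}.ncard : ℝ)
        ≤ CN * cnorm L₁ L₂ n ^ β) →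
    ∀ u v w : (Fin 3 → ℤ) → ℂ,
      u 0 = 0 → v 0 = 0 → w 0 = 0 →
      Summable (fun n => cnorm L₁ L₂ n ^ (2 * (β / 2)) * ‖u n‖ ^ 2) →
      Summable (fun n => cnorm L₁ L₂ n ^ (2 * (β / 2)) * ‖v n‖ ^ 2) →
      Summable (fun n => cnorm L₁ L₂ n ^ (2 * (0 : ℝ)) * ‖w n‖ ^ 2) →
      (∑' p : (Fin 3 → ℤ) × (Fin 3 → ℤ),
          ENNReal.ofReal (‖u p.1‖ * ‖v p.2‖ * ‖w (-p.1 - p.2)‖ *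
            Set.indicator N (fun _ => (1 : ℝ)) (p.1, p.2, -p.1 - p.2)))
        ≤ ENNReal.ofReal (C * Real.sqrt CN *
            ((hnorm L₁ L₂ 0 u * hnorm L₁ L₂ (β / 2) v +
              hnorm L₁ L₂ (β / 2) u * hnorm L₁ L₂ 0 v) * hnorm L₁ L₂ 0 w)) := by
  refine ⟨6, fun L₁ L₂ h₁ h₂ β hβ hβ' CN hCN N hsymm hN u v w u0 v0 w0 hu hv hw => ?_⟩
  refine (tsum_triads_le_orderedSum (L₁ := L₁) (L₂ := L₂) hsymm u v w).trans ?_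
  have hu₀ := summable_hnorm_zero h₁ h₂ (by positivity) u0 hu
  have hv₀ := summable_hnorm_zero h₁ h₂ (by positivity) v0 hv
  have weight_fst : ∀ p ∈ orderedTriads L₁ L₂ N, p.1 ≠ 0 → cnorm L₁ L₂ p.1 ^ (β / 2) ≤
      1 * (cnorm L₁ L₂ p.1 ^ (β / 2) * cnorm L₁ L₂ p.2 ^ (0 : ℝ)) := by
    simp
  have weight_snd : ∀ p ∈ orderedTriads L₁ L₂ N, p.1 ≠ 0 → cnorm L₁ L₂ p.1 ^ (β / 2) ≤
      2 * (cnorm L₁ L₂ p.1 ^ (0 : ℝ) * cnorm L₁ L₂ p.2 ^ (β / 2)) := by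
    intro p hp _
    have hle : cnorm L₁ L₂ p.1 ≤ 2 * cnorm L₁ L₂ p.2 := by
      linarith [cnorm_le_add L₁ L₂ p.1 p.2, hp.2.2]
    calc cnorm L₁ L₂ p.1 ^ (β / 2) ≤ (2 * cnorm L₁ L₂ p.2) ^ (β / 2) :=
          Real.rpow_le_rpow (cnorm_nonneg _ _ _) hle (by positivity)
      _ = 2 ^ (β / 2) * cnorm L₁ L₂ p.2 ^ (β / 2) :=
          Real.mul_rpow (by norm_num) (cnorm_nonneg _ _ _)
      _ ≤ 2 * cnorm L₁ L₂ p.2 ^ (β / 2) := by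
          refine mul_le_mul_of_nonneg_right ?_ (Real.rpow_nonneg (cnorm_nonneg _ _ _) _)
          calc (2 : ℝ) ^ (β / 2) ≤ 2 ^ (1 : ℝ) :=
                Real.rpow_le_rpow_of_exponent_le (by norm_num) (by linarith)
            _ = 2 := Real.rpow_one 2
      _ = _ := by simp
  have huvw := orderedSum_le h₁ h₂ hCN hN u0 zero_le_two hu₀ hv hw weight_snd
  have hvuw := orderedSum_le h₁ h₂ hCN hN v0 zero_le_one hv hu₀ hw weight_fst
  have huwv := orderedSum_le h₁ h₂ hCN hN u0 zero_le_one hu hw hv₀ weight_fst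
  have hvwu := orderedSum_le h₁ h₂ hCN hN v0 zero_le_one hv hw hu₀ weight_fst
  have hwuv := orderedSum_le h₁ h₂ hCN hN w0 zero_le_two hw hu hv₀ weight_snd
  have hwvu := orderedSum_le h₁ h₂ hCN hN w0 zero_le_two hw hv hu₀ weight_snd
  refine (add_le_add (add_le_add (add_le_add (add_le_add (add_le_add huvw hvuw) huwv) hvwu)
    hwuv) hwvu).trans ?_
  have nonneg := hnorm_nonneg L₁ L₂
  have hu₁ := nonneg (β / 2) u
  have hu₂ := nonneg 0 u
  have hv₁ := nonneg (β / 2) v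
  have hv₂ := nonneg 0 v
  have hw₁ := nonneg 0 w
  repeat rw [← ENNReal.ofReal_add (by positivity) (by positivity)]
  refine ENNReal.ofReal_le_ofReal ?_
  have : 0 ≤ √CN * hnorm L₁ L₂ (β / 2) u * hnorm L₁ L₂ 0 v * hnorm L₁ L₂ 0 w := by positivity
  linarith
end

section
/- Let G ⊂ (ℤ³)³ be a set whose indicator satisfies 1_G(n,k,m) = 1_G(m,k,n) for all n,k,m ∈ ℤ³. Let U, V : ℤ³ → ℂ³ satisfy U₀ = V₀ = 0, the divergence-free condition ǩ · U_k = 0 for every k ∈ ℤ³, and the absolute convergence condition Σ_{n,k ∈ ℤ³} |U_k| |V_{−n−k}| |V_n| |m̌| < ∞ where m := −n−k. Then Σ_{n,k ∈ ℤ³} (U_k · m̌)(V_m · V_n) · 1_G(n, k, m) = 0, where m := −n−k and x·y denotes the bilinear (non-conjugated) dot product on ℂ³. -/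
open scoped BigOperators

theorem cvec_neg_sub (L₁ L₂ : ℝ) (n k : Fin 3 → ℤ) (i : Fin 3) :
    cvec L₁ L₂ (-n - k) i = -cvec L₁ L₂ n i - cvec L₁ L₂ k i := by
  fin_cases i <;> simp [cvec] <;> ring

/-- The involution `(n, k) ↦ (-n - k, k)`, exchanging `n` and `m = -n - k`. -/
def outerSwap {A : Type*} [AddCommGroup A] : A × A ≃ A × A where
  toFun p := (-p.1 - p.2, p.2)
  invFun p := (-p.1 - p.2, p.2)
  left_inv p := by ext <;> simp
  right_inv p := by ext <;> simp

theorem stmt3 (L₁ L₂ : ℝ) (hL₁ : 0 < L₁) (hL₂ : 0 < L₂)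
    (G : Set ((Fin 3 → ℤ) × (Fin 3 → ℤ) × (Fin 3 → ℤ)))
    (hGsym : ∀ n k m : Fin 3 → ℤ, (n, k, m) ∈ G ↔ (m, k, n) ∈ G)
    (U V : (Fin 3 → ℤ) → EuclideanSpace ℂ (Fin 3))
    (hU0 : U 0 = 0) (hV0 : V 0 = 0)
    (hdiv : ∀ k : Fin 3 → ℤ, (∑ i : Fin 3, (cvec L₁ L₂ k i : ℂ) * U k i) = 0)
    (habs : Summable (fun p : (Fin 3 → ℤ) × (Fin 3 → ℤ) =>
      ‖U p.2‖ * ‖V (-p.1 - p.2)‖ * ‖V p.1‖ * cnorm L₁ L₂ (-p.1 - p.2))) :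
    (∑' p : (Fin 3 → ℤ) × (Fin 3 → ℤ),
        ((∑ i : Fin 3, U p.2 i * (cvec L₁ L₂ (-p.1 - p.2) i : ℂ)) *
          (∑ i : Fin 3, V (-p.1 - p.2) i * V p.1 i)) *
        Set.indicator G (fun _ => (1 : ℂ)) (p.1, p.2, -p.1 - p.2)) = 0 := by
  rw [← self_eq_neg, ← tsum_neg, ← outerSwap.tsum_eq]
  refine tsum_congr fun p => ?_
  obtain ⟨n, k⟩ := p
  have hn : -(-n - k) - k = n := by abel
  simp only [outerSwap, Equiv.coe_fn_mk, hn]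
  have hG : Set.indicator G (fun _ => (1 : ℂ)) (-n - k, k, n)
      = Set.indicator G (fun _ => (1 : ℂ)) (n, k, -n - k) := by
    classical
    simp only [Set.indicator_apply, hGsym (-n - k) k n]
  have hU : (∑ i : Fin 3, U k i * (cvec L₁ L₂ n i : ℂ))
      = -∑ i : Fin 3, U k i * (cvec L₁ L₂ (-n - k) i : ℂ) := by
    have h := hdiv k
    simp only [cvec_neg_sub, Fin.sum_univ_three] at h ⊢
    push_cast
    linear_combination -h
  have hV : (∑ i : Fin 3, V n i * V (-n - k) i) = ∑ i : Fin 3, V (-n - k) i * V n i :=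
    Finset.sum_congr rfl fun i _ => mul_comm _ _
  rw [hG, hU, hV]
  ring
end

section
/- Fix n ∈ ℝ³\{0}, signs σ₁, σ₂ ∈ {±1}, a bandwidth δ ≥ 0, and k₃ ∈ (−|ň|, |ň|) satisfying k₃ (k₃ + n₃) (2k₃ + n₃) ≠ 0. Define the planar slice S(k₃) := {(k₁,k₂) ∈ ℝ² : (k₁,k₂,k₃) ∈ V_{n,σ₁,σ₂}}. Then there exist constants C, C' independent of n, k₃, δ, L₁, L₂ such that the number of integer points in ℤ² ∩ S(k₃) is at most Area(S(k₃)) + C (L₁ + L₂) √(|ň|² − k₃²) + C', where Area denotes the two-dimensional Lebesgue measure; moreover, if δ = 0 then Area(S(k₃)) = 0. -/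
open scoped BigOperators ENNReal

/-- Euclidean norm of the domain-adjusted vector `ǩ = (k₁/L₁, k₂/L₂, k₃)` of `k ∈ ℝ³`. -/
noncomputable def rnorm (L₁ L₂ : ℝ) (k : Fin 3 → ℝ) : ℝ :=
  Real.sqrt ((k 0 / L₁) ^ 2 + (k 1 / L₂) ^ 2 + (k 2) ^ 2)

/-- `F_{n,σ₁,σ₂}(k) = σ₁ ň₃/|ň| + σ₂ ǩ₃/|ǩ| + m̌₃/|m̌|` with `m = -n-k`. -/
noncomputable def Ffun (L₁ L₂ σ₁ σ₂ : ℝ) (n k : Fin 3 → ℝ) : ℝ :=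
  σ₁ * (n 2 / rnorm L₁ L₂ n) + σ₂ * (k 2 / rnorm L₁ L₂ k) +
    (-n - k) 2 / rnorm L₁ L₂ (-n - k)

/-- The set `V_{n,σ₁,σ₂}`. -/
noncomputable def Vset (L₁ L₂ σ₁ σ₂ δ : ℝ) (n : Fin 3 → ℝ) : Set (Fin 3 → ℝ) :=
  {k | k ≠ 0 ∧ k ≠ -n ∧ |Ffun L₁ L₂ σ₁ σ₂ n k| ≤ δ ∧
    (1 / 2) * rnorm L₁ L₂ n ≤ rnorm L₁ L₂ k ∧ rnorm L₁ L₂ k ≤ rnorm L₁ L₂ n}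

open MeasureTheory Polynomial

/-- An interval contains at most one more integer than its length. -/
theorem encard_int_le_volume_add_one {T : Set ℝ} (hT : T.OrdConnected) :
    (({j : ℤ | (j : ℝ) ∈ T}.encard : ℕ∞) : ℝ≥0∞) ≤ volume T + 1 := by
  have key : ∀ F : Finset ℤ, (F : Set ℤ) ⊆ {j : ℤ | (j : ℝ) ∈ T} →
      (F.card : ℝ≥0∞) ≤ volume T + 1 := by
    intro F hF
    rcases F.eq_empty_or_nonempty with rfl | hne
    · simp
    have hsub : F ⊆ Finset.Icc (F.min' hne) (F.max' hne) := fun x hx =>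
      Finset.mem_Icc.2 ⟨F.min'_le x hx, F.le_max' x hx⟩
    have hle : F.min' hne ≤ F.max' hne := F.min'_le _ (F.max'_mem hne)
    have hcard := Finset.card_le_card hsub
    rw [Int.card_Icc] at hcard
    have hvol : volume (Set.Icc (F.min' hne : ℝ) (F.max' hne : ℝ)) ≤ volume T :=
      measure_mono (hT.out (hF (F.min'_mem hne)) (hF (F.max'_mem hne)))
    rw [Real.volume_Icc] at hvol
    refine le_trans ?_ (add_le_add_left hvol 1)
    rw [← ENNReal.ofReal_one, ← ENNReal.ofReal_add (by simpa using hle) zero_le_one,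
      ← ENNReal.ofReal_natCast]
    apply ENNReal.ofReal_le_ofReal
    have h2 : (F.card : ℤ) ≤ F.max' hne + 1 - F.min' hne := by omega
    have h3 : (F.card : ℝ) ≤ F.max' hne + 1 - F.min' hne := by exact_mod_cast h2
    linarith
  by_cases hfin : {j : ℤ | (j : ℝ) ∈ T}.Finite
  · have := key hfin.toFinset (by simp)
    rw [hfin.encard_eq_coe_toFinset_card]
    simpa using this
  · have htop : volume T + 1 = ⊤ := by
      by_contra hne
      obtain ⟨m, hm⟩ := ENNReal.exists_nat_gt hne
      obtain ⟨F, hF, hFc⟩ := Set.Infinite.exists_subset_card_eq hfin m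
      have := key F hF
      rw [hFc] at this
      exact absurd hm (not_lt.2 this)
    rw [htop]
    exact le_top

/-- If a measurable set meets every interval avoiding the finite set `s` in an interval, then
its number of integers exceeds its length by a quantity bounded in terms of the size of `s`. -/
theorem encard_int_le_volume_add_of_piecewise {S : Set ℝ} (hS : MeasurableSet S) (s : Finset ℝ)
    {I : Set ℝ} (hI : I.OrdConnected)
    (h : ∀ J : Set ℝ, J.OrdConnected → J ⊆ I → (∀ a ∈ s, a ∉ J) → (S ∩ J).OrdConnected) :
    (({j : ℤ | (j : ℝ) ∈ S ∩ I}.encard : ℕ∞) : ℝ≥0∞) ≤ volume (S ∩ I) + 3 ^ s.card := by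
  induction s using Finset.induction_on generalizing I with
  | empty => simpa using encard_int_le_volume_add_one (h I hI subset_rfl (by simp))
  | insert a s has ih =>
    have hl := ih (hI.inter Set.ordConnected_Iio : (I ∩ Set.Iio a).OrdConnected) (by
      intro J hJ hJI hJs
      refine h J hJ (hJI.trans Set.inter_subset_left) ?_
      intro b hb
      rcases Finset.mem_insert.1 hb with rfl | hb
      · exact fun hbJ => lt_irrefl b (hJI hbJ).2
      · exact hJs b hb)
    have hr := ih (hI.inter Set.ordConnected_Ioi : (I ∩ Set.Ioi a).OrdConnected) (by
      intro J hJ hJI hJs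
      refine h J hJ (hJI.trans Set.inter_subset_left) ?_
      intro b hb
      rcases Finset.mem_insert.1 hb with rfl | hb
      · exact fun hbJ => lt_irrefl b (hJI hbJ).2
      · exact hJs b hb)
    have hmid : (({j : ℤ | (j : ℝ) = a}.encard : ℕ∞) : ℝ≥0∞) ≤ 1 := by
      have : {j : ℤ | (j : ℝ) = a}.encard ≤ 1 := by
        rw [Set.encard_le_one_iff]
        intro x y hx hy
        exact_mod_cast (hx.trans hy.symm : (x : ℝ) = y)
      exact_mod_cast this
    have hcover : {j : ℤ | (j : ℝ) ∈ S ∩ I} ⊆ {j : ℤ | (j : ℝ) ∈ S ∩ (I ∩ Set.Iio a)} ∪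
        {j : ℤ | (j : ℝ) = a} ∪ {j : ℤ | (j : ℝ) ∈ S ∩ (I ∩ Set.Ioi a)} := by
      rintro j ⟨hjS, hjI⟩
      rcases lt_trichotomy (j : ℝ) a with hlt | heq | hgt
      · exact Or.inl (Or.inl ⟨hjS, hjI, hlt⟩)
      · exact Or.inl (Or.inr heq)
      · exact Or.inr ⟨hjS, hjI, hgt⟩
    have hcount : (({j : ℤ | (j : ℝ) ∈ S ∩ I}.encard : ℕ∞) : ℝ≥0∞) ≤
        ({j : ℤ | (j : ℝ) ∈ S ∩ (I ∩ Set.Iio a)}.encard : ℕ∞) +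
        ({j : ℤ | (j : ℝ) = a}.encard : ℕ∞) +
        ({j : ℤ | (j : ℝ) ∈ S ∩ (I ∩ Set.Ioi a)}.encard : ℕ∞) := by
      exact_mod_cast (Set.encard_le_encard hcover).trans ((Set.encard_union_le _ _).trans
        (add_le_add_left (Set.encard_union_le _ _) _))
    have hvol : volume (S ∩ (I ∩ Set.Iio a)) + volume (S ∩ (I ∩ Set.Ioi a)) ≤
        volume (S ∩ I) := by
      rw [← measure_union]
      · apply measure_mono
        rintro x (hx | hx)
        · exact ⟨hx.1, hx.2.1⟩
        · exact ⟨hx.1, hx.2.1⟩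
      · rw [Set.disjoint_left]
        exact fun x hx hx' => lt_asymm (Set.mem_Iio.1 hx.2.2) hx'.2.2
      · exact hS.inter (hI.measurableSet.inter measurableSet_Ioi)
    rw [Finset.card_insert_of_notMem has]
    calc _ ≤ _ := hcount
      _ ≤ (volume (S ∩ (I ∩ Set.Iio a)) + 3 ^ s.card) + 1 +
          (volume (S ∩ (I ∩ Set.Ioi a)) + 3 ^ s.card) := by gcongr
      _ = (volume (S ∩ (I ∩ Set.Iio a)) + volume (S ∩ (I ∩ Set.Ioi a))) +
          (2 * 3 ^ s.card + 1) := by ring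
      _ ≤ volume (S ∩ I) + (2 * 3 ^ s.card + 1) := by gcongr
      _ ≤ volume (S ∩ I) + 3 ^ (s.card + 1) := by
        gcongr
        have : 2 * 3 ^ s.card + 1 ≤ 3 ^ (s.card + 1) := by
          have := Nat.one_le_pow s.card 3 (by norm_num)
          rw [pow_succ]
          omega
        exact_mod_cast this

/-- The number of integers in `[-a, a]`. -/
theorem encard_int_Icc_le {a : ℝ} (ha : 0 ≤ a) :
    (({j : ℤ | (j : ℝ) ∈ Set.Icc (-a) a}.encard : ℕ∞) : ℝ≥0∞) ≤ ENNReal.ofReal (2 * a + 1) := by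
  refine (encard_int_le_volume_add_one Set.ordConnected_Icc).trans ?_
  rw [Real.volume_Icc, ENNReal.ofReal_add (by linarith) zero_le_one, ENNReal.ofReal_one]
  ring_nf
  exact le_rfl

theorem tsum_indicator_one_eq_encard {ι : Type*} (A : Set ι) :
    ∑' i, A.indicator (fun _ => (1 : ℝ≥0∞)) i = (A.encard : ℕ∞) := by
  rw [← ENNReal.tsum_set_one, tsum_subtype A (fun _ => (1 : ℝ≥0∞))]

/-- Davenport's lattice point principle in the plane: the number of lattice points exceeds the
area by a boundary term, if this is so for the sections along both coordinate axes. -/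
theorem encard_int_prod_le_volume_add {S : Set (ℝ × ℝ)} (hS : MeasurableSet S) {a b : ℝ}
    (ha : 0 ≤ a) (hSa : ∀ p ∈ S, p.1 ∈ Set.Icc (-a) a) (hSb : ∀ p ∈ S, p.2 ∈ Set.Icc (-b) b)
    (h : ℝ≥0∞)
    (hx : ∀ x : ℝ, (({j : ℤ | (x, (j : ℝ)) ∈ S}.encard : ℕ∞) : ℝ≥0∞) ≤
      volume {t : ℝ | (x, t) ∈ S} + h)
    (hy : ∀ y : ℝ, (({i : ℤ | ((i : ℝ), y) ∈ S}.encard : ℕ∞) : ℝ≥0∞) ≤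
      volume {t : ℝ | (t, y) ∈ S} + h) :
    (({p : ℤ × ℤ | ((p.1 : ℝ), (p.2 : ℝ)) ∈ S}.encard : ℕ∞) : ℝ≥0∞) ≤
      volume S + h * ENNReal.ofReal (2 * b) + h * ENNReal.ofReal (2 * a + 1) := by
  have hsec : ∀ x : ℝ, MeasurableSet {t : ℝ | (x, t) ∈ S} := fun x => measurable_prodMk_left hS
  have hsec' : ∀ y : ℝ, MeasurableSet {t : ℝ | (t, y) ∈ S} := fun y => measurable_prodMk_right hS
  have hrow : ∀ i : ℤ, (({j : ℤ | ((i : ℝ), (j : ℝ)) ∈ S}.encard : ℕ∞) : ℝ≥0∞) ≤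
      volume {t : ℝ | ((i : ℝ), t) ∈ S} +
        h * {j : ℤ | (j : ℝ) ∈ Set.Icc (-a) a}.indicator (fun _ => 1) i := by
    intro i
    by_cases hi : (i : ℝ) ∈ Set.Icc (-a) a
    · rw [Set.indicator_of_mem (by exact hi), mul_one]
      exact hx i
    · have : {j : ℤ | ((i : ℝ), (j : ℝ)) ∈ S} = ∅ := by
        ext j
        simpa using fun hj => hi (hSa _ hj)
      simp [this]
  have hcol : ∀ y : ℝ, (({i : ℤ | ((i : ℝ), y) ∈ S}.encard : ℕ∞) : ℝ≥0∞) ≤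
      volume {t : ℝ | (t, y) ∈ S} + (Set.Icc (-b) b).indicator (fun _ => h) y := by
    intro y
    by_cases hi : y ∈ Set.Icc (-b) b
    · rw [Set.indicator_of_mem hi]
      exact hy y
    · have : {i : ℤ | ((i : ℝ), y) ∈ S} = ∅ := by
        ext j
        simpa using fun hj => hi (hSb _ hj)
      simp [this]
  have hsum : ∑' i : ℤ, volume {t : ℝ | ((i : ℝ), t) ∈ S} ≤
      volume S + h * ENNReal.ofReal (2 * b) := by
    calc ∑' i : ℤ, volume {t : ℝ | ((i : ℝ), t) ∈ S}
        = ∑' i : ℤ, ∫⁻ y, {t : ℝ | ((i : ℝ), t) ∈ S}.indicator (fun _ => (1 : ℝ≥0∞)) y := by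
          congr 1 with i
          rw [lintegral_indicator_const (hsec i), one_mul]
      _ = ∫⁻ y, ∑' i : ℤ, {t : ℝ | ((i : ℝ), t) ∈ S}.indicator (fun _ => (1 : ℝ≥0∞)) y :=
          (lintegral_tsum fun i : ℤ => (measurable_const.indicator (hsec i)).aemeasurable).symm
      _ = ∫⁻ y, (({i : ℤ | ((i : ℝ), y) ∈ S}.encard : ℕ∞) : ℝ≥0∞) := by
          refine lintegral_congr fun y => ?_
          rw [← tsum_indicator_one_eq_encard]
          rfl
      _ ≤ ∫⁻ y, (volume {t : ℝ | (t, y) ∈ S} + (Set.Icc (-b) b).indicator (fun _ => h) y) :=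
          lintegral_mono hcol
      _ = volume S + h * ENNReal.ofReal (2 * b) := by
          rw [lintegral_add_right _ (measurable_const.indicator measurableSet_Icc),
            lintegral_indicator_const measurableSet_Icc, Real.volume_Icc,
            Measure.volume_eq_prod, Measure.prod_apply_symm hS, sub_neg_eq_add, two_mul]
          rfl
  calc (({p : ℤ × ℤ | ((p.1 : ℝ), (p.2 : ℝ)) ∈ S}.encard : ℕ∞) : ℝ≥0∞)
      = ∑' i : ℤ, (({j : ℤ | ((i : ℝ), (j : ℝ)) ∈ S}.encard : ℕ∞) : ℝ≥0∞) := by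
        rw [← tsum_indicator_one_eq_encard, ENNReal.tsum_prod']
        congr 1 with i
        rw [← tsum_indicator_one_eq_encard]
        rfl
    _ ≤ ∑' i : ℤ, (volume {t : ℝ | ((i : ℝ), t) ∈ S} +
        h * {j : ℤ | (j : ℝ) ∈ Set.Icc (-a) a}.indicator (fun _ => 1) i) :=
        ENNReal.tsum_le_tsum hrow
    _ = ∑' i : ℤ, volume {t : ℝ | ((i : ℝ), t) ∈ S} +
        h * ({j : ℤ | (j : ℝ) ∈ Set.Icc (-a) a}.encard : ℕ∞) := by
        rw [ENNReal.tsum_add, ENNReal.tsum_mul_left, tsum_indicator_one_eq_encard]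
    _ ≤ volume S + h * ENNReal.ofReal (2 * b) + h * ENNReal.ofReal (2 * a + 1) :=
        add_le_add hsum (mul_le_mul_right (encard_int_Icc_le ha) _)

/-- The restriction of `Ffun` to a line parallel to one of the first two coordinate axes. -/
noncomputable def lineFun (L A B b α β c t : ℝ) : ℝ :=
  c + α / √((t / L) ^ 2 + A) + β / √(((-b - t) / L) ^ 2 + B)

/-- The polynomial that vanishes at the critical points of `lineFun`. -/
noncomputable def criticalPoly (L A B b α β : ℝ) : ℝ[X] :=
  C (α ^ 2) * X ^ 2 * ((C (-1 / L) * X + C (-b / L)) ^ 2 + C B) ^ 3 -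
    C (β ^ 2) * (X + C b) ^ 2 * ((C (1 / L) * X) ^ 2 + C A) ^ 3

/-- The derivative of the first summand of `lineFun`. -/
noncomputable def radialDeriv (L A α t : ℝ) : ℝ :=
  -(α * t / L ^ 2) / √((t / L) ^ 2 + A) ^ 3

theorem natDegree_criticalPoly_le (L A B b α β : ℝ) :
    (criticalPoly L A B b α β).natDegree ≤ 8 := by
  unfold criticalPoly
  compute_degree

theorem eval_criticalPoly (L A B b α β t : ℝ) :
    (criticalPoly L A B b α β).eval t = α ^ 2 * t ^ 2 * (((-b - t) / L) ^ 2 + B) ^ 3 -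
      β ^ 2 * (t + b) ^ 2 * ((t / L) ^ 2 + A) ^ 3 := by
  simp only [criticalPoly, eval_sub, eval_mul, eval_pow, eval_add, eval_C, eval_X]
  ring

theorem hasDerivAt_div_sqrt {A : ℝ} (hA : 0 < A) (L α t : ℝ) :
    HasDerivAt (fun t => α / √((t / L) ^ 2 + A)) (radialDeriv L A α t) t := by
  have hP : 0 < (t / L) ^ 2 + A := by positivity
  have h1 : HasDerivAt (fun t : ℝ => (t / L) ^ 2 + A) (2 * (t / L) * (1 / L)) t := by
    simpa using (((hasDerivAt_id t).div_const L).pow 2).add_const A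
  have h2 := (hasDerivAt_const t α).div (h1.sqrt hP.ne') (Real.sqrt_pos.2 hP).ne'
  refine h2.congr_deriv ?_
  have := (Real.sqrt_pos.2 hP).ne'
  rw [radialDeriv]
  generalize √((t / L) ^ 2 + A) = r at *
  field_simp
  ring

theorem hasDerivAt_lineFun {A B : ℝ} (hA : 0 < A) (hB : 0 < B) (L b α β c t : ℝ) :
    HasDerivAt (lineFun L A B b α β c) (radialDeriv L A α t - radialDeriv L B β (-b - t)) t := by
  have h1 := (hasDerivAt_div_sqrt hA L α t).const_add c
  have h2 := (hasDerivAt_div_sqrt hB L β (-b - t)).comp t ((hasDerivAt_id t).const_sub (-b))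
  have h3 := h1.add h2
  rw [mul_neg_one, ← sub_eq_add_neg] at h3
  exact h3

theorem continuous_radialDeriv {A : ℝ} (hA : 0 < A) (L α : ℝ) :
    Continuous (radialDeriv L A α) := by
  unfold radialDeriv
  refine Continuous.div (by fun_prop) (by fun_prop) fun t => ?_
  have : 0 < (t / L) ^ 2 + A := by positivity
  positivity

theorem radialDeriv_sq_eq_iff {L A B : ℝ} (hL : 0 < L) (hA : 0 < A) (hB : 0 < B) (b α β t : ℝ) :
    radialDeriv L A α t ^ 2 = radialDeriv L B β (-b - t) ^ 2 ↔
      (criticalPoly L A B b α β).eval t = 0 := by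
  have hP : 0 < (t / L) ^ 2 + A := by positivity
  have hQ : 0 < ((-b - t) / L) ^ 2 + B := by positivity
  have e : ∀ x : ℝ, 0 < x → (√x ^ 3) ^ 2 = x ^ 3 := fun x hx => by
    rw [← pow_mul, mul_comm, pow_mul, Real.sq_sqrt hx.le]
  rw [eval_criticalPoly, radialDeriv, radialDeriv, div_pow _ (√_ ^ 3), div_pow _ (√_ ^ 3),
    e _ hP, e _ hQ, div_eq_div_iff (by positivity) (by positivity), sub_eq_zero]
  generalize (t / L) ^ 2 + A = P
  generalize ((-b - t) / L) ^ 2 + B = Q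
  field_simp
  constructor <;> intro h <;> linarith

/-- On an interval that contains neither `0` nor a root of `criticalPoly`, the derivative of
`lineFun` does not change sign. -/
theorem monotoneOn_or_antitoneOn_lineFun {L A B : ℝ} (hL : 0 < L) (hA : 0 < A) (hB : 0 < B)
    {α : ℝ} (hα : α ≠ 0) (b β c : ℝ) {I : Set ℝ} (hI : I.OrdConnected) (h0 : (0 : ℝ) ∉ I)
    (hroots : ∀ a ∈ (criticalPoly L A B b α β).roots, a ∉ I) :
    MonotoneOn (lineFun L A B b α β c) I ∨ AntitoneOn (lineFun L A B b α β c) I := by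
  have hd := hasDerivAt_lineFun hA hB L b α β c
  have hcont : Continuous (lineFun L A B b α β c) :=
    continuous_iff_continuousAt.2 fun t => (hd t).continuousAt
  have hu := continuous_radialDeriv hA L α
  have hv : Continuous fun t => radialDeriv L B β (-b - t) :=
    (continuous_radialDeriv hB L β).comp (by fun_prop)
  have hmono : (∀ t ∈ I, 0 ≤ radialDeriv L A α t - radialDeriv L B β (-b - t)) →
      MonotoneOn (lineFun L A B b α β c) I := fun h =>
    monotoneOn_of_deriv_nonneg hI.convex hcont.continuousOn
      (fun t _ => (hd t).differentiableAt.differentiableWithinAt)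
      fun t ht => (hd t).deriv ▸ h t (interior_subset ht)
  have hanti : (∀ t ∈ I, radialDeriv L A α t - radialDeriv L B β (-b - t) ≤ 0) →
      AntitoneOn (lineFun L A B b α β c) I := fun h =>
    antitoneOn_of_deriv_nonpos hI.convex hcont.continuousOn
      (fun t _ => (hd t).differentiableAt.differentiableWithinAt)
      fun t ht => (hd t).deriv ▸ h t (interior_subset ht)
  have hsign : ∀ g : ℝ → ℝ, Continuous g → (∀ t ∈ I, g t ≠ 0) →
      (∀ t ∈ I, 0 ≤ g t) ∨ ∀ t ∈ I, g t ≤ 0 := by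
    intro g hg hne
    by_contra hcon
    push Not at hcon
    obtain ⟨⟨x, hx, hx0⟩, y, hy, hy0⟩ := hcon
    obtain ⟨z, hz, hz0⟩ := (hI.isPreconnected.image g hg.continuousOn).ordConnected.out
      ⟨x, hx, rfl⟩ ⟨y, hy, rfl⟩ ⟨hx0.le, hy0.le⟩
    exact hne z hz hz0
  have hu0 : ∀ t ∈ I, radialDeriv L A α t ≠ 0 := by
    intro t ht
    have ht0 : t ≠ 0 := fun h => h0 (h ▸ ht)
    have hP : 0 < (t / L) ^ 2 + A := by positivity
    have : 0 < √((t / L) ^ 2 + A) := Real.sqrt_pos.2 hP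
    unfold radialDeriv
    exact div_ne_zero (neg_ne_zero.2 (by positivity)) (by positivity)
  by_cases hp : criticalPoly L A B b α β = 0
  · have hsq : Set.EqOn (radialDeriv L A α ^ 2) ((fun t => radialDeriv L B β (-b - t)) ^ 2) I :=
      fun t _ => (radialDeriv_sq_eq_iff hL hA hB b α β t).2 (by simp [hp])
    have hv0 : ∀ {t}, t ∈ I → (fun t => radialDeriv L B β (-b - t)) t ≠ 0 := by
      intro t ht h
      have := hsq ht
      simp only [Pi.pow_apply] at this h
      rw [h] at this
      exact hu0 t ht (by simpa using this)
    rcases hI.isPreconnected.eq_or_eq_neg_of_sq_eq hu.continuousOn hv.continuousOn hsq hv0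
      with h | h
    · exact Or.inl (hmono fun t ht => by rw [h ht, sub_self])
    · have h' : ∀ t ∈ I, radialDeriv L A α t - radialDeriv L B β (-b - t) =
          2 * radialDeriv L A α t := fun t ht => by
        have := h ht
        simp only [Pi.neg_apply] at this
        linarith
      rcases hsign _ hu hu0 with hs | hs
      · exact Or.inl (hmono fun t ht => by linarith [h' t ht, hs t ht])
      · exact Or.inr (hanti fun t ht => by linarith [h' t ht, hs t ht])
  · refine (hsign _ (hu.sub hv) fun t ht h => ?_).imp hmono hanti
    refine hroots t ((mem_roots hp).2 ?_) ht
    rw [IsRoot, ← radialDeriv_sq_eq_iff hL hA hB, sub_eq_zero.1 h]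

theorem ordConnected_inter_preimage {f : ℝ → ℝ} {I : Set ℝ}
    (hf : MonotoneOn f I ∨ AntitoneOn f I) (hI : I.OrdConnected) {J : Set ℝ}
    (hJ : J.OrdConnected) : (I ∩ f ⁻¹' J).OrdConnected := by
  refine ⟨fun x hx y hy z hz => ?_⟩
  have hzI := hI.out hx.1 hy.1 hz
  refine ⟨hzI, ?_⟩
  rcases hf with hf | hf
  · exact hJ.out hx.2 hy.2 ⟨hf hx.1 hzI hz.1, hf hzI hy.1 hz.2⟩
  · exact hJ.out hy.2 hx.2 ⟨hf hzI hy.1 hz.2, hf hx.1 hzI hz.1⟩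

theorem monotoneOn_or_antitoneOn_sqrt_sq {L A : ℝ} (hL : 0 < L) {I : Set ℝ}
    (hI : I.OrdConnected) (h0 : (0 : ℝ) ∉ I) :
    MonotoneOn (fun t => √((t / L) ^ 2 + A)) I ∨ AntitoneOn (fun t => √((t / L) ^ 2 + A)) I := by
  have hside : (∀ x ∈ I, 0 ≤ x) ∨ ∀ x ∈ I, x ≤ 0 := by
    by_contra hcon
    push Not at hcon
    obtain ⟨⟨x, hx, hx0⟩, y, hy, hy0⟩ := hcon
    exact h0 (hI.out hx hy ⟨hx0.le, hy0.le⟩)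
  rcases hside with h | h
  · refine Or.inl fun x hx y hy hxy => ?_
    have := h x hx
    dsimp only
    gcongr
  · refine Or.inr fun x hx y hy hxy => ?_
    have := h y hy
    have : (y / L) ^ 2 ≤ (x / L) ^ 2 := by
      rw [← neg_sq (y / L), ← neg_sq (x / L), ← neg_div, ← neg_div]
      have : 0 ≤ -y := by linarith
      gcongr
    dsimp only
    gcongr

/-- The sections of the planar slices contain few more integers than their length. -/
theorem encard_int_lineFun_le {L A B : ℝ} (hL : 0 < L) (hA : 0 < A) (hB : 0 < B)
    {α : ℝ} (hα : α ≠ 0) (b β c δ lo hi : ℝ) {S : Set ℝ} (hS : MeasurableSet S)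
    (hmem : ∀ t, t ∈ S ↔ |lineFun L A B b α β c t| ≤ δ ∧ lo ≤ √((t / L) ^ 2 + A) ∧
      √((t / L) ^ 2 + A) ≤ hi) :
    (({j : ℤ | (j : ℝ) ∈ S}.encard : ℕ∞) : ℝ≥0∞) ≤ volume S + 3 ^ 9 := by
  classical
  set s : Finset ℝ := insert 0 (criticalPoly L A B b α β).roots.toFinset
  have hcard : s.card ≤ 9 := by
    refine (Finset.card_insert_le _ _).trans (Nat.succ_le_succ ?_)
    exact (Multiset.toFinset_card_le _).trans
      ((card_roots' _).trans (natDegree_criticalPoly_le L A B b α β))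
  have h := encard_int_le_volume_add_of_piecewise hS s Set.ordConnected_univ (by
    intro J hJ _ hs
    have h0 : (0 : ℝ) ∉ J := hs 0 (Finset.mem_insert_self _ _)
    have hm := monotoneOn_or_antitoneOn_lineFun hL hA hB hα b β c hJ h0 fun a ha =>
      hs a (Finset.mem_insert_of_mem (Multiset.mem_toFinset.2 ha))
    have h1 := ordConnected_inter_preimage hm hJ
      (Set.ordConnected_Icc : (Set.Icc (-δ) δ).OrdConnected)
    have h2 := ordConnected_inter_preimage
      (monotoneOn_or_antitoneOn_sqrt_sq (A := A) hL hJ h0) hJ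
      (Set.ordConnected_Icc : (Set.Icc lo hi).OrdConnected)
    convert h1.inter h2 using 1
    ext t
    simp only [Set.mem_inter_iff, hmem, abs_le, Set.mem_preimage, Set.mem_Icc]
    tauto)
  simp only [Set.inter_univ] at h
  refine h.trans ?_
  gcongr
  norm_num

theorem finite_zeros_lineFun {L A B : ℝ} (hL : 0 < L) (hA : 0 < A) (hB : 0 < B)
    {α b β c : ℝ} (hp : criticalPoly L A B b α β ≠ 0) :
    {t | lineFun L A B b α β c t = 0}.Finite := by
  classical
  set s : Finset ℝ := (criticalPoly L A B b α β).roots.toFinset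
  have hd := hasDerivAt_lineFun hA hB L b α β c
  have key : ∀ x ∈ {t | lineFun L A B b α β c t = 0} \ s,
      ∀ y ∈ {t | lineFun L A B b α β c t = 0} \ s, x < y →
      s.filter (· < x) ≠ s.filter (· < y) := by
    intro x hx y hy hxy heq
    obtain ⟨z, hz, hz0⟩ := exists_hasDerivAt_eq_zero hxy
      (fun t _ => (hd t).continuousAt.continuousWithinAt) (hx.1.trans hy.1.symm) fun t _ => hd t
    have hzs : z ∈ s := by
      rw [Multiset.mem_toFinset, mem_roots hp, IsRoot, ← radialDeriv_sq_eq_iff hL hA hB,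
        sub_eq_zero.1 hz0]
    have : z ∈ s.filter (· < x) := heq ▸ Finset.mem_filter.2 ⟨hzs, hz.2⟩
    exact lt_asymm hz.1 (Finset.mem_filter.1 this).2
  have hfin : ({t | lineFun L A B b α β c t = 0} \ s).Finite := by
    refine Set.Finite.of_injOn (f := fun x => s.filter (· < x)) (t := (s.powerset : Set _))
      (fun x _ => Finset.mem_coe.2 (Finset.mem_powerset.2 (Finset.filter_subset _ _))) ?_
      (Finset.finite_toSet _)
    intro x hx y hy hxy
    by_contra hne
    rcases lt_or_gt_of_ne hne with h | h
    · exact key x hx y hy h hxy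
    · exact key y hy x hx h hxy.symm
  exact (hfin.union s.finite_toSet).subset fun x hx => by
    by_cases hxs : x ∈ s
    · exact Or.inr hxs
    · exact Or.inl ⟨hx, hxs⟩

/-- `criticalPoly` vanishes identically only in the fully symmetric situation. -/
theorem eq_of_criticalPoly_eq_zero {L A B b α β : ℝ} (hL : 0 < L) (hA : 0 < A)
    (hβ : β ≠ 0) (hp : criticalPoly L A B b α β = 0) :
    b = 0 ∧ α ^ 2 = β ^ 2 ∧ A = B := by
  have ev : ∀ t : ℝ, α ^ 2 * t ^ 2 * (((-b - t) / L) ^ 2 + B) ^ 3 -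
      β ^ 2 * (t + b) ^ 2 * ((t / L) ^ 2 + A) ^ 3 = 0 := fun t => by
    rw [← eval_criticalPoly, hp, eval_zero]
  have hb : b = 0 := by
    have := ev 0
    simpa [hβ, hA.ne'] using this
  subst hb
  have ev2 : ∀ x : ℝ, 0 < x → α ^ 2 * (x + B) ^ 3 = β ^ 2 * (x + A) ^ 3 := by
    intro x hx
    have := ev (L * √x)
    have e : ((L * √x) / L) ^ 2 = x := by
      rw [mul_div_cancel_left₀ _ hL.ne', Real.sq_sqrt hx.le]
    rw [show -0 - L * √x = -(L * √x) by ring, neg_div, neg_sq, e, add_zero] at this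
    have h2 : 0 < (L * √x) ^ 2 := by positivity
    have h3 : (L * √x) ^ 2 * (α ^ 2 * (x + B) ^ 3 - β ^ 2 * (x + A) ^ 3) = 0 := by
      linear_combination this
    exact sub_eq_zero.1 ((mul_eq_zero.1 h3).resolve_left h2.ne')
  have e1 := ev2 1 (by norm_num)
  have e2 := ev2 2 (by norm_num)
  have e3 := ev2 3 (by norm_num)
  have e4 := ev2 4 (by norm_num)
  have hαβ : α ^ 2 = β ^ 2 := by
    linear_combination (e4 - 3 * e3 + 3 * e2 - e1) / 6
  refine ⟨rfl, hαβ, ?_⟩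
  rw [hαβ] at e1
  have h1 := mul_left_cancel₀ (pow_ne_zero 2 hβ) e1
  have h2 := (Odd.strictMono_pow (by decide : Odd 3)).injective h1
  linarith

theorem mem_Vset_iff {L₁ L₂ σ₁ σ₂ δ : ℝ} {n : Fin 3 → ℝ} {k₃ : ℝ} (hk : k₃ ≠ 0)
    (hm : -n 2 - k₃ ≠ 0) (x y : ℝ) :
    ![x, y, k₃] ∈ Vset L₁ L₂ σ₁ σ₂ δ n ↔
      |lineFun L₂ ((x / L₁) ^ 2 + k₃ ^ 2) (((-n 0 - x) / L₁) ^ 2 + (-n 2 - k₃) ^ 2) (n 1)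
        (σ₂ * k₃) (-n 2 - k₃) (σ₁ * (n 2 / rnorm L₁ L₂ n)) y| ≤ δ ∧
      1 / 2 * rnorm L₁ L₂ n ≤ √((y / L₂) ^ 2 + ((x / L₁) ^ 2 + k₃ ^ 2)) ∧
      √((y / L₂) ^ 2 + ((x / L₁) ^ 2 + k₃ ^ 2)) ≤ rnorm L₁ L₂ n := by
  have h0 : ![x, y, k₃] ≠ 0 := fun h => hk (by simpa using congrFun h 2)
  have h1 : ![x, y, k₃] ≠ -n := fun h => hm (by
    have := congrFun h 2
    simp at this
    linarith)
  have hr : rnorm L₁ L₂ ![x, y, k₃] = √((y / L₂) ^ 2 + ((x / L₁) ^ 2 + k₃ ^ 2)) := by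
    simp [rnorm]
    ring_nf
  have hr' : rnorm L₁ L₂ (-n - ![x, y, k₃]) =
      √(((-n 1 - y) / L₂) ^ 2 + (((-n 0 - x) / L₁) ^ 2 + (-n 2 - k₃) ^ 2)) := by
    simp [rnorm]
    ring_nf
  have hF : Ffun L₁ L₂ σ₁ σ₂ n ![x, y, k₃] =
      lineFun L₂ ((x / L₁) ^ 2 + k₃ ^ 2) (((-n 0 - x) / L₁) ^ 2 + (-n 2 - k₃) ^ 2) (n 1)
        (σ₂ * k₃) (-n 2 - k₃) (σ₁ * (n 2 / rnorm L₁ L₂ n)) y := by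
    rw [Ffun, hr, hr', lineFun, mul_div_assoc σ₂]
    simp
  simp only [Vset, Set.mem_ofPred_eq, hF, hr, h0, h1, ne_eq, not_false_eq_true, true_and]

theorem lineFun_swap (L₁ L₂ a b k m α c x y : ℝ) :
    lineFun L₂ ((x / L₁) ^ 2 + k ^ 2) (((-a - x) / L₁) ^ 2 + m ^ 2) b α m c y =
      lineFun L₁ ((y / L₂) ^ 2 + k ^ 2) (((-b - y) / L₂) ^ 2 + m ^ 2) a α m c x := by
  simp only [lineFun, add_left_comm]

theorem mem_Icc_of_sqrt_le {L A k x N : ℝ} (hL : 0 < L) (hA : 0 ≤ A)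
    (h : √((x / L) ^ 2 + (A + k ^ 2)) ≤ N) :
    x ∈ Set.Icc (-(L * √(N ^ 2 - k ^ 2))) (L * √(N ^ 2 - k ^ 2)) := by
  have h2 := (Real.sqrt_le_left ((Real.sqrt_nonneg _).trans h)).1 h
  have h3 := Real.abs_le_sqrt (show (x / L) ^ 2 ≤ N ^ 2 - k ^ 2 by linarith)
  rw [abs_div, abs_of_pos hL, div_le_iff₀ hL, mul_comm] at h3
  exact abs_le.1 h3

theorem measurableSet_slice {L₁ L₂ σ₁ σ₂ δ : ℝ} {n : Fin 3 → ℝ} {k₃ : ℝ} (hk : k₃ ≠ 0)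
    (hm : -n 2 - k₃ ≠ 0) :
    MeasurableSet {q : ℝ × ℝ | ![q.1, q.2, k₃] ∈ Vset L₁ L₂ σ₁ σ₂ δ n} := by
  simp only [mem_Vset_iff hk hm, lineFun]
  measurability

/-- The lattice point bound for a planar slice of `Vset`. -/
theorem encard_slice_le {L₁ L₂ σ₁ σ₂ δ : ℝ} (hL₁ : 0 < L₁) (hL₂ : 0 < L₂) {n : Fin 3 → ℝ}
    {k₃ : ℝ} (hk : k₃ ≠ 0) (hm : -n 2 - k₃ ≠ 0) (hσ : σ₂ ≠ 0) :
    (({p : ℤ × ℤ | ![(p.1 : ℝ), (p.2 : ℝ), k₃] ∈ Vset L₁ L₂ σ₁ σ₂ δ n}.encard : ℕ∞) : ℝ≥0∞) ≤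
      volume {q : ℝ × ℝ | ![q.1, q.2, k₃] ∈ Vset L₁ L₂ σ₁ σ₂ δ n} +
        ENNReal.ofReal (2 * 3 ^ 9 * (L₁ + L₂) * √(rnorm L₁ L₂ n ^ 2 - k₃ ^ 2) + 3 ^ 9) := by
  have hS := measurableSet_slice (L₁ := L₁) (L₂ := L₂) (σ₁ := σ₁) (σ₂ := σ₂) (δ := δ) hk hm
  have hpos : ∀ s : ℝ, 0 < s ^ 2 + k₃ ^ 2 := fun s => by positivity
  have hpos' : ∀ s : ℝ, 0 < s ^ 2 + (-n 2 - k₃) ^ 2 := fun s => by positivity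
  have h := encard_int_prod_le_volume_add hS
    (a := L₁ * √(rnorm L₁ L₂ n ^ 2 - k₃ ^ 2)) (b := L₂ * √(rnorm L₁ L₂ n ^ 2 - k₃ ^ 2))
    (by positivity)
    (fun p hp => by
      have := ((mem_Vset_iff hk hm _ _).1 hp).2.2
      rw [add_left_comm] at this
      exact mem_Icc_of_sqrt_le hL₁ (sq_nonneg _) this)
    (fun p hp => mem_Icc_of_sqrt_le hL₂ (sq_nonneg _) ((mem_Vset_iff hk hm _ _).1 hp).2.2)
    (3 ^ 9)
    (fun x => encard_int_lineFun_le hL₂ (hpos _) (hpos' _) (mul_ne_zero hσ hk) _ _ _ _ _ _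
      (measurable_prodMk_left hS) fun t => mem_Vset_iff hk hm x t)
    (fun y => encard_int_lineFun_le hL₁ (hpos _) (hpos' _) (mul_ne_zero hσ hk) _ _ _ _ _ _
      (measurable_prodMk_right hS) fun t => by
        have := mem_Vset_iff (L₁ := L₁) (L₂ := L₂) (σ₁ := σ₁) (σ₂ := σ₂) (δ := δ) hk hm t y
        rwa [lineFun_swap, add_left_comm] at this)
  refine h.trans_eq ?_
  have h3 : (3 ^ 9 : ℝ≥0∞) = ENNReal.ofReal (3 ^ 9) := by
    rw [ENNReal.ofReal_pow (by norm_num)]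
    norm_num
  rw [h3, add_assoc, ← ENNReal.ofReal_mul (by positivity), ← ENNReal.ofReal_mul (by positivity),
    ← ENNReal.ofReal_add (by positivity) (by positivity)]
  ring_nf

/-- For bandwidth `0` the planar slices of `Vset` are null sets. -/
theorem volume_slice_eq_zero {L₁ L₂ σ₁ σ₂ : ℝ} (hL₁ : 0 < L₁) (hL₂ : 0 < L₂) {n : Fin 3 → ℝ}
    (hn : n ≠ 0) {k₃ : ℝ} (hk : k₃ ≠ 0) (hm : -n 2 - k₃ ≠ 0) (hkm : 2 * k₃ + n 2 ≠ 0)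
    (hσ : σ₂ ^ 2 = 1) :
    volume {q : ℝ × ℝ | ![q.1, q.2, k₃] ∈ Vset L₁ L₂ σ₁ σ₂ 0 n} = 0 := by
  rw [Measure.volume_eq_prod, Measure.measure_prod_null (measurableSet_slice hk hm)]
  have hae : ∀ᵐ x : ℝ, x ≠ -n 0 / 2 := compl_mem_ae_iff.2 (measure_singleton _)
  filter_upwards [hae] with x hx
  have hA : 0 < (x / L₁) ^ 2 + k₃ ^ 2 := by positivity
  have hB : 0 < ((-n 0 - x) / L₁) ^ 2 + (-n 2 - k₃) ^ 2 := by positivity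
  change volume (Prod.mk x ⁻¹' _) = 0
  refine ((finite_zeros_lineFun hL₂ hA hB fun hp => ?_).subset fun t ht =>
    abs_nonpos_iff.1 ((mem_Vset_iff hk hm x t).1 ht).1).measure_zero volume
  obtain ⟨h1, hsq, hAB⟩ := eq_of_criticalPoly_eq_zero hL₂ hA hm hp
  rw [mul_pow, hσ, one_mul] at hsq
  have h2 : n 2 = 0 := by
    have : n 2 * (2 * k₃ + n 2) = 0 := by linear_combination -hsq
    exact (mul_eq_zero.1 this).resolve_right hkm
  rw [hsq, add_left_inj, div_pow, div_pow, div_left_inj' (by positivity)] at hAB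
  have h0 : n 0 * (2 * x + n 0) = 0 := by linear_combination -hAB
  rcases mul_eq_zero.1 h0 with h0 | h0
  · exact hn (funext fun i => by fin_cases i <;> assumption)
  · exact hx (by linarith)

theorem stmt5 :
    ∃ C C' : ℝ, ∀ L₁ L₂ : ℝ, 0 < L₁ → 0 < L₂ →
    ∀ n : Fin 3 → ℝ, n ≠ 0 →
    ∀ σ₁ σ₂ : ℝ, (σ₁ = 1 ∨ σ₁ = -1) → (σ₂ = 1 ∨ σ₂ = -1) →
    ∀ δ : ℝ, 0 ≤ δ →
    ∀ k₃ : ℝ, -rnorm L₁ L₂ n < k₃ → k₃ < rnorm L₁ L₂ n →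
    k₃ * (k₃ + n 2) * (2 * k₃ + n 2) ≠ 0 →
    ((({p : ℤ × ℤ | ![(p.1 : ℝ), (p.2 : ℝ), k₃] ∈ Vset L₁ L₂ σ₁ σ₂ δ n}.encard : ℕ∞)
          : ℝ≥0∞)
        ≤ MeasureTheory.volume {q : ℝ × ℝ | ![q.1, q.2, k₃] ∈ Vset L₁ L₂ σ₁ σ₂ δ n}
          + ENNReal.ofReal
              (C * (L₁ + L₂) * Real.sqrt (rnorm L₁ L₂ n ^ 2 - k₃ ^ 2) + C')) ∧
    (δ = 0 →
      MeasureTheory.volume {q : ℝ × ℝ | ![q.1, q.2, k₃] ∈ Vset L₁ L₂ σ₁ σ₂ δ n} = 0) := by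
  refine ⟨2 * 3 ^ 9, 3 ^ 9, fun L₁ L₂ hL₁ hL₂ n hn σ₁ σ₂ _ hσ₂ δ _ k₃ _ _ hne => ?_⟩
  obtain ⟨hne, hkm⟩ := mul_ne_zero_iff.1 hne
  obtain ⟨hk, hm⟩ := mul_ne_zero_iff.1 hne
  have hm' : -n 2 - k₃ ≠ 0 := fun h => hm (by linarith)
  refine ⟨encard_slice_le hL₁ hL₂ hk hm' (by rcases hσ₂ with rfl | rfl <;> norm_num), ?_⟩
  rintro rfl
  exact volume_slice_eq_zero hL₁ hL₂ hn hk hm' hkm (by rcases hσ₂ with rfl | rfl <;> norm_num)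
end

section
/- There exists a constant C independent of n, δ, σ₁, σ₂, L₁, L₂ such that for every bandwidth constant δ ∈ (0, 1/2), every n ∈ ℤ³\{0} and every choice of signs σ₁, σ₂ ∈ {±1}: vol(V_{n,σ₁,σ₂}) / (L₁ L₂ |ň|³) ≤ C ( δ + δ · log⁺( 1 / (δ + 2|n₃|/|ň|) ) ), where vol denotes the three-dimensional Lebesgue measure and log⁺(x) := max{log x, 0}. -/
open scoped BigOperators ENNReal

open MeasureTheory

lemma one_half_lt_abs_cos_combination {σ₁ σ₂ α β ω : ℝ} (h₁ : σ₁ = 1 ∨ σ₁ = -1)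
    (h₂ : σ₂ = 1 ∨ σ₂ = -1) (hβ : 0 ≤ Real.sin β) (hαβ : Real.sin β ≤ Real.sin (α - β))
    (hα : |Real.sin (α - ω)| < 1 / 10) (hβω : |Real.sin (β - ω)| < 1 / 10) :
    1 / 2 < |σ₁ * Real.cos ω + σ₂ * Real.cos (α - ω) - Real.cos (β - ω)| := by
  have key : ∀ x y : ℝ, |Real.sin (x - y)| ≤ |Real.sin x| + |Real.sin y| := fun x y ↦ by
    rw [Real.sin_sub]
    refine (abs_sub _ _).trans ?_
    rw [abs_mul, abs_mul]
    nlinarith [Real.abs_cos_le_one x, Real.abs_cos_le_one y, abs_nonneg (Real.sin x),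
      abs_nonneg (Real.sin y)]
  have h3 : |Real.sin (α - β)| < 1 / 5 := by
    have := key (α - ω) (β - ω)
    rw [sub_sub_sub_cancel_right] at this
    linarith
  have h4 : |Real.sin ω| < 3 / 10 := by
    have := key β (β - ω)
    rw [sub_sub_cancel, abs_of_nonneg hβ] at this
    linarith [le_abs_self (Real.sin (α - β))]
  have large : ∀ x : ℝ, |Real.sin x| < 3 / 10 → 9 / 10 ≤ |Real.cos x| := fun x hx ↦ by
    have hs : Real.sin x ^ 2 < (3 / 10) ^ 2 := sq_lt_sq' (by linarith [(abs_lt.1 hx).1]) (abs_lt.1 hx).2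
    refine abs_le_of_sq_le_sq' ?_ (abs_nonneg _) |>.2
    rw [sq_abs]
    nlinarith [Real.sin_sq_add_cos_sq x]
  have c1 := large ω h4
  have c2 := large _ (hα.trans (by norm_num))
  have c3 := large _ (hβω.trans (by norm_num))
  have d1 := Real.abs_cos_le_one ω
  have d2 := Real.abs_cos_le_one (α - ω)
  have d3 := Real.abs_cos_le_one (β - ω)
  rw [lt_abs]
  rcases h₁ with rfl | rfl <;> rcases h₂ with rfl | rfl <;>
  rcases le_abs.1 c1 with e1 | e1 <;> rcases le_abs.1 c2 with e2 | e2 <;>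
  rcases le_abs.1 c3 with e3 | e3 <;> rw [abs_le] at d1 d2 d3 <;>
  first
  | (left; linarith)
  | (right; linarith)

lemma volume_cos_near_le (τ b ε : ℝ) :
    volume {θ : ℝ | θ - τ ∈ Set.Icc 0 Real.pi ∧ 1 / 10 ≤ Real.sin (θ - τ) ∧
      |Real.cos (θ - τ) - b| ≤ ε} ≤ ENNReal.ofReal (32 * ε) := by
  refine (Real.volume_le_diam _).trans (Metric.ediam_le ?_)
  have key : ∀ x y : ℝ, x ≤ y → 0 ≤ x → y ≤ Real.pi → 1 / 10 ≤ Real.sin x →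
      1 / 10 ≤ Real.sin y → |Real.cos x - b| ≤ ε → |Real.cos y - b| ≤ ε → y - x ≤ 32 * ε := by
    intro x y hxy hx hy sx sy cx cy
    have hmean : 1 / 10 ≤ Real.sin ((x + y) / 2) := by
      have hxm : x ∈ Set.Icc 0 Real.pi := ⟨hx, hxy.trans hy⟩
      have hym : y ∈ Set.Icc 0 Real.pi := ⟨hx.trans hxy, hy⟩
      have this := strictConcaveOn_sin_Icc.concaveOn.2 hxm hym (show (0 : ℝ) ≤ 1 / 2 by norm_num)
        (show (0 : ℝ) ≤ 1 / 2 by norm_num) (by norm_num)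
      simp only [smul_eq_mul] at this
      rw [show (x + y) / 2 = 1 / 2 * x + 1 / 2 * y by ring]
      linarith
    have hj : 2 / Real.pi * ((y - x) / 2) ≤ Real.sin ((y - x) / 2) :=
      Real.mul_le_sin (by linarith) (by linarith)
    have hj' : (y - x) / 2 * (1 / 1.6) ≤ Real.sin ((y - x) / 2) := by
      refine le_trans ?_ hj
      rw [mul_comm]
      refine mul_le_mul_of_nonneg_right ?_ (by linarith)
      rw [div_le_div_iff₀ (by norm_num) Real.pi_pos]
      linarith [Real.pi_lt_d2]
    have hcos : Real.cos x - Real.cos y = 2 * Real.sin ((x + y) / 2) * Real.sin ((y - x) / 2) := by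
      rw [Real.cos_sub_cos, show (x - y) / 2 = -((y - x) / 2) by ring, Real.sin_neg]; ring
    have h2 : Real.cos x - Real.cos y ≤ 2 * ε := by
      linarith [(abs_le.1 cx).2, (abs_le.1 cy).1]
    norm_num at hj'
    nlinarith
  rintro x ⟨⟨hx0, hx1⟩, hx2, hx3⟩ y ⟨⟨hy0, hy1⟩, hy2, hy3⟩
  rw [edist_dist, Real.dist_eq]
  refine ENNReal.ofReal_le_ofReal (abs_le.2 ⟨?_, ?_⟩)
  · rcases le_total x y with h | h
    · linarith [key _ _ (sub_le_sub_right h τ) hx0 hy1 hx2 hy2 hx3 hy3]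
    · have := (abs_nonneg _).trans hx3
      linarith
  · rcases le_total x y with h | h
    · have := (abs_nonneg _).trans hx3
      linarith
    · linarith [key _ _ (sub_le_sub_right h τ) hy0 hx1 hy2 hx2 hy3 hx3]

lemma volume_cos_shift_near_le {ω σ : ℝ} (hσ : σ = 1 ∨ σ = -1) (hω : |ω| ≤ Real.pi) (b ε : ℝ) :
    volume {θ : ℝ | θ ∈ Set.Ioo 0 Real.pi ∧ 1 / 10 ≤ |Real.sin (θ - ω)| ∧
      |b + σ * Real.cos (θ - ω)| ≤ ε} ≤ ENNReal.ofReal (96 * ε) := by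
  rcases lt_or_ge ε 0 with hε | hε
  · rw [show {θ : ℝ | θ ∈ Set.Ioo 0 Real.pi ∧ 1 / 10 ≤ |Real.sin (θ - ω)| ∧
      |b + σ * Real.cos (θ - ω)| ≤ ε} = ∅ from Set.eq_empty_of_forall_notMem
        fun θ h ↦ absurd ((abs_nonneg _).trans h.2.2) (not_le.2 hε)]
    simp
  have hsplit : ENNReal.ofReal (96 * ε) =
      ENNReal.ofReal (32 * ε) + ENNReal.ofReal (32 * ε) + ENNReal.ofReal (32 * ε) := by
    rw [← ENNReal.ofReal_add (by positivity) (by positivity),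
      ← ENNReal.ofReal_add (by positivity) (by positivity)]
    ring_nf
  rw [hsplit]
  refine (measure_mono ?_).trans ((measure_union_le _ _).trans (add_le_add
    ((measure_union_le _ _).trans (add_le_add (volume_cos_near_le ω (-σ * b) ε)
      (volume_cos_near_le (ω - Real.pi) (σ * b) ε)))
    (volume_cos_near_le (ω + Real.pi) (σ * b) ε)))
  rintro θ ⟨⟨h0, hπ⟩, hs, hc⟩
  have hω' := abs_le.1 hω
  have e1 : Real.sin (θ - (ω - Real.pi)) = -Real.sin (θ - ω) := by
    rw [← sub_add, Real.sin_add_pi]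
  have e2 : Real.cos (θ - (ω - Real.pi)) = -Real.cos (θ - ω) := by
    rw [← sub_add, Real.cos_add_pi]
  have e3 : Real.sin (θ - (ω + Real.pi)) = -Real.sin (θ - ω) := by
    rw [← sub_sub, Real.sin_sub_pi]
  have e4 : Real.cos (θ - (ω + Real.pi)) = -Real.cos (θ - ω) := by
    rw [← sub_sub, Real.cos_sub_pi]
  have hc1 : |Real.cos (θ - ω) - -σ * b| ≤ ε := by
    rw [abs_le] at hc ⊢
    rcases hσ with rfl | rfl <;> constructor <;> linarith
  have hc2 : |-Real.cos (θ - ω) - σ * b| ≤ ε := by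
    rw [← abs_neg]
    convert hc1 using 2
    ring
  simp only [Set.mem_union, Set.mem_ofPred_eq, Set.mem_Icc, e1, e2, e3, e4]
  rcases le_total (θ - ω) 0 with hn | hn
  · have : Real.sin (θ - ω) ≤ 0 :=
      Real.sin_nonpos_of_nonpos_of_neg_pi_le hn (by linarith)
    rw [abs_of_nonpos this] at hs
    exact Or.inl (Or.inr ⟨⟨by linarith, by linarith⟩, hs, hc2⟩)
  rcases le_total (θ - ω) Real.pi with hp | hp
  · rw [abs_of_nonneg (Real.sin_nonneg_of_nonneg_of_le_pi hn hp)] at hs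
    exact Or.inl (Or.inl ⟨⟨hn, hp⟩, hs, hc1⟩)
  · have : 0 ≤ Real.sin (θ - (ω + Real.pi)) :=
      Real.sin_nonneg_of_nonneg_of_le_pi (by linarith) (by linarith)
    rw [e3] at this
    rw [abs_of_nonpos (by linarith)] at hs
    exact Or.inr ⟨⟨by linarith, by linarith⟩, hs, hc2⟩

/-- Pairs of angles `(α, β)` which an in-plane vector `(A, B)` sees as nearly resonant. -/
def planeSet (σ₁ σ₂ A B δ : ℝ) : Set (ℝ × ℝ) :=
  {p | 0 < p.2 ∧ p.2 < p.1 ∧ p.1 < Real.pi ∧ Real.sin p.2 ≤ Real.sin (p.1 - p.2) ∧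
    |A * (σ₁ + σ₂ * Real.cos p.1 - Real.cos p.2) + B * (σ₂ * Real.sin p.1 - Real.sin p.2)| ≤ δ}

lemma volume_le_of_slices {E : Set (ℝ × ℝ)} (hE : MeasurableSet E) {c : ℝ}
    (h₁ : ∀ p ∈ E, p.1 ∈ Set.Ioo 0 Real.pi)
    (h : ∀ x, volume (Prod.mk x ⁻¹' E) ≤ ENNReal.ofReal c) :
    volume E ≤ ENNReal.ofReal (4 * c) := by
  rw [Measure.volume_eq_prod, Measure.prod_apply hE]
  calc ∫⁻ x, volume (Prod.mk x ⁻¹' E)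
      ≤ ∫⁻ x, (Set.Ioo 0 Real.pi).indicator (fun _ ↦ ENNReal.ofReal c) x := by
        refine lintegral_mono fun x ↦ ?_
        by_cases hx : x ∈ Set.Ioo 0 Real.pi
        · simpa [hx] using h x
        · rw [show Prod.mk x ⁻¹' E = ∅ from
            Set.eq_empty_of_forall_notMem fun y hy ↦ hx (h₁ _ hy)]
          simp
    _ = ENNReal.ofReal c * ENNReal.ofReal Real.pi := by
        rw [lintegral_indicator measurableSet_Ioo, setLIntegral_const, Real.volume_Ioo, sub_zero]
    _ ≤ ENNReal.ofReal c * ENNReal.ofReal 4 := by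
        gcongr
        exact Real.pi_le_four
    _ = ENNReal.ofReal (4 * c) := by
        rw [ENNReal.ofReal_mul (by norm_num), mul_comm]

lemma volume_planeSet_le {σ₁ σ₂ A B δ : ℝ} (h₁ : σ₁ = 1 ∨ σ₁ = -1) (h₂ : σ₂ = 1 ∨ σ₂ = -1)
    (hδ : 0 < δ) :
    volume (planeSet σ₁ σ₂ A B δ) ≤
      ENNReal.ofReal (1200 * (δ / (δ + Real.sqrt (A ^ 2 + B ^ 2)))) := by
  set g := Real.sqrt (A ^ 2 + B ^ 2) with hg
  have hg0 : 0 ≤ g := Real.sqrt_nonneg _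
  rcases le_or_gt g (2 * δ) with hcase | hcase
  · have hsub : planeSet σ₁ σ₂ A B δ ⊆ Set.Ioo 0 Real.pi ×ˢ Set.Ioo 0 Real.pi :=
      fun p hp ↦ ⟨⟨hp.1.trans hp.2.1, hp.2.2.1⟩, ⟨hp.1, hp.2.1.trans hp.2.2.1⟩⟩
    refine (measure_mono hsub).trans ?_
    rw [Measure.volume_eq_prod, Measure.prod_prod, Real.volume_Ioo, sub_zero,
      ← ENNReal.ofReal_mul Real.pi_pos.le]
    refine ENNReal.ofReal_le_ofReal ?_
    have : 1 / 3 ≤ δ / (δ + g) := by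
      rw [div_le_div_iff₀ (by norm_num) (by positivity)]
      linarith
    nlinarith [Real.pi_le_four, Real.pi_pos]
  · have hgpos : 0 < g := by linarith
    obtain ⟨ω, hω, hA, hB⟩ : ∃ ω : ℝ, |ω| ≤ Real.pi ∧ A = g * Real.cos ω ∧ B = g * Real.sin ω := by
      have hn : ‖(⟨A, B⟩ : ℂ)‖ = g := by
        rw [Complex.norm_eq_sqrt_sq_add_sq]
      refine ⟨Complex.arg ⟨A, B⟩, Complex.abs_arg_le_pi _, ?_, ?_⟩
      · rw [← hn, Complex.norm_mul_cos_arg]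
      · rw [← hn, Complex.norm_mul_sin_arg]
    set ε := δ / g with hε
    have hε0 : 0 < ε := by positivity
    have hε2 : ε < 1 / 2 := by
      rw [hε, div_lt_div_iff₀ hgpos (by norm_num)]
      linarith
    let G : ℝ × ℝ → ℝ := fun p ↦
      σ₁ * Real.cos ω + σ₂ * Real.cos (p.1 - ω) - Real.cos (p.2 - ω)
    let E₁ : Set (ℝ × ℝ) := (Set.Ioo 0 Real.pi ×ˢ Set.Ioo 0 Real.pi) ∩
      ({p | 1 / 10 ≤ |Real.sin (p.1 - ω)|} ∩ {p | |G p| ≤ ε})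
    let E₂ : Set (ℝ × ℝ) := (Set.Ioo 0 Real.pi ×ˢ Set.Ioo 0 Real.pi) ∩
      ({p | 1 / 10 ≤ |Real.sin (p.2 - ω)|} ∩ {p | |G p| ≤ ε})
    have hsub : planeSet σ₁ σ₂ A B δ ⊆ E₁ ∪ E₂ := by
      rintro p ⟨p1, p2, p3, p4, p5⟩
      have hG : |G p| ≤ ε := by
        have e : A * (σ₁ + σ₂ * Real.cos p.1 - Real.cos p.2) +
            B * (σ₂ * Real.sin p.1 - Real.sin p.2) = g * G p := by
          simp only [G, Real.cos_sub]
          rw [hA, hB]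
          ring
        rw [e, abs_mul, abs_of_pos hgpos] at p5
        rw [hε, le_div_iff₀ hgpos]
        linarith
      have m1 : p.1 ∈ Set.Ioo 0 Real.pi := ⟨p1.trans p2, p3⟩
      have m2 : p.2 ∈ Set.Ioo 0 Real.pi := ⟨p1, p2.trans p3⟩
      by_contra hcon
      simp only [Set.mem_union, not_or] at hcon
      have n1 : |Real.sin (p.1 - ω)| < 1 / 10 := lt_of_not_ge fun h ↦ hcon.1 ⟨⟨m1, m2⟩, h, hG⟩
      have n2 : |Real.sin (p.2 - ω)| < 1 / 10 := lt_of_not_ge fun h ↦ hcon.2 ⟨⟨m1, m2⟩, h, hG⟩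
      have := one_half_lt_abs_cos_combination h₁ h₂ (Real.sin_pos_of_mem_Ioo m2).le p4 n1 n2
      linarith
    have hGm : Measurable fun p ↦ |G p| := by fun_prop
    have hm1 : MeasurableSet E₁ :=
      (measurableSet_Ioo.prod measurableSet_Ioo).inter
        ((measurableSet_le measurable_const (by fun_prop)).inter
          (measurableSet_le hGm measurable_const))
    have hm2 : MeasurableSet E₂ :=
      (measurableSet_Ioo.prod measurableSet_Ioo).inter
        ((measurableSet_le measurable_const (by fun_prop)).inter
          (measurableSet_le hGm measurable_const))
    have hv1 : volume E₁ ≤ ENNReal.ofReal (4 * (96 * ε)) := by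
      rw [Measure.volume_eq_prod, ← (Measure.measurePreserving_swap (μ := (volume : Measure ℝ))
        (ν := (volume : Measure ℝ))).measure_preimage hm1.nullMeasurableSet]
      refine volume_le_of_slices (measurable_swap hm1) (fun p hp ↦ hp.1.2) fun y ↦ ?_
      refine (measure_mono ?_).trans (volume_cos_shift_near_le h₂ hω
        (σ₁ * Real.cos ω - Real.cos (y - ω)) ε)
      rintro x ⟨⟨hx1, -⟩, hx3, hx4⟩
      refine ⟨hx1, hx3, ?_⟩
      have hx4 : |G (x, y)| ≤ ε := hx4
      convert hx4 using 2
      simp only [G]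
      ring
    have hv2 : volume E₂ ≤ ENNReal.ofReal (4 * (96 * ε)) := by
      refine volume_le_of_slices hm2 (fun p hp ↦ hp.1.1) fun x ↦ ?_
      refine (measure_mono ?_).trans (volume_cos_shift_near_le (Or.inr rfl) hω
        (σ₁ * Real.cos ω + σ₂ * Real.cos (x - ω)) ε)
      rintro y ⟨⟨-, hy2⟩, hy3, hy4⟩
      refine ⟨hy2, hy3, ?_⟩
      have hy4 : |G (x, y)| ≤ ε := hy4
      convert hy4 using 2
      simp only [G]
      ring
    refine (measure_mono hsub).trans ((measure_union_le _ _).trans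
      ((add_le_add hv1 hv2).trans ?_))
    rw [← ENNReal.ofReal_add (by positivity) (by positivity)]
    refine ENNReal.ofReal_le_ofReal ?_
    have : ε ≤ 3 / 2 * (δ / (δ + g)) := by
      rw [hε, ← mul_div_assoc, div_le_div_iff₀ hgpos (by positivity)]
      nlinarith
    linarith

lemma integral_inv_add_mul {η c T : ℝ} (hη : 0 < η) (hc : 0 < c) (hT : 0 ≤ T) :
    ∫ t in (0 : ℝ)..T, (η + c * t)⁻¹ = (Real.log (η + c * T) - Real.log η) / c := by
  have hpos : ∀ t ∈ Set.uIcc 0 T, 0 < η + c * t := fun t ht ↦ by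
    rw [Set.uIcc_of_le hT] at ht
    have := mul_nonneg hc.le ht.1
    linarith
  rw [intervalIntegral.integral_eq_sub_of_hasDerivAt (f := fun t ↦ Real.log (η + c * t) / c)]
  · ring_nf
  · intro t ht
    have h := ((((hasDerivAt_id t).const_mul c).const_add η).log (hpos t ht).ne').div_const c
    refine HasDerivAt.congr_deriv (f := fun t ↦ Real.log (η + c * t) / c) h ?_
    have := (hpos t ht).ne'
    simp only [id]
    field_simp
  · refine ContinuousOn.intervalIntegrable (ContinuousOn.inv₀ (by fun_prop) fun t ht ↦ (hpos t ht).ne')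

lemma integral_inv_add_abs_sin_le {η : ℝ} (hη : 0 < η) :
    ∫ t in -Real.pi..Real.pi, (η + |Real.sin t|)⁻¹ ≤
      2 * Real.pi * (Real.log (η + 2) - Real.log η) := by
  have hπ := Real.pi_pos
  have hcont : Continuous fun t ↦ (η + |Real.sin t|)⁻¹ :=
    Continuous.inv₀ (by fun_prop) fun t ↦ by positivity
  have hper : Function.Periodic (fun t ↦ (η + |Real.sin t|)⁻¹) Real.pi := fun t ↦ by
    simp only [Real.sin_add_pi, abs_neg]
  have h0 := hper.intervalIntegral_add_eq (-Real.pi) 0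
  rw [neg_add_cancel, zero_add] at h0
  rw [← intervalIntegral.integral_add_adjacent_intervals (b := 0) (hcont.intervalIntegrable _ _)
    (hcont.intervalIntegrable _ _), h0]
  set c := 2 / Real.pi with hc
  have hc0 : 0 < c := by positivity
  have hcπ : c * Real.pi = 2 := by rw [hc]; field_simp
  have hI : IntervalIntegrable (fun t ↦ (η + c * t)⁻¹) volume 0 Real.pi := by
    refine ContinuousOn.intervalIntegrable (ContinuousOn.inv₀ (by fun_prop) fun t ht ↦ ?_)
    rw [Set.uIcc_of_le hπ.le] at ht
    have := mul_nonneg hc0.le ht.1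
    linarith
  have hI' : IntervalIntegrable (fun t ↦ (η + c * (Real.pi - t))⁻¹) volume 0 Real.pi := by
    refine ContinuousOn.intervalIntegrable (ContinuousOn.inv₀ (by fun_prop) fun t ht ↦ ?_)
    rw [Set.uIcc_of_le hπ.le] at ht
    have := mul_nonneg hc0.le (sub_nonneg.2 ht.2)
    linarith
  have hle : ∫ t in (0 : ℝ)..Real.pi, (η + |Real.sin t|)⁻¹ ≤
      ∫ t in (0 : ℝ)..Real.pi, ((η + c * t)⁻¹ + (η + c * (Real.pi - t))⁻¹) := by
    refine intervalIntegral.integral_mono_on hπ.le (hcont.intervalIntegrable _ _) (hI.add hI') ?_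
    rintro t ⟨ht0, htπ⟩
    have p1 := mul_nonneg hc0.le ht0
    have p2 := mul_nonneg hc0.le (sub_nonneg.2 htπ)
    rcases le_total t (Real.pi / 2) with h | h
    · have hs := Real.mul_le_sin ht0 h
      have : (η + |Real.sin t|)⁻¹ ≤ (η + c * t)⁻¹ :=
        inv_anti₀ (by linarith) (by linarith [le_abs_self (Real.sin t)])
      have : 0 ≤ (η + c * (Real.pi - t))⁻¹ := by positivity
      linarith
    · have hs := Real.mul_le_sin (sub_nonneg.2 htπ) (by linarith)
      rw [Real.sin_pi_sub] at hs
      have : (η + |Real.sin t|)⁻¹ ≤ (η + c * (Real.pi - t))⁻¹ :=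
        inv_anti₀ (by linarith) (by linarith [le_abs_self (Real.sin t)])
      have : 0 ≤ (η + c * t)⁻¹ := by positivity
      linarith
  rw [intervalIntegral.integral_add hI hI',
    intervalIntegral.integral_comp_sub_left (fun t ↦ (η + c * t)⁻¹), sub_self, sub_zero,
    integral_inv_add_mul hη hc0 hπ.le, hcπ] at hle
  have e : (Real.log (η + 2) - Real.log η) / c =
      Real.pi / 2 * (Real.log (η + 2) - Real.log η) := by
    rw [hc]; field_simp
  rw [e] at hle
  linarith

/-- Triples `(α, β, φ)` whose in-plane pair `(α, β)` is nearly resonant for the vector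
`(a, q sin φ)`. -/
def angleSet (σ₁ σ₂ a q δ : ℝ) : Set (Fin 3 → ℝ) :=
  {p | p 2 ∈ Set.Icc (-Real.pi) Real.pi ∧
    (p 0, p 1) ∈ planeSet σ₁ σ₂ a (q * Real.sin (p 2)) δ}

lemma measurableSet_planeSet_family (σ₁ σ₂ a q δ : ℝ) :
    MeasurableSet {x : ℝ × ℝ × ℝ | x.1 ∈ Set.Icc (-Real.pi) Real.pi ∧
      x.2 ∈ planeSet σ₁ σ₂ a (q * Real.sin x.1) δ} := by
  refine (measurable_fst measurableSet_Icc).inter (s₂ := {x : ℝ × ℝ × ℝ |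
      x.2 ∈ planeSet σ₁ σ₂ a (q * Real.sin x.1) δ}) ?_
  have h1 : MeasurableSet {x : ℝ × ℝ × ℝ | 0 < x.2.2} := measurableSet_lt (by fun_prop) (by fun_prop)
  have h2 : MeasurableSet {x : ℝ × ℝ × ℝ | x.2.2 < x.2.1} :=
    measurableSet_lt (by fun_prop) (by fun_prop)
  have h3 : MeasurableSet {x : ℝ × ℝ × ℝ | x.2.1 < Real.pi} :=
    measurableSet_lt (by fun_prop) (by fun_prop)
  have h4 : MeasurableSet {x : ℝ × ℝ × ℝ | Real.sin x.2.2 ≤ Real.sin (x.2.1 - x.2.2)} :=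
    measurableSet_le (by fun_prop) (by fun_prop)
  have h5 : MeasurableSet {x : ℝ × ℝ × ℝ |
      |a * (σ₁ + σ₂ * Real.cos x.2.1 - Real.cos x.2.2) +
        q * Real.sin x.1 * (σ₂ * Real.sin x.2.1 - Real.sin x.2.2)| ≤ δ} :=
    measurableSet_le (by fun_prop) (by fun_prop)
  exact h1.inter (h2.inter (h3.inter (h4.inter h5)))

lemma measurePreserving_finThree :
    MeasurePreserving (fun p : Fin 3 → ℝ ↦ ((p 2, p 0, p 1) : ℝ × ℝ × ℝ)) volume volume :=
  ((MeasurePreserving.id (volume : Measure ℝ)).prod (volume_preserving_finTwoArrow ℝ)).comp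
    (volume_preserving_piFinSuccAbove (fun _ : Fin 3 ↦ ℝ) 2)

lemma measurableSet_angleSet (σ₁ σ₂ a q δ : ℝ) : MeasurableSet (angleSet σ₁ σ₂ a q δ) :=
  measurePreserving_finThree.measurable (measurableSet_planeSet_family σ₁ σ₂ a q δ)

lemma volume_angleSet_le {σ₁ σ₂ a q δ : ℝ} (h₁ : σ₁ = 1 ∨ σ₁ = -1) (h₂ : σ₂ = 1 ∨ σ₂ = -1)
    (haq : a ^ 2 + q ^ 2 = 1) (hδ : 0 < δ) :
    volume (angleSet σ₁ σ₂ a q δ) ≤ ENNReal.ofReal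
      (4800 * δ * (2 * Real.pi * (Real.log (δ + 2 * |a| + 2) - Real.log (δ + 2 * |a|)))) := by
  set η := δ + 2 * |a| with hη
  have hη0 : 0 < η := by positivity
  have hT := measurableSet_planeSet_family σ₁ σ₂ a q δ
  have hcont : Continuous fun t ↦ (η + |Real.sin t|)⁻¹ :=
    Continuous.inv₀ (by fun_prop) fun t ↦ by positivity
  calc volume (angleSet σ₁ σ₂ a q δ)
      = volume {x : ℝ × ℝ × ℝ | x.1 ∈ Set.Icc (-Real.pi) Real.pi ∧
          x.2 ∈ planeSet σ₁ σ₂ a (q * Real.sin x.1) δ} :=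
        measurePreserving_finThree.measure_preimage hT.nullMeasurableSet
    _ ≤ ∫⁻ t, (Set.Icc (-Real.pi) Real.pi).indicator
          (fun t ↦ ENNReal.ofReal (4800 * δ * (η + |Real.sin t|)⁻¹)) t := by
        rw [Measure.volume_eq_prod, Measure.prod_apply hT]
        refine lintegral_mono fun t ↦ ?_
        by_cases ht : t ∈ Set.Icc (-Real.pi) Real.pi
        · rw [Set.indicator_of_mem ht]
          refine (measure_mono (t := planeSet σ₁ σ₂ a (q * Real.sin t) δ)
            fun x hx ↦ hx.2).trans ((volume_planeSet_le h₁ h₂ hδ).trans ?_)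
          refine ENNReal.ofReal_le_ofReal ?_
          have hs := Real.abs_sin_le_one t
          have hs2 : Real.sin t ^ 2 ≤ 1 := by
            rw [← sq_abs]; exact pow_le_one₀ (abs_nonneg _) hs
          have g1 : |a| ≤ Real.sqrt (a ^ 2 + (q * Real.sin t) ^ 2) :=
            Real.abs_le_sqrt (by nlinarith [sq_nonneg (q * Real.sin t)])
          have g2 : |Real.sin t| ≤ Real.sqrt (a ^ 2 + (q * Real.sin t) ^ 2) := by
            refine Real.abs_le_sqrt ?_
            have : q ^ 2 = 1 - a ^ 2 := by linarith
            rw [mul_pow, this]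
            nlinarith [mul_nonneg (sq_nonneg a) (sub_nonneg.2 hs2)]
          have : (δ + Real.sqrt (a ^ 2 + (q * Real.sin t) ^ 2))⁻¹ ≤
              4 * (η + |Real.sin t|)⁻¹ := by
            rw [← div_eq_mul_inv, inv_eq_one_div, div_le_div_iff₀ (by positivity) (by positivity)]
            rw [hη]
            linarith [abs_nonneg a, abs_nonneg (Real.sin t)]
          rw [div_eq_mul_inv]
          nlinarith
        · rw [Set.indicator_of_notMem ht, nonpos_iff_eq_zero]
          exact measure_mono_null (fun x hx ↦ ht hx.1) measure_empty
    _ = ENNReal.ofReal (∫ t in -Real.pi..Real.pi, 4800 * δ * (η + |Real.sin t|)⁻¹) := by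
        rw [lintegral_indicator measurableSet_Icc, intervalIntegral.integral_of_le
          (by linarith [Real.pi_pos]), ← integral_Icc_eq_integral_Ioc,
          ofReal_integral_eq_lintegral_ofReal]
        · exact (Continuous.integrableOn_Icc (by fun_prop))
        · exact Filter.Eventually.of_forall fun t ↦ by positivity
    _ ≤ _ := by
        rw [intervalIntegral.integral_const_mul]
        exact ENNReal.ofReal_le_ofReal
          (mul_le_mul_of_nonneg_left (integral_inv_add_abs_sin_le hη0) (by positivity))

/-- Bipolar parametrization of `ℝ³` around the first axis: `α` and `β` are the angles between that
axis and the directions from the points `0` and `(-1, 0, 0)`, and `φ` is the azimuth. -/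
noncomputable def bipolar (p : Fin 3 → ℝ) : Fin 3 → ℝ :=
  ![Real.cos (p 0) * Real.sin (p 1) / Real.sin (p 0 - p 1),
    Real.sin (p 0) * Real.sin (p 1) / Real.sin (p 0 - p 1) * Real.cos (p 2),
    Real.sin (p 0) * Real.sin (p 1) / Real.sin (p 0 - p 1) * Real.sin (p 2)]

/-- The Jacobian matrix of `bipolar`. -/
noncomputable def bipolarJacobian (p : Fin 3 → ℝ) : Matrix (Fin 3) (Fin 3) ℝ :=
  !![-(Real.sin (p 1) * Real.cos (p 1)) / Real.sin (p 0 - p 1) ^ 2,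
      Real.sin (p 0) * Real.cos (p 0) / Real.sin (p 0 - p 1) ^ 2, 0;
    -Real.sin (p 1) ^ 2 / Real.sin (p 0 - p 1) ^ 2 * Real.cos (p 2),
      Real.sin (p 0) ^ 2 / Real.sin (p 0 - p 1) ^ 2 * Real.cos (p 2),
      -(Real.sin (p 0) * Real.sin (p 1) / Real.sin (p 0 - p 1) * Real.sin (p 2));
    -Real.sin (p 1) ^ 2 / Real.sin (p 0 - p 1) ^ 2 * Real.sin (p 2),
      Real.sin (p 0) ^ 2 / Real.sin (p 0 - p 1) ^ 2 * Real.sin (p 2),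
      Real.sin (p 0) * Real.sin (p 1) / Real.sin (p 0 - p 1) * Real.cos (p 2)]

lemma hasFDerivAt_bipolar {p : Fin 3 → ℝ} (hp : Real.sin (p 0 - p 1) ≠ 0) :
    HasFDerivAt bipolar (Matrix.toLin' (bipolarJacobian p)).toContinuousLinearMap p := by
  have h0 : HasFDerivAt (fun p : Fin 3 → ℝ ↦ p 0) _ p :=
    hasFDerivAt_apply (𝕜 := ℝ) (F' := fun _ ↦ ℝ) 0 p
  have h1 : HasFDerivAt (fun p : Fin 3 → ℝ ↦ p 1) _ p :=
    hasFDerivAt_apply (𝕜 := ℝ) (F' := fun _ ↦ ℝ) 1 p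
  have h2 : HasFDerivAt (fun p : Fin 3 → ℝ ↦ p 2) _ p :=
    hasFDerivAt_apply (𝕜 := ℝ) (F' := fun _ ↦ ℝ) 2 p
  have hd := ((hasDerivAt_inv hp).comp_hasFDerivAt p (h0.sub h1).sin)
  have hr := (h0.sin.mul h1.sin).mul hd
  have hi : (Real.sin (p 0 - p 1))⁻¹ = Real.sin (p 0 - p 1) * (Real.sin (p 0 - p 1) ^ 2)⁻¹ := by
    field_simp
  have k₁ : Real.cos (p 0) * Real.cos (p 0 - p 1) + Real.sin (p 0) * Real.sin (p 0 - p 1) =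
      Real.cos (p 1) := by
    rw [← Real.cos_sub, sub_sub_cancel]
  have k₂ : Real.sin (p 1) * Real.cos (p 0 - p 1) + Real.cos (p 1) * Real.sin (p 0 - p 1) =
      Real.sin (p 0) := by
    rw [← Real.sin_add, add_sub_cancel]
  have k₃ : Real.sin (p 0) * Real.cos (p 0 - p 1) - Real.cos (p 0) * Real.sin (p 0 - p 1) =
      Real.sin (p 1) := by
    rw [← Real.sin_sub, sub_sub_cancel]
  rw [hasFDerivAt_pi']
  intro i
  fin_cases i
  · refine ((h0.cos.mul h1.sin).mul hd).congr_fderiv ?_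
    ext v
    simp [bipolarJacobian, Matrix.toLin'_apply, dotProduct, Fin.sum_univ_three]
    linear_combination (Real.cos (p 0) * Real.cos (p 1) * v 1 -
      Real.sin (p 1) * Real.sin (p 0) * v 0) * hi -
      (Real.sin (p 0 - p 1) ^ 2)⁻¹ * Real.sin (p 1) * v 0 * k₁ +
      (Real.sin (p 0 - p 1) ^ 2)⁻¹ * Real.cos (p 0) * v 1 * k₂
  · refine (hr.mul h2.cos).congr_fderiv ?_
    ext v
    simp [bipolarJacobian, Matrix.toLin'_apply, dotProduct, Fin.sum_univ_three]
    linear_combination Real.cos (p 2) * (Real.sin (p 0) * Real.cos (p 1) * v 1 +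
      Real.sin (p 1) * Real.cos (p 0) * v 0) * hi -
      Real.cos (p 2) * (Real.sin (p 0 - p 1) ^ 2)⁻¹ * Real.sin (p 1) * v 0 * k₃ +
      Real.cos (p 2) * (Real.sin (p 0 - p 1) ^ 2)⁻¹ * Real.sin (p 0) * v 1 * k₂
  · refine (hr.mul h2.sin).congr_fderiv ?_
    ext v
    simp [bipolarJacobian, Matrix.toLin'_apply, dotProduct, Fin.sum_univ_three]
    linear_combination Real.sin (p 2) * (Real.sin (p 0) * Real.cos (p 1) * v 1 +
      Real.sin (p 1) * Real.cos (p 0) * v 0) * hi -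
      Real.sin (p 2) * (Real.sin (p 0 - p 1) ^ 2)⁻¹ * Real.sin (p 1) * v 0 * k₃ +
      Real.sin (p 2) * (Real.sin (p 0 - p 1) ^ 2)⁻¹ * Real.sin (p 0) * v 1 * k₂

lemma det_bipolarJacobian {p : Fin 3 → ℝ} (hp : Real.sin (p 0 - p 1) ≠ 0) :
    (bipolarJacobian p).det =
      -(Real.sin (p 0) ^ 2 * Real.sin (p 1) ^ 2 / Real.sin (p 0 - p 1) ^ 4) := by
  have hs : Real.cos (p 2) ^ 2 = 1 - Real.sin (p 2) ^ 2 := Real.cos_sq' _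
  rw [bipolarJacobian, Matrix.det_fin_three]
  simp
  have hd := Real.sin_sub (p 0) (p 1)
  generalize Real.sin (p 0 - p 1) = d at *
  field_simp
  rw [hs, hd]
  ring

lemma volume_bipolar_image_le (σ₁ σ₂ a q δ : ℝ) :
    volume (bipolar '' angleSet σ₁ σ₂ a q δ) ≤ 4 * volume (angleSet σ₁ σ₂ a q δ) := by
  have hpos : ∀ p ∈ angleSet σ₁ σ₂ a q δ, 0 < Real.sin (p 0 - p 1) := by
    rintro p ⟨-, h0, h1, h2, -⟩
    exact Real.sin_pos_of_pos_of_lt_pi (sub_pos.2 h1) (by linarith)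
  refine (addHaar_image_le_lintegral_abs_det_fderiv volume (measurableSet_angleSet σ₁ σ₂ a q δ)
    fun p hp ↦ (hasFDerivAt_bipolar (hpos p hp).ne').hasFDerivWithinAt).trans ?_
  refine (setLIntegral_mono' (g := fun _ ↦ 4) (measurableSet_angleSet σ₁ σ₂ a q δ) ?_).trans
    (setLIntegral_const _ _).le
  intro p hp
  have hd := hpos p hp
  obtain ⟨-, h0, h1, h2, h3, -⟩ := hp
  have hβ := Real.sin_pos_of_pos_of_lt_pi h0 (h1.trans h2)
  have hα := Real.sin_pos_of_pos_of_lt_pi (h0.trans h1) h2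
  have hα2 : Real.sin (p 0) ≤ 2 * Real.sin (p 0 - p 1) := by
    have e : Real.sin (p 0) = Real.sin (p 0 - p 1) * Real.cos (p 1) +
        Real.cos (p 0 - p 1) * Real.sin (p 1) := by
      rw [← Real.sin_add, sub_add_cancel]
    have e1 := mul_le_mul_of_nonneg_left (Real.cos_le_one (p 1)) hd.le
    have e2 := mul_le_mul_of_nonneg_right (Real.cos_le_one (p 0 - p 1)) hβ.le
    simp only at h3
    linarith
  rw [ContinuousLinearMap.det, LinearMap.coe_toContinuousLinearMap, LinearMap.det_toLin',
    det_bipolarJacobian hd.ne', abs_neg, abs_of_nonneg (by positivity)]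
  rw [show (4 : ℝ≥0∞) = ENNReal.ofReal 4 by simp]
  refine ENNReal.ofReal_le_ofReal ?_
  rw [div_le_iff₀ (by positivity)]
  calc Real.sin (p 0) ^ 2 * Real.sin (p 1) ^ 2
      ≤ (2 * Real.sin (p 0 - p 1)) ^ 2 * Real.sin (p 0 - p 1) ^ 2 := by
        gcongr
    _ = 4 * Real.sin (p 0 - p 1) ^ 4 := by ring

lemma exists_bipolar_eq {x y z : ℝ} (hy : y ≠ 0) :
    ∃ p : Fin 3 → ℝ, bipolar p = ![x, y, z] ∧ p 2 ∈ Set.Icc (-Real.pi) Real.pi ∧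
      0 < p 1 ∧ p 1 < p 0 ∧ p 0 < Real.pi ∧
      0 < Real.sqrt (x ^ 2 + y ^ 2 + z ^ 2) ∧
      0 < Real.sqrt ((1 + x) ^ 2 + y ^ 2 + z ^ 2) ∧
      Real.sin (p 1) = Real.sqrt (x ^ 2 + y ^ 2 + z ^ 2) * Real.sin (p 0 - p 1) ∧
      x = Real.sqrt (x ^ 2 + y ^ 2 + z ^ 2) * Real.cos (p 0) ∧
      z = Real.sqrt (x ^ 2 + y ^ 2 + z ^ 2) * (Real.sin (p 0) * Real.sin (p 2)) ∧
      1 + x = Real.sqrt ((1 + x) ^ 2 + y ^ 2 + z ^ 2) * Real.cos (p 1) ∧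
      z = Real.sqrt ((1 + x) ^ 2 + y ^ 2 + z ^ 2) * (Real.sin (p 1) * Real.sin (p 2)) := by
  have hy2 : 0 < y ^ 2 := by positivity
  set ρ := ‖(⟨y, z⟩ : ℂ)‖ with hρ
  have hρsq : ρ ^ 2 = y ^ 2 + z ^ 2 := by
    rw [hρ, Complex.norm_eq_sqrt_sq_add_sq, Real.sq_sqrt (by positivity)]
  have hρ0 : 0 < ρ := norm_pos_iff.2 fun h ↦ hy (congrArg Complex.re h)
  have polar : ∀ t : ℝ, ∃ θ : ℝ, 0 < θ ∧ θ < Real.pi ∧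
      0 < Real.sqrt (t ^ 2 + y ^ 2 + z ^ 2) ∧
      t = Real.sqrt (t ^ 2 + y ^ 2 + z ^ 2) * Real.cos θ ∧
      ρ = Real.sqrt (t ^ 2 + y ^ 2 + z ^ 2) * Real.sin θ := fun t ↦ by
    have hn : ‖(⟨t, ρ⟩ : ℂ)‖ = Real.sqrt (t ^ 2 + y ^ 2 + z ^ 2) := by
      rw [Complex.norm_eq_sqrt_sq_add_sq, hρsq, add_assoc]
    have hr : 0 < Real.sqrt (t ^ 2 + y ^ 2 + z ^ 2) := Real.sqrt_pos.2 (by positivity)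
    have hs : ρ = Real.sqrt (t ^ 2 + y ^ 2 + z ^ 2) * Real.sin (Complex.arg ⟨t, ρ⟩) := by
      rw [← hn, Complex.norm_mul_sin_arg]
    have hsin : 0 < Real.sin (Complex.arg ⟨t, ρ⟩) := by
      by_contra hcon
      nlinarith
    have h0 : 0 ≤ Complex.arg ⟨t, ρ⟩ := Complex.arg_nonneg_iff.2 hρ0.le
    refine ⟨Complex.arg ⟨t, ρ⟩, h0.lt_of_ne ?_, (Complex.arg_le_pi _).lt_of_ne ?_, hr, ?_, hs⟩
    · intro h
      rw [← h, Real.sin_zero] at hsin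
      exact hsin.false
    · intro h
      rw [h, Real.sin_pi] at hsin
      exact hsin.false
    · rw [← hn, Complex.norm_mul_cos_arg]
  obtain ⟨α, hα0, hαπ, hr, hxr, hρr⟩ := polar x
  obtain ⟨β, hβ0, hβπ, hs, hxs, hρs⟩ := polar (1 + x)
  set r := Real.sqrt (x ^ 2 + y ^ 2 + z ^ 2)
  set s := Real.sqrt ((1 + x) ^ 2 + y ^ 2 + z ^ 2)
  have hyφ : ρ * Real.cos (Complex.arg ⟨y, z⟩) = y := by rw [hρ, Complex.norm_mul_cos_arg]
  have hzφ : ρ * Real.sin (Complex.arg ⟨y, z⟩) = z := by rw [hρ, Complex.norm_mul_sin_arg]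
  set φ := Complex.arg ⟨y, z⟩ with hφ
  have hd : r * s * Real.sin (α - β) = ρ := by
    rw [Real.sin_sub]
    linear_combination (-(s * Real.cos β)) * hρr - ρ * hxs + s * Real.sin β * hxr + x * hρs
  have hdpos : 0 < Real.sin (α - β) := by
    by_contra hcon
    nlinarith [mul_pos hr hs]
  have hβα : β < α := by
    by_contra! hcon
    have : Real.sin (α - β) ≤ 0 :=
      Real.sin_nonpos_of_nonpos_of_neg_pi_le (by linarith) (by linarith)
    linarith
  have hsβ : Real.sin β = r * Real.sin (α - β) := by
    have : s * (Real.sin β - r * Real.sin (α - β)) = 0 := by linear_combination -hρs - hd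
    rcases mul_eq_zero.1 this with h | h <;> linarith
  have e1 : Real.sin α * Real.sin β / Real.sin (α - β) = ρ := by
    rw [hsβ, hρr]; field_simp
  have e2 : Real.cos α * Real.sin β / Real.sin (α - β) = x := by
    rw [hsβ, hxr]; field_simp
  refine ⟨![α, β, φ], ?_, ⟨(Complex.neg_pi_lt_arg _).le, Complex.arg_le_pi _⟩, hβ0, hβα, hαπ,
    hr, hs, hsβ, hxr, ?_, hxs, ?_⟩
  · ext i
    fin_cases i
    · exact e2
    · change Real.sin α * Real.sin β / Real.sin (α - β) * Real.cos φ = y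
      rw [e1, hyφ]
    · change Real.sin α * Real.sin β / Real.sin (α - β) * Real.sin φ = z
      rw [e1, hzφ]
  · change z = r * (Real.sin α * Real.sin φ)
    rw [← mul_assoc, ← hρr, hzφ]
  · change z = s * (Real.sin β * Real.sin φ)
    rw [← mul_assoc, ← hρs, hzφ]

/-- The matrix of a frame adapted to the wavevector with polar data `(a, q, u, v)` and length `N`,
in the unscaled coordinates. -/
def frameMatrix (L₁ L₂ N a q u v : ℝ) : Matrix (Fin 3) (Fin 3) ℝ :=
  !![L₁ * N * (q * u), L₁ * N * v, -(L₁ * N * (a * u));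
    L₂ * N * (q * v), -(L₂ * N * u), -(L₂ * N * (a * v));
    N * a, 0, N * q]

lemma det_frameMatrix {L₁ L₂ N a q u v : ℝ} (haq : a ^ 2 + q ^ 2 = 1) (huv : u ^ 2 + v ^ 2 = 1) :
    (frameMatrix L₁ L₂ N a q u v).det = -(L₁ * L₂ * N ^ 3) := by
  rw [frameMatrix, Matrix.det_fin_three]
  simp
  linear_combination (-(L₁ * L₂ * N ^ 3)) * ((a ^ 2 + q ^ 2) * huv + haq)

lemma frameMatrix_apply (L₁ L₂ N a q u v x y z : ℝ) :
    Matrix.toLin' (frameMatrix L₁ L₂ N a q u v) ![x, y, z] =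
      ![L₁ * (N * (q * u * x + v * y - a * u * z)), L₂ * (N * (q * v * x - u * y - a * v * z)),
        N * (a * x + q * z)] := by
  ext i
  fin_cases i
  all_goals
    simp [frameMatrix, Matrix.toLin'_apply, Matrix.mulVec_eq_sum, Fin.sum_univ_three]
    ring

lemma rnorm_eq_of_frame {L₁ L₂ N a q u v x y z : ℝ} (hL₁ : L₁ ≠ 0) (hL₂ : L₂ ≠ 0) (hN : 0 ≤ N)
    (haq : a ^ 2 + q ^ 2 = 1) (huv : u ^ 2 + v ^ 2 = 1) {k : Fin 3 → ℝ}
    (h0 : k 0 = L₁ * (N * (q * u * x + v * y - a * u * z)))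
    (h1 : k 1 = L₂ * (N * (q * v * x - u * y - a * v * z))) (h2 : k 2 = N * (a * x + q * z)) :
    rnorm L₁ L₂ k = N * Real.sqrt (x ^ 2 + y ^ 2 + z ^ 2) := by
  rw [rnorm, h0, h1, h2, mul_div_cancel_left₀ _ hL₁, mul_div_cancel_left₀ _ hL₂]
  conv_rhs => rw [← Real.sqrt_sq hN, ← Real.sqrt_mul (sq_nonneg N)]
  congr 1
  linear_combination N ^ 2 * ((q ^ 2 * x ^ 2 + y ^ 2 + a ^ 2 * z ^ 2 - 2 * q * a * x * z) * huv +
    (x ^ 2 + z ^ 2) * haq)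

set_option maxHeartbeats 1000000 in
lemma Vset_subset {L₁ L₂ σ₁ σ₂ δ N a q u v : ℝ} {n : Fin 3 → ℝ} (hL₁ : 0 < L₁) (hL₂ : 0 < L₂)
    (hN : 0 < N) (haq : a ^ 2 + q ^ 2 = 1) (huv : u ^ 2 + v ^ 2 = 1) (h0 : n 0 = L₁ * (N * (q * u)))
    (h1 : n 1 = L₂ * (N * (q * v))) (h2 : n 2 = N * a) :
    Vset L₁ L₂ σ₁ σ₂ δ n ⊆
      Matrix.toLin' (frameMatrix L₁ L₂ N a q u v) '' (bipolar '' angleSet σ₁ σ₂ a q δ) ∪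
        {k | v * (k 0 / L₁) - u * (k 1 / L₂) = 0} := by
  rintro k ⟨-, -, hF, -, hkn⟩
  by_cases hy : v * (k 0 / L₁) - u * (k 1 / L₂) = 0
  · exact Or.inr hy
  left
  obtain ⟨y, hydef⟩ : ∃ y, y = (v * (k 0 / L₁) - u * (k 1 / L₂)) / N := ⟨_, rfl⟩
  obtain ⟨x, hxdef⟩ : ∃ x, x = (q * u * (k 0 / L₁) + q * v * (k 1 / L₂) + a * k 2) / N := ⟨_, rfl⟩
  obtain ⟨z, hzdef⟩ : ∃ z, z = (-a * u * (k 0 / L₁) - a * v * (k 1 / L₂) + q * k 2) / N :=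
    ⟨_, rfl⟩
  have hy0 : y ≠ 0 := hydef ▸ div_ne_zero hy hN.ne'
  have ex : N * x = q * u * (k 0 / L₁) + q * v * (k 1 / L₂) + a * k 2 := by
    rw [hxdef]; field_simp
  have ey : N * y = v * (k 0 / L₁) - u * (k 1 / L₂) := by
    rw [hydef]; field_simp
  have ez : N * z = -a * u * (k 0 / L₁) - a * v * (k 1 / L₂) + q * k 2 := by
    rw [hzdef]; field_simp
  have k0 : k 0 = L₁ * (N * (q * u * x + v * y - a * u * z)) := by
    have : k 0 / L₁ = N * (q * u * x + v * y - a * u * z) := by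
      linear_combination (-(q * u)) * ex - v * ey + a * u * ez -
        (u ^ 2 * (k 0 / L₁) + u * v * (k 1 / L₂)) * haq - (k 0 / L₁) * huv
    rw [← this]; field_simp
  have k1 : k 1 = L₂ * (N * (q * v * x - u * y - a * v * z)) := by
    have : k 1 / L₂ = N * (q * v * x - u * y - a * v * z) := by
      linear_combination (-(q * v)) * ex + u * ey + a * v * ez -
        (u * v * (k 0 / L₁) + v ^ 2 * (k 1 / L₂)) * haq - (k 1 / L₂) * huv
    rw [← this]; field_simp
  have k2 : k 2 = N * (a * x + q * z) := by
    linear_combination (-a) * ex - q * ez - k 2 * haq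
  have hn : rnorm L₁ L₂ n = N := by
    rw [rnorm_eq_of_frame (x := 1) (y := 0) (z := 0) hL₁.ne' hL₂.ne' hN.le haq huv
      (by rw [h0]; ring) (by rw [h1]; ring) (by rw [h2]; ring)]
    norm_num
  have hk := rnorm_eq_of_frame hL₁.ne' hL₂.ne' hN.le haq huv k0 k1 k2
  have hm : rnorm L₁ L₂ (-n - k) = N * Real.sqrt ((1 + x) ^ 2 + y ^ 2 + z ^ 2) := by
    rw [rnorm_eq_of_frame (x := -(1 + x)) (y := -y) (z := -z) hL₁.ne' hL₂.ne' hN.le haq huv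
      (by simp only [Pi.sub_apply, Pi.neg_apply]; rw [h0, k0]; ring)
      (by simp only [Pi.sub_apply, Pi.neg_apply]; rw [h1, k1]; ring)
      (by simp only [Pi.sub_apply, Pi.neg_apply]; rw [h2, k2]; ring)]
    simp only [neg_sq]
  obtain ⟨p, hp, hφ, hβ0, hβα, hαπ, hr, hs, hsβ, hxr, hzr, hxs, hzs⟩ :=
    exists_bipolar_eq (x := x) (z := z) hy0
  refine ⟨_, ⟨p, ⟨hφ, hβ0, hβα, hαπ, ?_, ?_⟩, hp⟩, ?_⟩
  · change Real.sin (p 1) ≤ Real.sin (p 0 - p 1)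
    have hd : 0 < Real.sin (p 0 - p 1) :=
      Real.sin_pos_of_pos_of_lt_pi (sub_pos.2 hβα) (by linarith)
    rw [hk, hn] at hkn
    have : Real.sqrt (x ^ 2 + y ^ 2 + z ^ 2) ≤ 1 :=
      (mul_le_iff_le_one_right hN).1 hkn
    rw [hsβ]
    exact mul_le_of_le_one_left hd.le this
  · change |a * (σ₁ + σ₂ * Real.cos (p 0) - Real.cos (p 1)) +
      q * Real.sin (p 2) * (σ₂ * Real.sin (p 0) - Real.sin (p 1))| ≤ δ
    have en : n 2 / rnorm L₁ L₂ n = a := by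
      rw [hn, h2]; field_simp
    have ek : k 2 / rnorm L₁ L₂ k =
        a * Real.cos (p 0) + q * (Real.sin (p 0) * Real.sin (p 2)) := by
      rw [hk, div_eq_iff (by positivity), k2]
      linear_combination N * a * hxr + N * q * hzr
    have em : (-n - k) 2 / rnorm L₁ L₂ (-n - k) =
        -(a * Real.cos (p 1) + q * (Real.sin (p 1) * Real.sin (p 2))) := by
      rw [hm, div_eq_iff (by positivity), Pi.sub_apply, Pi.neg_apply, k2, h2]
      linear_combination (-(N * a)) * hxs - N * q * hzs
    rw [Ffun, en, ek, em] at hF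
    calc _ = _ := by congr 1; ring
      _ ≤ δ := hF
  · rw [frameMatrix_apply]
    ext i
    fin_cases i
    · exact k0.symm
    · exact k1.symm
    · exact k2.symm

lemma volume_plane_eq_zero {b c : ℝ} (h : b ≠ 0 ∨ c ≠ 0) :
    volume {k : Fin 3 → ℝ | b * k 0 + c * k 1 = 0} = 0 := by
  let f : (Fin 3 → ℝ) →ₗ[ℝ] ℝ := b • LinearMap.proj 0 + c • LinearMap.proj 1
  refine Measure.addHaar_submodule volume (LinearMap.ker f) fun htop ↦ ?_
  have hf : f = 0 := LinearMap.ker_eq_top.1 htop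
  rcases h with h | h
  · exact h (by simpa [f] using LinearMap.congr_fun hf ![1, 0, 0])
  · exact h (by simpa [f] using LinearMap.congr_fun hf ![0, 1, 0])

lemma volume_Vset_le {L₁ L₂ σ₁ σ₂ δ N a q u v : ℝ} {n : Fin 3 → ℝ} (hL₁ : 0 < L₁) (hL₂ : 0 < L₂)
    (h₁ : σ₁ = 1 ∨ σ₁ = -1) (h₂ : σ₂ = 1 ∨ σ₂ = -1) (hδ : 0 < δ)
    (hN : 0 < N) (haq : a ^ 2 + q ^ 2 = 1) (huv : u ^ 2 + v ^ 2 = 1) (h0 : n 0 = L₁ * (N * (q * u)))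
    (h1 : n 1 = L₂ * (N * (q * v))) (h2 : n 2 = N * a) :
    volume (Vset L₁ L₂ σ₁ σ₂ δ n) ≤ ENNReal.ofReal (L₁ * L₂ * N ^ 3 * (4 * (4800 * δ *
      (2 * Real.pi * (Real.log (δ + 2 * |a| + 2) - Real.log (δ + 2 * |a|)))))) := by
  have hplane : volume {k : Fin 3 → ℝ | v * (k 0 / L₁) - u * (k 1 / L₂) = 0} = 0 := by
    have h : v / L₁ ≠ 0 ∨ -(u / L₂) ≠ 0 := by
      by_contra! hcon
      have hv : v = 0 := by simpa [hL₁.ne'] using hcon.1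
      have hu : u = 0 := by simpa [hL₂.ne'] using hcon.2
      simp [hu, hv] at huv
    convert volume_plane_eq_zero h using 5
    ring
  refine (measure_mono (Vset_subset hL₁ hL₂ hN haq huv h0 h1 h2)).trans
    ((measure_union_le _ _).trans ?_)
  rw [hplane, add_zero, Measure.addHaar_image_linearMap, LinearMap.det_toLin',
    det_frameMatrix haq huv, abs_neg, abs_of_pos (by positivity),
    ENNReal.ofReal_mul (p := L₁ * L₂ * N ^ 3) (by positivity), ENNReal.ofReal_mul (p := 4) (by norm_num)]
  gcongr
  refine (volume_bipolar_image_le σ₁ σ₂ a q δ).trans ?_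
  rw [show (4 : ℝ≥0∞) = ENNReal.ofReal 4 by simp]
  gcongr
  exact volume_angleSet_le h₁ h₂ haq hδ

theorem stmt7 :
    ∃ C : ℝ, ∀ L₁ L₂ : ℝ, 0 < L₁ → 0 < L₂ →
    ∀ δ : ℝ, 0 < δ → δ < 1 / 2 →
    ∀ n : Fin 3 → ℤ, n ≠ 0 →
    ∀ σ₁ σ₂ : ℝ, (σ₁ = 1 ∨ σ₁ = -1) → (σ₂ = 1 ∨ σ₂ = -1) →
    (MeasureTheory.volume (Vset L₁ L₂ σ₁ σ₂ δ (fun i => (n i : ℝ)))).toReal /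
        (L₁ * L₂ * cnorm L₁ L₂ n ^ 3)
      ≤ C * (δ + δ * max (Real.log (1 / (δ + 2 * |(n 2 : ℝ)| / cnorm L₁ L₂ n))) 0) := by
  refine ⟨640000, fun L₁ L₂ hL₁ hL₂ δ hδ hδ2 n hn σ₁ σ₂ h₁ h₂ ↦ ?_⟩
  have hNdef : cnorm L₁ L₂ n =
      Real.sqrt ((n 0 / L₁) ^ 2 + (n 1 / L₂) ^ 2 + (n 2 : ℝ) ^ 2) := rfl
  set N := cnorm L₁ L₂ n
  have hNsq : N ^ 2 = (n 0 / L₁) ^ 2 + (n 1 / L₂) ^ 2 + (n 2 : ℝ) ^ 2 := by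
    rw [hNdef, Real.sq_sqrt (by positivity)]
  have hN : 0 < N := by
    refine (hNdef ▸ Real.sqrt_nonneg _ : 0 ≤ N).lt_of_ne' fun h ↦ hn ?_
    rw [h] at hNsq
    have e0 : (n 0 / L₁ : ℝ) = 0 := by
      nlinarith [sq_nonneg (n 0 / L₁ : ℝ), sq_nonneg (n 1 / L₂ : ℝ), sq_nonneg (n 2 : ℝ)]
    have e1 : (n 1 / L₂ : ℝ) = 0 := by
      nlinarith [sq_nonneg (n 0 / L₁ : ℝ), sq_nonneg (n 1 / L₂ : ℝ), sq_nonneg (n 2 : ℝ)]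
    have e2 : (n 2 : ℝ) = 0 := by
      nlinarith [sq_nonneg (n 0 / L₁ : ℝ), sq_nonneg (n 1 / L₂ : ℝ), sq_nonneg (n 2 : ℝ)]
    ext i
    fin_cases i
    · simpa [hL₁.ne'] using e0
    · simpa [hL₂.ne'] using e1
    · simpa using e2
  set w : ℂ := ⟨n 0 / L₁, n 1 / L₂⟩ with hw
  have hwsq : ‖w‖ ^ 2 = (n 0 / L₁) ^ 2 + (n 1 / L₂ : ℝ) ^ 2 := by
    rw [hw, Complex.norm_eq_sqrt_sq_add_sq, Real.sq_sqrt (by positivity)]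
  have haq : ((n 2 : ℝ) / N) ^ 2 + (‖w‖ / N) ^ 2 = 1 := by
    rw [div_pow, div_pow, hwsq, ← add_div, div_eq_one_iff_eq (by positivity), hNsq]
    ring
  have hvol := volume_Vset_le (n := fun i ↦ (n i : ℝ)) hL₁ hL₂ h₁ h₂ hδ hN haq
    (Real.cos_sq_add_sin_sq w.arg)
    (by
      have h : N * (‖w‖ / N * Real.cos w.arg) = n 0 / L₁ := by
        rw [← mul_assoc, mul_div_cancel₀ _ hN.ne', Complex.norm_mul_cos_arg]
      rw [h, mul_div_cancel₀ _ hL₁.ne'])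
    (by
      have h : N * (‖w‖ / N * Real.sin w.arg) = n 1 / L₂ := by
        rw [← mul_assoc, mul_div_cancel₀ _ hN.ne', Complex.norm_mul_sin_arg]
      rw [h, mul_div_cancel₀ _ hL₂.ne'])
    (by field_simp)
  have habs : |(n 2 : ℝ) / N| = |(n 2 : ℝ)| / N := by rw [abs_div, abs_of_pos hN]
  rw [habs, ← mul_div_assoc] at hvol
  set η := δ + 2 * |(n 2 : ℝ)| / N with hη
  have hη0 : 0 < η := by positivity
  have hη2 : η ≤ 5 / 2 := by
    have : |(n 2 : ℝ) / N| ≤ 1 := by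
      rw [← sq_le_one_iff_abs_le_one]
      nlinarith [sq_nonneg (‖w‖ / N)]
    rw [habs] at this
    rw [hη, mul_div_assoc]
    linarith
  have hlog1 : Real.log (η + 2) ≤ 7 / 2 := by
    linarith [Real.log_le_sub_one_of_pos (show 0 < η + 2 by linarith)]
  have hlog2 : -Real.log η ≤ max (Real.log (1 / η)) 0 := by
    rw [one_div, Real.log_inv]
    exact le_max_left _ _
  have hlog3 : 0 ≤ Real.log (η + 2) - Real.log η :=
    sub_nonneg.2 (Real.log_le_log hη0 (by linarith))
  have hM : 0 ≤ max (Real.log (1 / η)) 0 := le_max_right _ _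
  rw [div_le_iff₀ (by positivity)]
  refine (ENNReal.toReal_le_of_le_ofReal (by positivity) hvol).trans ?_
  rw [mul_comm (640000 * _)]
  refine mul_le_mul_of_nonneg_left ?_ (by positivity)
  calc 4 * (4800 * δ * (2 * Real.pi * (Real.log (η + 2) - Real.log η)))
      ≤ 4 * (4800 * δ * (2 * 4 * (4 * (1 + max (Real.log (1 / η)) 0)))) := by
        gcongr
        · exact Real.pi_le_four
        · linarith
    _ ≤ 640000 * (δ + δ * max (Real.log (1 / η)) 0) := by
        nlinarith [mul_nonneg hδ.le hM]
end

section
/- Let θ_m, θ_k, θ_n be real numbers, set 𝒞^{σ_k,σ_n} := cos(θ_m + σ_k θ_k + σ_n θ_n) for σ_k, σ_n ∈ {+1,−1}, and set c_n := cos θ_n, c_k := cos θ_k, c_m := cos θ_m. Then for every permutation π of four elements and every Π ∈ {Π_IL, Π_EC, Π_SP}: Π( π(𝒞^{++}, 𝒞^{+−}, 𝒞^{−+}, 𝒞^{−−}) ) = 4 · Π( π(1, c_n², c_k², c_m²) ). -/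
open scoped BigOperators

/-- Interlaced product of differences `Π_IL(a,b,c,d) = (a-c)(b-d)`. -/
noncomputable def PiIL (v : Fin 4 → ℝ) : ℝ := (v 0 - v 2) * (v 1 - v 3)

/-- Enclosed product of differences `Π_EC(a,b,c,d) = (a-d)(b-c)`. -/
noncomputable def PiEC (v : Fin 4 → ℝ) : ℝ := (v 0 - v 3) * (v 1 - v 2)

/-- Separated product of differences `Π_SP(a,b,c,d) = (a-b)(c-d)`. -/
noncomputable def PiSP (v : Fin 4 → ℝ) : ℝ := (v 0 - v 1) * (v 2 - v 3)

/-- The quadruple `(𝒞^{++}, 𝒞^{+-}, 𝒞^{-+}, 𝒞^{--})` where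
`𝒞^{σ_k,σ_n} = cos(θ_m + σ_k θ_k + σ_n θ_n)`. -/
noncomputable def Cquad (θm θk θn : ℝ) : Fin 4 → ℝ :=
  ![Real.cos (θm + θk + θn), Real.cos (θm + θk - θn),
    Real.cos (θm - θk + θn), Real.cos (θm - θk - θn)]

/-- The quadruple `(1, c_n², c_k², c_m²)`. -/
noncomputable def sigquad (θm θk θn : ℝ) : Fin 4 → ℝ :=
  ![1, Real.cos θn ^ 2, Real.cos θk ^ 2, Real.cos θm ^ 2]

/-- If two quadruples have proportional interlaced, enclosed and separated products with a common
factor, this persists after exchanging two entries. -/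
lemma products_comp_swap {v w : Fin 4 → ℝ} {r : ℝ}
    (h : PiIL v = r * PiIL w ∧ PiEC v = r * PiEC w ∧ PiSP v = r * PiSP w) (x y : Fin 4) :
    PiIL (v ∘ Equiv.swap x y) = r * PiIL (w ∘ Equiv.swap x y) ∧
    PiEC (v ∘ Equiv.swap x y) = r * PiEC (w ∘ Equiv.swap x y) ∧
    PiSP (v ∘ Equiv.swap x y) = r * PiSP (w ∘ Equiv.swap x y) := by
  simp only [PiIL, PiEC, PiSP] at h
  obtain ⟨h₁, h₂, h₃⟩ := h
  fin_cases x <;> fin_cases y <;>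
    simp [PiIL, PiEC, PiSP, Equiv.swap_apply_def] <;>
    refine ⟨?_, ?_, ?_⟩ <;> linarith

lemma products_comp_perm {v w : Fin 4 → ℝ} {r : ℝ}
    (h : PiIL v = r * PiIL w ∧ PiEC v = r * PiEC w ∧ PiSP v = r * PiSP w)
    (π : Equiv.Perm (Fin 4)) :
    PiIL (v ∘ π) = r * PiIL (w ∘ π) ∧
    PiEC (v ∘ π) = r * PiEC (w ∘ π) ∧
    PiSP (v ∘ π) = r * PiSP (w ∘ π) := by
  induction π using Equiv.Perm.swap_induction_on' with
  | one => simpa using h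
  | mul_swap f x y _ ih => exact products_comp_swap ih x y

lemma products_Cquad (θm θk θn : ℝ) :
    PiIL (Cquad θm θk θn) = 4 * PiIL (sigquad θm θk θn) ∧
    PiEC (Cquad θm θk θn) = 4 * PiEC (sigquad θm θk θn) ∧
    PiSP (Cquad θm θk θn) = 4 * PiSP (sigquad θm θk θn) := by
  have hm := Real.sin_sq_add_cos_sq θm
  have hk := Real.sin_sq_add_cos_sq θk
  have hn := Real.sin_sq_add_cos_sq θn
  simp [PiIL, PiEC, PiSP, Cquad, sigquad, Real.cos_add, Real.cos_sub, Real.sin_add, Real.sin_sub]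
  refine ⟨?_, ?_, ?_⟩ <;> grind

theorem stmt8 (θm θk θn : ℝ) (π : Equiv.Perm (Fin 4)) :
    PiIL (Cquad θm θk θn ∘ π) = 4 * PiIL (sigquad θm θk θn ∘ π) ∧
    PiEC (Cquad θm θk θn ∘ π) = 4 * PiEC (sigquad θm θk θn ∘ π) ∧
    PiSP (Cquad θm θk θn ∘ π) = 4 * PiSP (sigquad θm θk θn ∘ π) :=
  products_comp_perm (products_Cquad θm θk θn) π
end

section
/- Let θ_m, θ_k, θ_n be real numbers, set 𝒞^{σ_k,σ_n} := cos(θ_m + σ_k θ_k + σ_n θ_n) for σ_k, σ_n ∈ {+1,−1}, and set c_n := cos θ_n, c_k := cos θ_k, c_m := cos θ_m. Assume the four numbers 1, c_n², c_k², c_m² are pairwise distinct. Let 𝒞_s be the quadruple (𝒞^{++}, 𝒞^{+−}, 𝒞^{−+}, 𝒞^{−−}) rearranged in strictly descending order, and let ς_s be the quadruple (1, c_n², c_k², c_m²) rearranged in strictly descending order. Then for every Π ∈ {Π_IL, Π_EC, Π_SP}: Π(𝒞_s) = 4 · Π(ς_s). -/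
open scoped BigOperators

/-- Up to a common sign, permuting a quadruple permutes `PiSP`, `-PiIL` and `PiEC`:
cyclically for even permutations, and by a transposition with a sign for odd ones. -/
lemma Pi_comp_perm (x : Fin 4 → ℝ) (π : Equiv.Perm (Fin 4)) :
    (PiSP (x ∘ π) = PiSP x ∧ PiIL (x ∘ π) = PiIL x ∧ PiEC (x ∘ π) = PiEC x) ∨
    (PiSP (x ∘ π) = -PiIL x ∧ PiIL (x ∘ π) = -PiEC x ∧ PiEC (x ∘ π) = PiSP x) ∨
    (PiSP (x ∘ π) = PiEC x ∧ PiIL (x ∘ π) = -PiSP x ∧ PiEC (x ∘ π) = -PiIL x) ∨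
    (PiSP (x ∘ π) = PiIL x ∧ PiIL (x ∘ π) = PiSP x ∧ PiEC (x ∘ π) = -PiEC x) ∨
    (PiSP (x ∘ π) = -PiEC x ∧ PiIL (x ∘ π) = -PiIL x ∧ PiEC (x ∘ π) = -PiSP x) ∨
    (PiSP (x ∘ π) = -PiSP x ∧ PiIL (x ∘ π) = PiEC x ∧ PiEC (x ∘ π) = PiIL x) := by
  have h01 : π 0 ≠ π 1 := π.injective.ne (by decide)
  have h02 : π 0 ≠ π 2 := π.injective.ne (by decide)
  have h03 : π 0 ≠ π 3 := π.injective.ne (by decide)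
  have h12 : π 1 ≠ π 2 := π.injective.ne (by decide)
  have h13 : π 1 ≠ π 3 := π.injective.ne (by decide)
  have h23 : π 2 ≠ π 3 := π.injective.ne (by decide)
  simp only [PiSP, PiIL, PiEC, Function.comp_apply]
  generalize π 0 = i at *
  generalize π 1 = j at *
  generalize π 2 = k at *
  generalize π 3 = l at *
  fin_cases i <;> fin_cases j <;> first | exact absurd rfl h01 | skip
  all_goals fin_cases k <;> first | exact absurd rfl h02 | exact absurd rfl h12 | skip
  all_goals
    fin_cases l <;>
      first | exact absurd rfl h03 | exact absurd rfl h13 | exact absurd rfl h23 | skip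
  all_goals
    clear h01 h02 h03 h12 h13 h23
    dsimp only [Fin.zero_eta, Fin.mk_one, Fin.reduceFinMk]
    first
    | exact Or.inl ⟨by ring1, by ring1, by ring1⟩
    | exact Or.inr (Or.inl ⟨by ring1, by ring1, by ring1⟩)
    | exact Or.inr (Or.inr (Or.inl ⟨by ring1, by ring1, by ring1⟩))
    | exact Or.inr (Or.inr (Or.inr (Or.inl ⟨by ring1, by ring1, by ring1⟩)))
    | exact Or.inr (Or.inr (Or.inr (Or.inr (Or.inl ⟨by ring1, by ring1, by ring1⟩))))
    | exact Or.inr (Or.inr (Or.inr (Or.inr (Or.inr ⟨by ring1, by ring1, by ring1⟩))))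

lemma Pi_pos_of_descending {v : Fin 4 → ℝ} (hv : ∀ i j : Fin 4, i < j → v j < v i) :
    0 < PiSP v ∧ 0 < PiIL v ∧ 0 < PiEC v :=
  ⟨mul_pos (sub_pos.2 (hv 0 1 (by decide))) (sub_pos.2 (hv 2 3 (by decide))),
    mul_pos (sub_pos.2 (hv 0 2 (by decide))) (sub_pos.2 (hv 1 3 (by decide))),
    mul_pos (sub_pos.2 (hv 0 3 (by decide))) (sub_pos.2 (hv 1 2 (by decide)))⟩

lemma PiSP_Cquad (θm θk θn : ℝ) :
    PiSP (Cquad θm θk θn) = 4 * PiSP (sigquad θm θk θn) := by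
  simp only [PiSP, Cquad, sigquad, Matrix.cons_val, Real.cos_add, Real.cos_sub, Real.sin_add,
    Real.sin_sub]
  grind [Real.sin_sq_add_cos_sq θm, Real.sin_sq_add_cos_sq θk, Real.sin_sq_add_cos_sq θn]

lemma PiIL_Cquad (θm θk θn : ℝ) :
    PiIL (Cquad θm θk θn) = 4 * PiIL (sigquad θm θk θn) := by
  simp only [PiIL, Cquad, sigquad, Matrix.cons_val, Real.cos_add, Real.cos_sub, Real.sin_add,
    Real.sin_sub]
  grind [Real.sin_sq_add_cos_sq θm, Real.sin_sq_add_cos_sq θk, Real.sin_sq_add_cos_sq θn]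

lemma PiEC_Cquad (θm θk θn : ℝ) :
    PiEC (Cquad θm θk θn) = 4 * PiEC (sigquad θm θk θn) := by
  simp only [PiEC, Cquad, sigquad, Matrix.cons_val, Real.cos_add, Real.cos_sub, Real.sin_add,
    Real.sin_sub]
  grind [Real.sin_sq_add_cos_sq θm, Real.sin_sq_add_cos_sq θk, Real.sin_sq_add_cos_sq θn]

theorem stmt9 (θm θk θn : ℝ)
    (hdist : Function.Injective (sigquad θm θk θn))
    (Cs ςs : Fin 4 → ℝ) (πC πς : Equiv.Perm (Fin 4))
    (hCs : Cs = Cquad θm θk θn ∘ πC)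
    (hςs : ςs = sigquad θm θk θn ∘ πς)
    (hCdesc : ∀ i j : Fin 4, i < j → Cs j < Cs i)
    (hςdesc : ∀ i j : Fin 4, i < j → ςs j < ςs i) :
    PiIL Cs = 4 * PiIL ςs ∧ PiEC Cs = 4 * PiEC ςs ∧ PiSP Cs = 4 * PiSP ςs := by
  obtain ⟨hC₁, hC₂, hC₃⟩ := Pi_pos_of_descending hCdesc
  obtain ⟨hς₁, hς₂, hς₃⟩ := Pi_pos_of_descending hςdesc
  have hSP := PiSP_Cquad θm θk θn
  have hIL := PiIL_Cquad θm θk θn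
  have hEC := PiEC_Cquad θm θk θn
  have hC := Pi_comp_perm (Cquad θm θk θn) πC
  have hς := Pi_comp_perm (sigquad θm θk θn) πς
  rw [← hCs] at hC
  rw [← hςs] at hς
  rcases hC with ⟨a₁, a₂, a₃⟩ | ⟨a₁, a₂, a₃⟩ | ⟨a₁, a₂, a₃⟩ | ⟨a₁, a₂, a₃⟩ | ⟨a₁, a₂, a₃⟩ |
    ⟨a₁, a₂, a₃⟩ <;>
  rcases hς with ⟨b₁, b₂, b₃⟩ | ⟨b₁, b₂, b₃⟩ | ⟨b₁, b₂, b₃⟩ | ⟨b₁, b₂, b₃⟩ | ⟨b₁, b₂, b₃⟩ |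
    ⟨b₁, b₂, b₃⟩ <;>
  refine ⟨?_, ?_, ?_⟩ <;> linarith
end

section
/- Fix θ_n ∈ (0,π) with c_n := cos θ_n, and let θ_k ∈ (0,π) with c_k := cos θ_k and c_m ∈ (−1,1). Assume the nondegeneracy condition c_n c_k c_m (1−c_n²)(1−c_k²)(1−c_m²)(c_m²−c_k²)(c_k²−c_n²)(c_n²−c_m²) ≠ 0. Then there is an absolute constant C such that Q(θ_k, c_m) ≤ C · (1 + log√( Π_IL(ς_s) / Π_EC(ς_s) )) / √(Π_IL(ς_s)), where ς_s = (1, ς₂, ς₃, ς₄) is the descending rearrangement of (1, c_n², c_k², c_m²), Π_IL(ς_s) = (1 − ς₃)(ς₂ − ς₄) and Π_EC(ς_s) = (1 − ς₄)(ς₂ − ς₃). -/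
open scoped BigOperators ENNReal

/-- The quartic expression `q(λ, θ_k, c_m)` (for a fixed `θ_n`). -/
noncomputable def qfun (θn θk cm lam : ℝ) : ℝ :=
  (2 * lam * Real.sin θk * Real.sin θn * cm ^ 2) ^ 2 -
    ((lam ^ 2 + 1 + 2 * lam * Real.cos θn * Real.cos θk) * cm ^ 2 -
      (lam * Real.cos θk + Real.cos θn) ^ 2) ^ 2

/-- `q* = 1/√q` where `q > 0`, and `0` otherwise. -/
noncomputable def qstar (θn θk cm lam : ℝ) : ℝ :=
  if 0 < qfun θn θk cm lam then 1 / Real.sqrt (qfun θn θk cm lam) else 0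

/-- `Q(θ_k, c_m) = |c_m| ∫_{1/2}^{1} q*(λ, θ_k, c_m) dλ` (as an extended nonnegative real). -/
noncomputable def Qint (θn θk cm : ℝ) : ℝ≥0∞ :=
  ENNReal.ofReal |cm| *
    ∫⁻ lam in Set.Ioc (1 / 2 : ℝ) 1, ENNReal.ofReal (qstar θn θk cm lam)

section

open MeasureTheory

lemma lintegral_ofReal_le_sub_of_hasDerivAt {a b : ℝ} (hab : a ≤ b) {f G g : ℝ → ℝ}
    (hG : ContinuousOn G (Set.Icc a b))
    (hd : ∀ x ∈ Set.Ioo a b, HasDerivAt G (g x) x)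
    (hf : ∀ x ∈ Set.Ioo a b, f x ≤ g x) (hg : ∀ x ∈ Set.Ioo a b, 0 ≤ g x) :
    ∫⁻ x in Set.Ioo a b, ENNReal.ofReal (f x) ≤ ENNReal.ofReal (G b - G a) := by
  have hi : IntegrableOn g (Set.Ioc a b) :=
    intervalIntegral.integrableOn_deriv_of_nonneg hG hd hg
  have hio : IntegrableOn g (Set.Ioo a b) := hi.mono_set Set.Ioo_subset_Ioc_self
  have hI := intervalIntegral.integral_eq_sub_of_hasDerivAt_of_le hab hG hd
    ((intervalIntegrable_iff_integrableOn_Ioc_of_le hab).2 hi)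
  rw [intervalIntegral.integral_of_le hab, integral_Ioc_eq_integral_Ioo] at hI
  rw [← hI, ofReal_integral_eq_lintegral_ofReal hio
    ((ae_restrict_iff' measurableSet_Ioo).2 (Filter.Eventually.of_forall hg))]
  exact setLIntegral_mono' measurableSet_Ioo fun x hx => ENNReal.ofReal_le_ofReal (hf x hx)

lemma sqrt_mul_add_sqrt_mul_le {p q t r d w : ℝ} (hp : 0 ≤ p) (hq : 0 ≤ q) (ht : 0 ≤ t)
    (hr : 0 ≤ r) (h : p * t + q * r = d * w) :
    √p * √t + √q * √r ≤ √(2 * d * w) := by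
  apply Real.le_sqrt_of_sq_le
  nlinarith [sq_nonneg (√p * √t - √q * √r), Real.sq_sqrt hp, Real.sq_sqrt hq, Real.sq_sqrt ht,
    Real.sq_sqrt hr, mul_pow (√p) (√t) 2, mul_pow (√q) (√r) 2]

lemma log_div_sub_le {u v : ℝ} (hv : 0 < v) (huv : v < u) :
    Real.log (u / v) / (u - v) ≤ (1 + Real.log (u / v)) / u := by
  have hu : 0 < u := hv.trans huv
  rw [div_le_div_iff₀ (by linarith) hu]
  have h1 := Real.log_le_sub_one_of_pos (div_pos hu hv)
  have h2 : v * (u / v) = u := by field_simp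
  nlinarith [mul_le_mul_of_nonneg_left h1 hv.le]

lemma hasDerivAt_log_sqrt_combination {p q a b x : ℝ} (hp : 0 < p) (hq : 0 < q)
    (hx : x ∈ Set.Ioo a b) :
    HasDerivAt (fun x => Real.log (p * √(x - a) + q * √(b - x)))
      ((p * √(b - x) - q * √(x - a)) /
        (2 * √(x - a) * √(b - x) * (p * √(x - a) + q * √(b - x)))) x := by
  have ht : 0 < x - a := sub_pos.2 hx.1
  have hr : 0 < b - x := sub_pos.2 hx.2
  have ht' := Real.sqrt_pos.2 ht
  have hr' := Real.sqrt_pos.2 hr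
  have h1 : HasDerivAt (fun x => √(x - a)) (1 / (2 * √(x - a))) x :=
    ((hasDerivAt_id x).sub_const a).sqrt ht.ne'
  have h2 : HasDerivAt (fun x => √(b - x)) (-1 / (2 * √(b - x))) x :=
    ((hasDerivAt_id x).const_sub b).sqrt hr.ne'
  refine (((h1.const_mul p).fun_add (h2.const_mul q)).log
    (show p * √(x - a) + q * √(b - x) ≠ 0 by positivity)).congr_deriv ?_
  field_simp
  ring

lemma lintegral_quartic_gap_le {e₁ e₂ e₃ e₄ : ℝ} (h₁₂ : e₁ < e₂) (h₂₃ : e₂ < e₃) (h₃₄ : e₃ < e₄) :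
    ∫⁻ x in Set.Ioo e₃ e₄,
        ENNReal.ofReal (1 / √((x - e₁) * (x - e₂) * (x - e₃) * (e₄ - x))) ≤
      ENNReal.ofReal (4 * (1 + Real.log (√((e₄ - e₂) * (e₃ - e₁)) / √((e₃ - e₂) * (e₄ - e₁)))) /
        √((e₄ - e₂) * (e₃ - e₁))) := by
  set α := √(e₄ - e₂) with hα
  set β := √(e₃ - e₂) with hβ
  set γ := √(e₄ - e₁) with hγ
  set δ := √(e₃ - e₁) with hδ
  have hα0 : 0 < α := Real.sqrt_pos.2 (by linarith)
  have hβ0 : 0 < β := Real.sqrt_pos.2 (by linarith)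
  have hγ0 : 0 < γ := Real.sqrt_pos.2 (by linarith)
  have hδ0 : 0 < δ := Real.sqrt_pos.2 (by linarith)
  have hu : √((e₄ - e₂) * (e₃ - e₁)) = α * δ := Real.sqrt_mul (by linarith) _
  have hv : √((e₃ - e₂) * (e₄ - e₁)) = β * γ := Real.sqrt_mul (by linarith) _
  have huv : β * γ < α * δ := by
    rw [← hu, ← hv]
    apply Real.sqrt_lt_sqrt
    · exact mul_nonneg (by linarith) (by linarith)
    · nlinarith [mul_pos (sub_pos.2 h₁₂) (sub_pos.2 h₃₄)]
  rw [hu, hv]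
  have hw : 0 < α * δ - β * γ := by linarith
  have hd : 0 < e₄ - e₃ := by linarith
  set X : ℝ → ℝ := fun x => α * √(x - e₃) + β * √(e₄ - x) with hX
  set Y : ℝ → ℝ := fun x => γ * √(x - e₃) + δ * √(e₄ - x) with hY
  have hpos : ∀ x ∈ Set.Icc e₃ e₄, 0 < √(x - e₃) ∨ 0 < √(e₄ - x) := by
    intro x hx
    rcases hx.1.lt_or_eq with h | h
    · exact Or.inl (Real.sqrt_pos.2 (by linarith))
    · exact Or.inr (Real.sqrt_pos.2 (by linarith))
  have hX0 : ∀ x ∈ Set.Icc e₃ e₄, 0 < X x := by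
    intro x hx
    rcases hpos x hx with h | h <;> simp only [hX] <;> positivity
  have hY0 : ∀ x ∈ Set.Icc e₃ e₄, 0 < Y x := by
    intro x hx
    rcases hpos x hx with h | h <;> simp only [hY] <;> positivity
  set G : ℝ → ℝ := fun x => 4 / (α * δ - β * γ) * (Real.log (X x) - Real.log (Y x)) with hG
  set g : ℝ → ℝ := fun x => 2 * (e₄ - e₃) / (√(x - e₃) * √(e₄ - x) * X x * Y x) with hg
  have hGc : ContinuousOn G (Set.Icc e₃ e₄) := by
    refine continuousOn_const.mul (ContinuousOn.sub ?_ ?_)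
    · exact ContinuousOn.log (by fun_prop) fun x hx => (hX0 x hx).ne'
    · exact ContinuousOn.log (by fun_prop) fun x hx => (hY0 x hx).ne'
  have hGd : ∀ x ∈ Set.Ioo e₃ e₄, HasDerivAt G (g x) x := by
    intro x hx
    refine (((hasDerivAt_log_sqrt_combination hα0 hβ0 hx).fun_sub
      (hasDerivAt_log_sqrt_combination hγ0 hδ0 hx)).const_mul
        (4 / (α * δ - β * γ))).congr_deriv ?_
    have hXx := hX0 x (Set.Ioo_subset_Icc_self hx)
    have hYx := hY0 x (Set.Ioo_subset_Icc_self hx)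
    have ht : 0 < √(x - e₃) := Real.sqrt_pos.2 (by linarith [hx.1])
    have hr : 0 < √(e₄ - x) := Real.sqrt_pos.2 (by linarith [hx.2])
    have ht2 := Real.sq_sqrt (show 0 ≤ x - e₃ by linarith [hx.1])
    have hr2 := Real.sq_sqrt (show 0 ≤ e₄ - x by linarith [hx.2])
    have hsum : e₄ - e₃ = √(x - e₃) ^ 2 + √(e₄ - x) ^ 2 := by rw [ht2, hr2]; ring
    simp only [hg, hX, hY] at hXx hYx ⊢
    rw [hsum]
    generalize √(x - e₃) = t at *
    generalize √(e₄ - x) = r at *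
    have := hXx.ne'
    have := hYx.ne'
    have := hw.ne'
    field_simp
    ring
  have hmain := lintegral_ofReal_le_sub_of_hasDerivAt h₃₄.le hGc hGd
    (f := fun x => 1 / √((x - e₁) * (x - e₂) * (x - e₃) * (e₄ - x))) ?_ ?_
  · refine hmain.trans (ENNReal.ofReal_le_ofReal ?_)
    have hval : G e₄ - G e₃ = 4 * (Real.log (α * δ / (β * γ)) / (α * δ - β * γ)) := by
      have hs : 0 < √(e₄ - e₃) := Real.sqrt_pos.2 hd
      simp only [hG, hX, hY, sub_self, Real.sqrt_zero, mul_zero, add_zero, zero_add]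
      rw [Real.log_mul hα0.ne' hs.ne', Real.log_mul hβ0.ne' hs.ne', Real.log_mul hγ0.ne' hs.ne',
        Real.log_mul hδ0.ne' hs.ne', Real.log_div (by positivity) (by positivity),
        Real.log_mul hα0.ne' hδ0.ne', Real.log_mul hβ0.ne' hγ0.ne']
      ring
    rw [hval, mul_div_assoc (4 : ℝ)]
    exact mul_le_mul_of_nonneg_left (log_div_sub_le (mul_pos hβ0 hγ0) huv) (by norm_num)
  · intro x hx
    have ht : 0 < x - e₃ := sub_pos.2 hx.1
    have hr : 0 < e₄ - x := sub_pos.2 hx.2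
    have hXx := hX0 x (Set.Ioo_subset_Icc_self hx)
    have hYx := hY0 x (Set.Ioo_subset_Icc_self hx)
    have hXle : X x ≤ √(2 * (e₄ - e₃) * (x - e₂)) :=
      sqrt_mul_add_sqrt_mul_le (by linarith) (by linarith) ht.le hr.le (by ring)
    have hYle : Y x ≤ √(2 * (e₄ - e₃) * (x - e₁)) :=
      sqrt_mul_add_sqrt_mul_le (by linarith) (by linarith) ht.le hr.le (by ring)
    have hXY : X x * Y x ≤ 2 * (e₄ - e₃) * (√(x - e₁) * √(x - e₂)) := by
      calc X x * Y x ≤ √(2 * (e₄ - e₃) * (x - e₂)) * √(2 * (e₄ - e₃) * (x - e₁)) := by gcongr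
        _ = (√(2 * (e₄ - e₃)) * √(2 * (e₄ - e₃))) * (√(x - e₁) * √(x - e₂)) := by
          rw [Real.sqrt_mul (x := 2 * (e₄ - e₃)) (by linarith),
            Real.sqrt_mul (x := 2 * (e₄ - e₃)) (by linarith)]
          ring
        _ = _ := by rw [Real.mul_self_sqrt (by linarith)]
    have h1 : 0 < x - e₁ := by linarith
    have h2 : 0 < x - e₂ := by linarith
    simp only [hg]
    rw [Real.sqrt_mul (by positivity), Real.sqrt_mul (by positivity), Real.sqrt_mul h1.le]
    have ht' := Real.sqrt_pos.2 ht
    have hr' := Real.sqrt_pos.2 hr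
    have h1' := Real.sqrt_pos.2 h1
    have h2' := Real.sqrt_pos.2 h2
    rw [div_le_div_iff₀ (by positivity) (by positivity)]
    nlinarith [mul_le_mul_of_nonneg_left hXY (mul_pos ht' hr').le]
  · intro x hx
    have hXx := hX0 x (Set.Ioo_subset_Icc_self hx)
    have hYx := hY0 x (Set.Ioo_subset_Icc_self hx)
    simp only [hg]
    positivity

lemma sub_mul_sub_nonneg_of_notMem_Ioo {a b x : ℝ} (hab : a ≤ b) (hx : x ∉ Set.Ioo a b) :
    0 ≤ (x - a) * (x - b) := by
  rcases le_or_gt x a with h | h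
  · exact mul_nonneg_of_nonpos_of_nonpos (by linarith) (by linarith)
  · have : b ≤ x := not_lt.1 fun hb => hx ⟨h, hb⟩
    exact mul_nonneg (by linarith) (by linarith)

lemma lintegral_quartic_gap_le_left {e₁ e₂ e₃ e₄ : ℝ} (h₁₂ : e₁ < e₂) (h₂₃ : e₂ < e₃)
    (h₃₄ : e₃ < e₄) :
    ∫⁻ x in Set.Ioo e₁ e₂,
        ENNReal.ofReal (1 / √((x - e₁) * (e₂ - x) * (x - e₃) * (x - e₄))) ≤
      ENNReal.ofReal (4 * (1 + Real.log (√((e₄ - e₂) * (e₃ - e₁)) / √((e₃ - e₂) * (e₄ - e₁)))) /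
        √((e₄ - e₂) * (e₃ - e₁))) := by
  have h := lintegral_quartic_gap_le (neg_lt_neg h₃₄) (neg_lt_neg h₂₃) (neg_lt_neg h₁₂)
  rw [← (Measure.measurePreserving_neg volume).setLIntegral_comp_preimage_emb
    (MeasurableEquiv.neg ℝ).measurableEmbedding] at h
  have hI : (-e₁ - -e₃) * (-e₂ - -e₄) = (e₄ - e₂) * (e₃ - e₁) := by ring
  have hD : (-e₂ - -e₃) * (-e₁ - -e₄) = (e₃ - e₂) * (e₄ - e₁) := by ring
  rw [hI, hD] at h
  have hset : Neg.neg ⁻¹' Set.Ioo (-e₂) (-e₁) = Set.Ioo e₁ e₂ := by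
    ext x; simp
  rw [hset] at h
  refine le_trans (le_of_eq (lintegral_congr fun x => ?_)) h
  congr 3
  ring

lemma lintegral_quartic_le_of_roots {e₁ e₂ e₃ e₄ K J E : ℝ} (h₁₂ : e₁ < e₂) (h₂₃ : e₂ < e₃)
    (h₃₄ : e₃ < e₄) (hK : 0 < K) {f : ℝ → ℝ}
    (hf : ∀ x, f x = -(K * ((x - e₁) * (x - e₂) * (x - e₃) * (x - e₄))))
    (hJ : J = K * ((e₄ - e₂) * (e₃ - e₁))) (hE : E = K * ((e₃ - e₂) * (e₄ - e₁))) :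
    ∫⁻ x, ENNReal.ofReal (if 0 < f x then 1 / √(f x) else 0) ≤
      ENNReal.ofReal (8 * (1 + Real.log (√(J / E))) / √J) := by
  have hgapR := lintegral_quartic_gap_le h₁₂ h₂₃ h₃₄
  have hgapL := lintegral_quartic_gap_le_left h₁₂ h₂₃ h₃₄
  set I := (e₄ - e₂) * (e₃ - e₁) with hI
  set D := (e₃ - e₂) * (e₄ - e₁) with hD
  have hI0 : 0 < I := mul_pos (by linarith) (by linarith)
  have hD0 : 0 < D := mul_pos (by linarith) (by linarith)
  have hDI : D ≤ I := by nlinarith [mul_pos (sub_pos.2 h₁₂) (sub_pos.2 h₃₄)]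
  have hlog : 0 ≤ Real.log (√I / √D) := by
    apply Real.log_nonneg
    rw [one_le_div (Real.sqrt_pos.2 hD0)]
    exact Real.sqrt_le_sqrt hDI
  set B := 4 * (1 + Real.log (√I / √D)) / √I with hB
  have hB0 : 0 ≤ B := by positivity
  have hsupp : Function.support (fun x => ENNReal.ofReal (if 0 < f x then 1 / √(f x) else 0)) ⊆
      Set.Ioo e₁ e₂ ∪ Set.Ioo e₃ e₄ := by
    intro x hx
    by_contra hmem
    rw [Set.mem_union, not_or] at hmem
    have h := mul_nonneg (sub_mul_sub_nonneg_of_notMem_Ioo h₁₂.le hmem.1)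
      (sub_mul_sub_nonneg_of_notMem_Ioo h₃₄.le hmem.2)
    have hfx : ¬ 0 < f x := by
      rw [hf]
      nlinarith [mul_nonneg hK.le h]
    simp [hfx] at hx
  have hscale : ∀ (s : Set ℝ) (p : ℝ → ℝ), (∀ x, f x = K * p x) →
      ∫⁻ x in s, ENNReal.ofReal (1 / √(p x)) ≤ ENNReal.ofReal B →
      ∫⁻ x in s, ENNReal.ofReal (if 0 < f x then 1 / √(f x) else 0) ≤
        ENNReal.ofReal (1 / √K * B) := by
    intro s p hp hle
    rw [ENNReal.ofReal_mul (by positivity)]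
    refine le_trans ?_ (mul_le_mul_right hle _)
    rw [← lintegral_const_mul' _ _ ENNReal.ofReal_ne_top]
    refine lintegral_mono fun x => ?_
    rw [← ENNReal.ofReal_mul (by positivity)]
    apply ENNReal.ofReal_le_ofReal
    split_ifs
    · rw [hp, Real.sqrt_mul hK.le, one_div_mul_one_div]
    · positivity
  rw [← setLIntegral_eq_of_support_subset hsupp]
  refine (lintegral_union_le _ _ _).trans ((add_le_add
    (hscale _ _ (fun x => ?_) hgapL) (hscale _ _ (fun x => ?_) hgapR)).trans (le_of_eq ?_))
  · rw [hf]; ring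
  · rw [hf]; ring
  · rw [← ENNReal.ofReal_add (by positivity) (by positivity), hJ, hE,
      mul_div_mul_left _ _ hK.ne', Real.sqrt_div hI0.le, Real.sqrt_mul hK.le, hB]
    congr 1
    field_simp
    ring

lemma multiset_triple_eq {α : Type*} {x y z a b c : α}
    (h : ({x, y, z} : Multiset α) = {a, b, c}) :
    (x = a ∧ y = b ∧ z = c) ∨ (x = a ∧ y = c ∧ z = b) ∨ (x = b ∧ y = a ∧ z = c) ∨
    (x = b ∧ y = c ∧ z = a) ∨ (x = c ∧ y = a ∧ z = b) ∨ (x = c ∧ y = b ∧ z = a) := by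
  simp only [Multiset.insert_eq_cons, Multiset.cons_eq_cons, Multiset.singleton_eq_cons_iff,
    Multiset.singleton_inj] at h
  aesop

set_option maxHeartbeats 1000000 in
lemma lintegral_scattering_quartic_le {a b m u v s : ℝ} (ha : 0 < a) (hb : 0 < b) (hm : 0 < m)
    (hu : 0 < u) (hv : 0 < v) (hs : 0 < s) (hu2 : u ^ 2 = 1 - a ^ 2) (hv2 : v ^ 2 = 1 - b ^ 2)
    (hs2 : s ^ 2 = 1 - m ^ 2) {f : ℝ → ℝ}
    (hf : ∀ x, f x = (2 * x * v * u * m ^ 2) ^ 2 -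
      ((x ^ 2 + 1 + 2 * x * a * b) * m ^ 2 - (x * b + a) ^ 2) ^ 2)
    {ς₂ ς₃ ς₄ : ℝ} (hς : ({ς₂, ς₃, ς₄} : Multiset ℝ) = {a ^ 2, b ^ 2, m ^ 2})
    (h₃₂ : ς₃ < ς₂) (h₄₃ : ς₄ < ς₃) :
    ∫⁻ x, ENNReal.ofReal (if 0 < f x then 1 / √(f x) else 0) ≤
      ENNReal.ofReal (8 * (1 + Real.log (√(4 * m ^ 2 * ((1 - ς₃) * (ς₂ - ς₄)) /
        (4 * m ^ 2 * ((1 - ς₄) * (ς₂ - ς₃)))))) / √(4 * m ^ 2 * ((1 - ς₃) * (ς₂ - ς₄)))) := by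
  obtain ⟨A, hA⟩ : ∃ A, A = s * b - m * v := ⟨_, rfl⟩
  obtain ⟨B, hB⟩ : ∃ B, B = s * b + m * v := ⟨_, rfl⟩
  obtain ⟨P, hP⟩ : ∃ P, P = s * a + m * u := ⟨_, rfl⟩
  obtain ⟨R, hR⟩ : ∃ R, R = s * a - m * u := ⟨_, rfl⟩
  have hB0 : 0 < B := by rw [hB]; positivity
  have hP0 : 0 < P := by rw [hP]; positivity
  have hAB : A * B = b ^ 2 - m ^ 2 := by
    rw [hA, hB]; linear_combination b ^ 2 * hs2 - m ^ 2 * hv2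
  have hPR : P * R = a ^ 2 - m ^ 2 := by
    rw [hP, hR]; linear_combination a ^ 2 * hs2 - m ^ 2 * hu2
  have hcross : (P * B - R * A) * (R * B - P * A) = 4 * m ^ 2 * ((1 - m ^ 2) * (a ^ 2 - b ^ 2)) := by
    rw [hA, hB, hP, hR]
    linear_combination 4 * m ^ 2 * (a ^ 2 * v ^ 2 - b ^ 2 * u ^ 2) * hs2 +
      4 * m ^ 2 * (1 - m ^ 2) * (a ^ 2 * hv2 - b ^ 2 * hu2)
  have hPB : 0 < P * B - R * A := by
    have : P * B - R * A = 2 * s * m * (a * v + b * u) := by rw [hA, hB, hP, hR]; ring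
    rw [this]; positivity
  have hBA : B - A = 2 * m * v := by rw [hA, hB]; ring
  have hPR' : P - R = 2 * m * u := by rw [hP, hR]; ring
  have hfac : ∀ x, f x = -((A * x + P) * (B * x + P) * (A * x + R) * (B * x + R)) := by
    intro x
    have h1 : (A * x + P) * (B * x + R) =
        (x * b + a) ^ 2 - (x ^ 2 + 1 + 2 * x * a * b) * m ^ 2 + 2 * x * v * u * m ^ 2 := by
      have : A * R + P * B = 2 * (a * b - m ^ 2 * (a * b - u * v)) := by
        rw [hA, hB, hP, hR]; linear_combination 2 * a * b * hs2
      linear_combination x ^ 2 * hAB + hPR + x * this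
    have h2 : (B * x + P) * (A * x + R) =
        (x * b + a) ^ 2 - (x ^ 2 + 1 + 2 * x * a * b) * m ^ 2 - 2 * x * v * u * m ^ 2 := by
      have : B * R + P * A = 2 * (a * b - m ^ 2 * (a * b + u * v)) := by
        rw [hA, hB, hP, hR]; linear_combination 2 * a * b * hs2
      linear_combination x ^ 2 * hAB + hPR + x * this
    rw [hf]
    linear_combination (B * x + P) * (A * x + R) * h1 +
      ((x * b + a) ^ 2 - (x ^ 2 + 1 + 2 * x * a * b) * m ^ 2 + 2 * x * v * u * m ^ 2) * h2
  have hroots : A ≠ 0 → ∀ x, f x = -((A * B) ^ 2 *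
      ((x - -P / A) * (x - -P / B) * (x - -R / A) * (x - -R / B))) := by
    intro hA x
    rw [hfac]
    field_simp
    ring
  have hK : A ≠ 0 → 0 < (A * B) ^ 2 := fun h => by positivity
  have hv' : A ≠ 0 → (A * B) ^ 2 * ((-P / A - -P / B) * (-R / A - -R / B)) =
      4 * m ^ 2 * ((1 - b ^ 2) * (a ^ 2 - m ^ 2)) := by
    intro hA
    have : (A * B) ^ 2 * ((-P / A - -P / B) * (-R / A - -R / B)) = (B - A) ^ 2 * (P * R) := by
      field_simp; ring
    rw [this, hBA, hPR, ← hv2]; ring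
  have hu' : A ≠ 0 → (A * B) ^ 2 * ((-P / A - -R / A) * (-P / B - -R / B)) =
      4 * m ^ 2 * ((1 - a ^ 2) * (b ^ 2 - m ^ 2)) := by
    intro hA
    have : (A * B) ^ 2 * ((-P / A - -R / A) * (-P / B - -R / B)) = (P - R) ^ 2 * (A * B) := by
      field_simp; ring
    rw [this, hPR', hAB, ← hu2]; ring
  have hs' : A ≠ 0 → (A * B) ^ 2 * ((-P / A - -R / B) * (-P / B - -R / A)) =
      4 * m ^ 2 * ((1 - m ^ 2) * (b ^ 2 - a ^ 2)) := by
    intro hA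
    have : (A * B) ^ 2 * ((-P / A - -R / B) * (-P / B - -R / A)) =
        -((P * B - R * A) * (R * B - P * A)) := by
      field_simp; ring
    rw [this, hcross]; ring
  have hpBrB : -P / B < -R / B := by
    rw [div_lt_div_iff_of_pos_right hB0]
    have : 0 < P - R := by rw [hPR']; positivity
    linarith
  have hBA0 : 0 < B - A := by rw [hBA]; positivity
  have hPR0 : 0 < P - R := by rw [hPR']; positivity
  have hApos : m < b → 0 < A := fun h => by nlinarith
  have hAneg : b < m → A < 0 := fun h => by nlinarith
  have hRpos : m < a → 0 < R := fun h => by nlinarith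
  have hRneg : a < m → R < 0 := fun h => by nlinarith
  have hflip : ∀ X, -X / A = X / -A := fun X => by rw [div_neg, neg_div]
  have hsm : 0 < 4 * m ^ 2 * (1 - m ^ 2) := by rw [← hs2]; positivity
  have hRBpos : b < a → P * A < R * B := fun h => by
    have : 0 < (P * B - R * A) * (R * B - P * A) := by
      rw [hcross, ← mul_assoc]
      exact mul_pos hsm (by nlinarith)
    linarith [(mul_pos_iff_of_pos_left hPB).1 this]
  have hRBneg : a < b → R * B < P * A := fun h => by
    have : 0 < (P * B - R * A) * (P * A - R * B) := by
      have h' : (P * B - R * A) * (P * A - R * B) = 4 * m ^ 2 * (1 - m ^ 2) * (b ^ 2 - a ^ 2) := by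
        linear_combination -hcross
      rw [h']
      exact mul_pos hsm (by nlinarith)
    linarith [(mul_pos_iff_of_pos_left hPB).1 this]
  rcases multiset_triple_eq hς with ⟨rfl, rfl, rfl⟩ | ⟨rfl, rfl, rfl⟩ | ⟨rfl, rfl, rfl⟩ |
    ⟨rfl, rfl, rfl⟩ | ⟨rfl, rfl, rfl⟩ | ⟨rfl, rfl, rfl⟩
  all_goals
    rw [pow_lt_pow_iff_left₀ (by positivity) (by positivity) two_ne_zero] at h₃₂ h₄₃
  · have hA := hApos h₄₃
    have hR := hRpos (h₄₃.trans h₃₂)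
    have hRB := hRBpos h₃₂
    have h0 : -P / A < -R / A := by
      rw [div_lt_div_iff_of_pos_right hA]; linarith
    have h1 : -R / A < -P / B := by
      rw [div_lt_div_iff₀ hA hB0]; nlinarith
    refine lintegral_quartic_le_of_roots h0 h1 hpBrB (hK hA.ne') (fun x => ?_) ?_ ?_
    · rw [hroots hA.ne' x]; ring
    · linear_combination -hv' hA.ne'
    · linear_combination hs' hA.ne'
  · have hA := hAneg h₄₃
    have hR := hRpos h₃₂
    have h1 : -R / B < -R / A := by
      rw [hflip R, div_lt_div_iff₀ hB0 (neg_pos.2 hA)]; nlinarith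
    have h2 : -R / A < -P / A := by
      rw [hflip R, hflip P, div_lt_div_iff_of_pos_right (neg_pos.2 hA)]; linarith
    refine lintegral_quartic_le_of_roots hpBrB h1 h2 (hK hA.ne) (fun x => ?_) ?_ ?_
    · rw [hroots hA.ne x]; ring
    · linear_combination hs' hA.ne
    · linear_combination -hv' hA.ne
  · have hA := hApos (h₄₃.trans h₃₂)
    have hR := hRpos h₄₃
    have hRB := hRBneg h₃₂
    have h0 : -P / A < -P / B := by
      rw [div_lt_div_iff₀ hA hB0]; nlinarith
    have h1 : -P / B < -R / A := by
      rw [div_lt_div_iff₀ hB0 hA]; nlinarith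
    have h2 : -R / A < -R / B := by
      rw [div_lt_div_iff₀ hA hB0]; nlinarith
    refine lintegral_quartic_le_of_roots h0 h1 h2 (hK hA.ne') (fun x => ?_) ?_ ?_
    · exact hroots hA.ne' x
    · linear_combination -hu' hA.ne'
    · linear_combination -hs' hA.ne'
  · have hA := hApos h₃₂
    have hR := hRneg h₄₃
    have h0 : -P / A < -P / B := by
      rw [div_lt_div_iff₀ hA hB0]; nlinarith
    have h2 : -R / B < -R / A := by
      rw [div_lt_div_iff₀ hB0 hA]; nlinarith
    refine lintegral_quartic_le_of_roots h0 hpBrB h2 (hK hA.ne') (fun x => ?_) ?_ ?_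
    · rw [hroots hA.ne' x]; ring
    · linear_combination -hs' hA.ne'
    · linear_combination -hu' hA.ne'
  · have hA := hAneg (h₄₃.trans h₃₂)
    have hR := hRneg h₃₂
    have hRB := hRBpos h₄₃
    have h0 : -P / B < -R / A := by
      rw [hflip R, div_lt_div_iff₀ hB0 (neg_pos.2 hA)]; nlinarith
    have h1 : -R / A < -R / B := by
      rw [hflip R, div_lt_div_iff₀ (neg_pos.2 hA) hB0]; nlinarith
    have h2 : -R / B < -P / A := by
      rw [hflip P, div_lt_div_iff₀ hB0 (neg_pos.2 hA)]; nlinarith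
    refine lintegral_quartic_le_of_roots h0 h1 h2 (hK hA.ne) (fun x => ?_) ?_ ?_
    · rw [hroots hA.ne x]; ring
    · linear_combination hu' hA.ne
    · linear_combination hv' hA.ne
  · have hA := hAneg h₃₂
    have hR := hRneg (h₄₃.trans h₃₂)
    have hRB := hRBneg h₄₃
    have h0 : -R / A < -P / B := by
      rw [hflip R, div_lt_div_iff₀ (neg_pos.2 hA) hB0]; nlinarith
    have h2 : -R / B < -P / A := by
      rw [hflip P, div_lt_div_iff₀ hB0 (neg_pos.2 hA)]; nlinarith
    refine lintegral_quartic_le_of_roots h0 hpBrB h2 (hK hA.ne) (fun x => ?_) ?_ ?_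
    · rw [hroots hA.ne x]; ring
    · linear_combination hv' hA.ne
    · linear_combination hu' hA.ne

lemma lintegral_qstar_le {θn θk cm : ℝ} (hn : 0 < Real.sin θn) (hk : 0 < Real.sin θk)
    (hcm : cm ^ 2 < 1) (hn0 : Real.cos θn ≠ 0) (hk0 : Real.cos θk ≠ 0) (hm0 : cm ≠ 0)
    {ς₂ ς₃ ς₄ : ℝ}
    (hς : ({ς₂, ς₃, ς₄} : Multiset ℝ) = {Real.cos θn ^ 2, Real.cos θk ^ 2, cm ^ 2})
    (h₃₂ : ς₃ < ς₂) (h₄₃ : ς₄ < ς₃) :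
    ∫⁻ x, ENNReal.ofReal (qstar θn θk cm x) ≤
      ENNReal.ofReal (8 * (1 + Real.log (√(4 * |cm| ^ 2 * ((1 - ς₃) * (ς₂ - ς₄)) /
        (4 * |cm| ^ 2 * ((1 - ς₄) * (ς₂ - ς₃)))))) /
          √(4 * |cm| ^ 2 * ((1 - ς₃) * (ς₂ - ς₄)))) := by
  have hbound : ∀ f : ℝ → ℝ, (∀ x, f x = (2 * x * Real.sin θk * Real.sin θn * |cm| ^ 2) ^ 2 -
      ((x ^ 2 + 1 + 2 * x * |Real.cos θn| * |Real.cos θk|) * |cm| ^ 2 -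
        (x * |Real.cos θk| + |Real.cos θn|) ^ 2) ^ 2) → _ := fun f hf =>
    lintegral_scattering_quartic_le (abs_pos.2 hn0) (abs_pos.2 hk0) (abs_pos.2 hm0) hn hk
      (Real.sqrt_pos.2 (sub_pos.2 hcm)) (by rw [sq_abs, Real.sin_sq]) (by rw [sq_abs, Real.sin_sq])
      (by rw [sq_abs, Real.sq_sqrt (sub_nonneg.2 hcm.le)]) hf (by simpa only [sq_abs] using hς)
      h₃₂ h₄₃
  have ha := sq_abs (Real.cos θn)
  have hb := sq_abs (Real.cos θk)
  rcases lt_or_gt_of_ne (mul_ne_zero hn0 hk0) with h | h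
  · have hab : |Real.cos θn| * |Real.cos θk| = -(Real.cos θn * Real.cos θk) := by
      rw [← abs_mul, abs_of_neg h]
    rw [← lintegral_neg_eq_self (μ := volume) (fun x => ENNReal.ofReal (qstar θn θk cm x))]
    refine hbound (fun x => qfun θn θk cm (-x)) fun x => ?_
    have e1 : (x * |Real.cos θk| + |Real.cos θn|) ^ 2 = (-x * Real.cos θk + Real.cos θn) ^ 2 := by
      linear_combination x ^ 2 * hb + ha + 2 * x * hab
    have e2 : x ^ 2 + 1 + 2 * x * |Real.cos θn| * |Real.cos θk| =
        (-x) ^ 2 + 1 + 2 * (-x) * Real.cos θn * Real.cos θk := by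
      linear_combination 2 * x * hab
    rw [e1, e2, sq_abs]
    simp only [qfun]
    ring
  · have hab : |Real.cos θn| * |Real.cos θk| = Real.cos θn * Real.cos θk := by
      rw [← abs_mul, abs_of_pos h]
    refine hbound (qfun θn θk cm) fun x => ?_
    have e1 : (x * |Real.cos θk| + |Real.cos θn|) ^ 2 = (x * Real.cos θk + Real.cos θn) ^ 2 := by
      linear_combination x ^ 2 * hb + ha + 2 * x * hab
    have e2 : x ^ 2 + 1 + 2 * x * |Real.cos θn| * |Real.cos θk| =
        x ^ 2 + 1 + 2 * x * Real.cos θn * Real.cos θk := by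
      linear_combination 2 * x * hab
    rw [e1, e2, sq_abs]
    rfl

end

theorem stmt10 :
    ∃ C : ℝ, ∀ θn θk cm : ℝ,
    0 < θn → θn < Real.pi → 0 < θk → θk < Real.pi → -1 < cm → cm < 1 →
    Real.cos θn * Real.cos θk * cm * (1 - Real.cos θn ^ 2) * (1 - Real.cos θk ^ 2) *
        (1 - cm ^ 2) * (cm ^ 2 - Real.cos θk ^ 2) * (Real.cos θk ^ 2 - Real.cos θn ^ 2) *
        (Real.cos θn ^ 2 - cm ^ 2) ≠ 0 →
    ∀ ς₂ ς₃ ς₄ : ℝ,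
    ({ς₂, ς₃, ς₄} : Multiset ℝ) = {Real.cos θn ^ 2, Real.cos θk ^ 2, cm ^ 2} →
    ς₂ < 1 → ς₃ < ς₂ → ς₄ < ς₃ →
    Qint θn θk cm
      ≤ ENNReal.ofReal
          (C * (1 + Real.log (Real.sqrt
              (((1 - ς₃) * (ς₂ - ς₄)) / ((1 - ς₄) * (ς₂ - ς₃))))) /
            Real.sqrt ((1 - ς₃) * (ς₂ - ς₄))) := by
  refine ⟨4, ?_⟩
  intro θn θk cm hn hn' hk hk' hm hm' hne ς₂ ς₃ ς₄ hς _ h₃₂ h₄₃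
  have hn0 : Real.cos θn ≠ 0 := by rintro h; simp [h] at hne
  have hk0 : Real.cos θk ≠ 0 := by rintro h; simp [h] at hne
  have hm0 : cm ≠ 0 := by rintro h; simp [h] at hne
  have hc := abs_pos.2 hm0
  have hle := lintegral_qstar_le (Real.sin_pos_of_pos_of_lt_pi hn hn')
    (Real.sin_pos_of_pos_of_lt_pi hk hk') (by nlinarith) hn0 hk0 hm0 hς h₃₂ h₄₃
  have h4 : (4 : ℝ) * |cm| ^ 2 = (2 * |cm|) ^ 2 := by ring
  rw [mul_div_mul_left _ _ (by positivity), h4, Real.sqrt_mul (by positivity),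
    Real.sqrt_sq (by positivity)] at hle
  calc Qint θn θk cm
      ≤ ENNReal.ofReal |cm| * ∫⁻ x, ENNReal.ofReal (qstar θn θk cm x) :=
        mul_le_mul_right (MeasureTheory.setLIntegral_le_lintegral _ _) _
    _ ≤ _ := mul_le_mul_right hle _
    _ = _ := by
      rw [← ENNReal.ofReal_mul (abs_nonneg cm)]
      congr 1
      field_simp
      ring
end

section
/- Fix θ_n ∈ (0,π) with c_n := cos θ_n, and let θ_k ∈ (0,π) with c_k := cos θ_k and c_m ∈ (−1,1). Assume the nondegeneracy condition c_n c_k c_m (1−c_n²)(1−c_k²)(1−c_m²)(c_m²−c_k²)(c_k²−c_n²)(c_n²−c_m²) ≠ 0 and additionally the ordering |c_n| < min{|c_k|, |c_m|}. Then there is an absolute constant C such that Q(θ_k, c_m) ≤ C / √(Π_IL(ς_s)), where ς_s = (1, ς₂, ς₃, ς₄) is the descending rearrangement of (1, c_n², c_k², c_m²) and Π_IL(ς_s) = (1 − ς₃)(ς₂ − ς₄). -/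
open scoped BigOperators ENNReal

open MeasureTheory Set

lemma one_div_sqrt_mul_le {x y : ℝ} (hx : 0 < x) (hy : 0 < y) :
    1 / √(x * y) ≤ 1 / √(x + y) * (1 / √x + 1 / √y) := by
  have hx' := Real.sqrt_pos.2 hx
  have hy' := Real.sqrt_pos.2 hy
  have hxy := Real.sqrt_pos.2 (add_pos hx hy)
  have hsum : √(x + y) ≤ √x + √y :=
    Real.sqrt_le_iff.2 ⟨by positivity, by
      nlinarith [Real.sq_sqrt hx.le, Real.sq_sqrt hy.le, mul_pos hx' hy']⟩
  have heq : 1 / √(x + y) * (1 / √x + 1 / √y) =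
      1 / √(x * y) * ((√x + √y) / √(x + y)) := by
    rw [Real.sqrt_mul hx.le]
    field_simp
    ring
  rw [heq]
  exact le_mul_of_one_le_right (by positivity) ((one_le_div hxy).2 hsum)

lemma lintegral_one_div_sqrt_add_le (r s : ℝ) (hrs : r < s) :
    ∫⁻ x in Ioo r s, ENNReal.ofReal (1 / √(x - r) + 1 / √(s - x)) ≤
      ENNReal.ofReal (4 * √(s - r)) := by
  have hcont : ContinuousOn (fun x => 2 * √(x - r) - 2 * √(s - x)) (Icc r s) := by fun_prop
  have hderiv : ∀ x ∈ Ioo r s, HasDerivAt (fun x => 2 * √(x - r) - 2 * √(s - x))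
      (1 / √(x - r) + 1 / √(s - x)) x := by
    rintro x ⟨hx1, hx2⟩
    have h1 : 0 < x - r := by linarith
    have h2 : 0 < s - x := by linarith
    have h1' := Real.sqrt_pos.2 h1
    have h2' := Real.sqrt_pos.2 h2
    convert! ((((hasDerivAt_id x).sub_const r).sqrt h1.ne').const_mul 2).sub
      ((((hasDerivAt_id x).const_sub s).sqrt h2.ne').const_mul 2) using 1
    simp only [id]
    field_simp
    ring
  have hint : IntegrableOn (fun x => 1 / √(x - r) + 1 / √(s - x)) (Ioc r s) :=
    intervalIntegral.integrableOn_deriv_of_nonneg hcont hderiv (fun x _ => by positivity)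
  have hval : ∫ x in r..s, (1 / √(x - r) + 1 / √(s - x)) = 4 * √(s - r) := by
    rw [intervalIntegral.integral_eq_sub_of_hasDerivAt_of_le hrs.le hcont hderiv
      ((intervalIntegrable_iff_integrableOn_Ioc_of_le hrs.le).2 hint)]
    simp only [sub_self, Real.sqrt_zero]
    ring
  rw [restrict_Ioo_eq_restrict_Ioc,
    ← ofReal_integral_eq_lintegral_ofReal hint (Filter.Eventually.of_forall fun x => by positivity),
    ← intervalIntegral.integral_of_le hrs.le, hval]

lemma lintegral_one_div_sqrt_mul_le (r s : ℝ) :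
    ∫⁻ x in Ioo r s, ENNReal.ofReal (1 / √((x - r) * (s - x))) ≤ 4 := by
  rcases le_or_gt s r with h | hrs
  · simp [Ioo_eq_empty_of_le h]
  have hpos := Real.sqrt_pos.2 (sub_pos.2 hrs)
  calc ∫⁻ x in Ioo r s, ENNReal.ofReal (1 / √((x - r) * (s - x)))
      ≤ ∫⁻ x in Ioo r s, ENNReal.ofReal (1 / √(s - r)) *
          ENNReal.ofReal (1 / √(x - r) + 1 / √(s - x)) := by
        refine setLIntegral_mono' measurableSet_Ioo fun x hx => ?_
        rw [← ENNReal.ofReal_mul (by positivity)]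
        refine ENNReal.ofReal_le_ofReal ?_
        have := one_div_sqrt_mul_le (sub_pos.2 hx.1) (sub_pos.2 hx.2)
        rwa [show x - r + (s - x) = s - r by ring] at this
    _ = ENNReal.ofReal (1 / √(s - r)) *
          ∫⁻ x in Ioo r s, ENNReal.ofReal (1 / √(x - r) + 1 / √(s - x)) :=
        lintegral_const_mul' _ _ ENNReal.ofReal_ne_top
    _ ≤ ENNReal.ofReal (1 / √(s - r)) * ENNReal.ofReal (4 * √(s - r)) := by
        gcongr
        exact lintegral_one_div_sqrt_add_le r s hrs
    _ = 4 := by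
        rw [← ENNReal.ofReal_mul (by positivity),
          show 1 / √(s - r) * (4 * √(s - r)) = 4 by field_simp]
        norm_num

lemma lintegral_qstar_le_s11 {θn θk cm r s Y : ℝ} (hY : 0 < Y)
    (h : ∀ x ∈ Ioo (1 / 2 : ℝ) 1, 0 < qfun θn θk cm x →
      r < x ∧ x < s ∧ Y * ((x - r) * (s - x)) ≤ qfun θn θk cm x) :
    ∫⁻ x in Ioc (1 / 2 : ℝ) 1, ENNReal.ofReal (qstar θn θk cm x) ≤ ENNReal.ofReal (4 / √Y) := by
  have hY' := Real.sqrt_pos.2 hY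
  rw [← restrict_Ioo_eq_restrict_Ioc]
  calc ∫⁻ x in Ioo (1 / 2 : ℝ) 1, ENNReal.ofReal (qstar θn θk cm x)
      ≤ ∫⁻ x in Ioo (1 / 2 : ℝ) 1, (Ioo r s).indicator (fun x => ENNReal.ofReal (1 / √Y) *
          ENNReal.ofReal (1 / √((x - r) * (s - x)))) x := by
        refine setLIntegral_mono' measurableSet_Ioo fun x hx => ?_
        unfold qstar
        split_ifs with hq
        · obtain ⟨h1, h2, h3⟩ := h x hx hq
          have hpos := mul_pos (sub_pos.2 h1) (sub_pos.2 h2)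
          rw [indicator_of_mem (mem_Ioo.2 ⟨h1, h2⟩),
            ← ENNReal.ofReal_mul (by positivity), one_div_mul_one_div, ← Real.sqrt_mul hY.le]
          refine ENNReal.ofReal_le_ofReal (one_div_le_one_div_of_le ?_ (Real.sqrt_le_sqrt h3))
          positivity
        · simp
    _ ≤ ∫⁻ x, (Ioo r s).indicator (fun x => ENNReal.ofReal (1 / √Y) *
          ENNReal.ofReal (1 / √((x - r) * (s - x)))) x := setLIntegral_le_lintegral _ _
    _ = ENNReal.ofReal (1 / √Y) *
          ∫⁻ x in Ioo r s, ENNReal.ofReal (1 / √((x - r) * (s - x))) := by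
        rw [lintegral_indicator measurableSet_Ioo, lintegral_const_mul' _ _ ENNReal.ofReal_ne_top]
    _ ≤ ENNReal.ofReal (1 / √Y) * 4 := by
        gcongr
        exact lintegral_one_div_sqrt_mul_le r s
    _ = ENNReal.ofReal (4 / √Y) := by
        rw [show (4 : ℝ≥0∞) = ENNReal.ofReal 4 by norm_num, ← ENNReal.ofReal_mul (by positivity)]
        congr 1
        ring

/-- The four linear factors of the quartic, in terms of the cosines `a`, `b`, `m` and the sines
`sn`, `sk`, `w` of the three angles. -/
lemma quartic_eq_mul {a b m sn sk w : ℝ} (hn : sn ^ 2 = 1 - a ^ 2) (hk : sk ^ 2 = 1 - b ^ 2)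
    (hw : w ^ 2 = 1 - m ^ 2) (x : ℝ) :
    (2 * x * sk * sn * m ^ 2) ^ 2 -
        ((x ^ 2 + 1 + 2 * x * a * b) * m ^ 2 - (x * b + a) ^ 2) ^ 2 =
      (x * (sk * m + b * w) - (sn * m - a * w)) * (x * (sk * m + b * w) + (sn * m + a * w)) *
        ((sn * m + a * w) - x * (sk * m - b * w)) *
        (x * (sk * m - b * w) + (sn * m - a * w)) := by
  have hpt : (sk * m + b * w) * (sk * m - b * w) = m ^ 2 - b ^ 2 := by
    linear_combination m ^ 2 * hk - b ^ 2 * hw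
  have huv : (sn * m + a * w) * (sn * m - a * w) = m ^ 2 - a ^ 2 := by
    linear_combination m ^ 2 * hn - a ^ 2 * hw
  have h1 : (x * (sk * m + b * w) - (sn * m - a * w)) *
      (x * (sk * m - b * w) - (sn * m + a * w)) =
      (x ^ 2 + 1 + 2 * x * a * b) * m ^ 2 - (x * b + a) ^ 2 - 2 * x * sk * sn * m ^ 2 := by
    linear_combination x ^ 2 * hpt + huv - 2 * x * a * b * hw
  have h2 : (x * (sk * m + b * w) + (sn * m + a * w)) *
      (x * (sk * m - b * w) + (sn * m - a * w)) =
      (x ^ 2 + 1 + 2 * x * a * b) * m ^ 2 - (x * b + a) ^ 2 + 2 * x * sk * sn * m ^ 2 := by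
    linear_combination x ^ 2 * hpt + huv - 2 * x * a * b * hw
  linear_combination
    (x * (sk * m + b * w) + (sn * m + a * w)) * (x * (sk * m - b * w) + (sn * m - a * w)) * h1 +
    ((x ^ 2 + 1 + 2 * x * a * b) * m ^ 2 - (x * b + a) ^ 2 - 2 * x * sk * sn * m ^ 2) * h2

lemma factors_lower_bound_of_nonneg {p t u v : ℝ} (hp : 0 < p) (ht : 0 ≤ t) (hu : 0 < u)
    (htv : t ≤ v) {x : ℝ} (hx : x ∈ Ioo (1 / 2 : ℝ) 1)
    (hq : 0 < (x * p - u) * (x * p + v) * (v - x * t) * (x * t + u)) :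
    u / p < x ∧ x < 1 ∧ p * v * ((p + v) * (t + u) / 4) * ((x - u / p) * (1 - x)) ≤
      (x * p - u) * (x * p + v) * (v - x * t) * (x * t + u) := by
  obtain ⟨hx1, hx2⟩ := hx
  have hv : 0 ≤ v := ht.trans htv
  have e1 : (p + v) / 2 ≤ x * p + v := by nlinarith
  have e2 : (1 - x) * v ≤ v - x * t := by nlinarith
  have e3 : (t + u) / 2 ≤ x * t + u := by nlinarith
  have hv2 : 0 ≤ (1 - x) * v := mul_nonneg (by linarith) hv
  have hpos : 0 < x * p - u := by
    by_contra! hneg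
    have : (x * p - u) * ((x * p + v) * (v - x * t) * (x * t + u)) ≤ 0 :=
      mul_nonpos_of_nonpos_of_nonneg hneg
        (mul_nonneg (mul_nonneg (by linarith) (by linarith)) (by linarith))
    linarith
  refine ⟨by rw [div_lt_iff₀ hp]; linarith, hx2, ?_⟩
  calc p * v * ((p + v) * (t + u) / 4) * ((x - u / p) * (1 - x))
      = (x * p - u) * ((p + v) / 2) * ((1 - x) * v) * ((t + u) / 2) := by field_simp; ring
    _ ≤ _ := by
        gcongr
        exact mul_nonneg (mul_nonneg hpos.le (by linarith)) (by linarith)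

lemma factors_lower_bound_of_neg {p T u v M s : ℝ} (hp : 0 < p) (hT : 0 < T) (hv : 0 < v)
    (hM : 0 < M) {x : ℝ} (hx : x ∈ Ioo (1 / 2 : ℝ) 1) (hs : M * (s - x) ≤ u - x * T)
    (hTp : T ≤ p) (hxs : 0 < u - x * T → x < s)
    (hq : 0 < (x * p - u) * (x * p + v) * (v + x * T) * (u - x * T)) :
    u / p < x ∧ x < s ∧ p * M * ((T + v) * (p + v) / 4) * ((x - u / p) * (s - x)) ≤
      (x * p - u) * (x * p + v) * (v + x * T) * (u - x * T) := by
  obtain ⟨hx1, hx2⟩ := hx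
  have e1 : (p + v) / 2 ≤ x * p + v := by nlinarith
  have e2 : (T + v) / 2 ≤ v + x * T := by nlinarith
  have hmul : 0 < (x * p - u) * (u - x * T) := by
    have h : 0 < ((x * p - u) * (u - x * T)) * ((x * p + v) * (v + x * T)) := by linarith
    exact pos_of_mul_pos_left h (mul_nonneg (by linarith) (by linarith))
  have hpT : x * T ≤ x * p := by gcongr
  obtain ⟨h1, h2⟩ : 0 < x * p - u ∧ 0 < u - x * T := by
    rcases pos_and_pos_or_neg_and_neg_of_mul_pos hmul with h | h
    · exact h
    · linarith [h.1, h.2]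
  have hxs' := hxs h2
  have h3 : 0 ≤ M * (s - x) := mul_nonneg hM.le (by linarith)
  refine ⟨by rw [div_lt_iff₀ hp]; linarith, hxs', ?_⟩
  calc p * M * ((T + v) * (p + v) / 4) * ((x - u / p) * (s - x))
      = (x * p - u) * ((p + v) / 2) * ((T + v) / 2) * (M * (s - x)) := by field_simp; ring
    _ ≤ _ := by gcongr

lemma sq_mul_le_of_le {p T u v e : ℝ} (hp : 0 < p) (hT : 0 < T) (hu : 0 < u) (hv : 0 < v)
    (he : 0 < e) (hep : e ≤ p) (heuv : 2 * e ≤ u + v) (hTu : T ≤ u) :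
    e ^ 2 * (p * T + v * u) ≤ 2 * (p * u * ((T + v) * (p + v))) := by
  have h1 : e ^ 2 * (v * u) ≤ p * u * ((T + v) * (p + v)) := by
    calc e ^ 2 * (v * u) ≤ p ^ 2 * (v * u) := by gcongr
      _ = p * u * (v * p) := by ring
      _ ≤ _ := by gcongr <;> linarith
  have h2 : e ^ 2 * (p * T) ≤ p * u * ((T + v) * (p + v)) := by
    rcases le_total e u with h | h
    · calc e ^ 2 * (p * T) = e * e * (p * T) := by ring
        _ ≤ u * p * (p * T) := by gcongr
        _ = p * u * (T * p) := by ring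
        _ ≤ _ := by gcongr <;> linarith
    · have hev : e ≤ v := by linarith
      calc e ^ 2 * (p * T) = e * e * (p * T) := by ring
        _ ≤ v * p * (p * u) := by gcongr
        _ = p * u * (v * p) := by ring
        _ ≤ _ := by gcongr <;> linarith
  linarith

lemma sq_mul_le_of_ge {p T u v e : ℝ} (hp : 0 < p) (hT : 0 < T) (hu : 0 < u) (hv : 0 < v)
    (he : 0 < e) (hep : e ≤ p) (heuv : 2 * e ≤ u + v) (huT : u ≤ T) :
    e ^ 2 * (p * T + v * u) ≤ 2 * (p * T * ((T + v) * (p + v))) := by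
  have h1 : e ^ 2 * (v * u) ≤ p * T * ((T + v) * (p + v)) := by
    calc e ^ 2 * (v * u) ≤ p ^ 2 * (v * T) := by gcongr
      _ = p * T * (v * p) := by ring
      _ ≤ _ := by gcongr <;> linarith
  have h2 : e ^ 2 * (p * T) ≤ p * T * ((T + v) * (p + v)) := by
    calc e ^ 2 * (p * T) = p * T * (e * e) := by ring
      _ ≤ p * T * ((T + v) * (p + v)) := by gcongr <;> linarith
  linarith

lemma exists_quartic_lower_bound {a b m sn sk w : ℝ} (hn : sn ^ 2 = 1 - a ^ 2)
    (hk : sk ^ 2 = 1 - b ^ 2) (hw : w ^ 2 = 1 - m ^ 2) (hn0 : 0 < sn) (hk0 : 0 < sk)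
    (hw0 : 0 < w) (hm0 : 0 < m) (hab : |a| < b) (ham : |a| < m) :
    ∃ r s Y, 0 < Y ∧
      (b ≤ m → m ^ 2 * ((1 - b ^ 2) * (m ^ 2 - a ^ 2)) ≤ 8 * Y) ∧
      (m < b → m ^ 2 * ((1 - m ^ 2) * (b ^ 2 - a ^ 2)) ≤ 8 * Y) ∧
      ∀ x ∈ Ioo (1 / 2 : ℝ) 1,
        0 < (2 * x * sk * sn * m ^ 2) ^ 2 -
          ((x ^ 2 + 1 + 2 * x * a * b) * m ^ 2 - (x * b + a) ^ 2) ^ 2 →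
        r < x ∧ x < s ∧ Y * ((x - r) * (s - x)) ≤ (2 * x * sk * sn * m ^ 2) ^ 2 -
          ((x ^ 2 + 1 + 2 * x * a * b) * m ^ 2 - (x * b + a) ^ 2) ^ 2 := by
  have hb0 : 0 < b := (abs_nonneg a).trans_lt hab
  obtain ⟨hab1, hab2⟩ := abs_lt.1 hab
  have habsq : a ^ 2 < b ^ 2 := sq_lt_sq.2 (by rwa [abs_of_pos hb0])
  have hamsq : a ^ 2 < m ^ 2 := sq_lt_sq.2 (by rwa [abs_of_pos hm0])
  have hkn : sk ≤ sn := by nlinarith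
  have hwn : w ≤ sn := by nlinarith
  have haw : |a * w| < sn * m := by
    rw [abs_mul, abs_of_pos hw0]
    nlinarith [mul_pos hn0 hm0, mul_le_mul_of_nonneg_left hwn (abs_nonneg a)]
  obtain ⟨haw1, haw2⟩ := abs_lt.1 haw
  have hpt : (sk * m + b * w) * (sk * m - b * w) = m ^ 2 - b ^ 2 := by
    linear_combination m ^ 2 * hk - b ^ 2 * hw
  have huv : (sn * m + a * w) * (sn * m - a * w) = m ^ 2 - a ^ 2 := by
    linear_combination m ^ 2 * hn - a ^ 2 * hw
  have hskm : 0 < sk * m := mul_pos hk0 hm0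
  have hbw : 0 < b * w := mul_pos hb0 hw0
  have hmw : 0 < m * w := mul_pos hm0 hw0
  have htv : sk * m - b * w ≤ sn * m + a * w := by nlinarith
  have huv_sum : 2 * (m * w) ≤ (sn * m - a * w) + (sn * m + a * w) := by nlinarith
  have hTp : -(sk * m - b * w) ≤ sk * m + b * w := by linarith
  have hpk : sk * m ≤ sk * m + b * w := by linarith
  have hpw : m < b → m * w ≤ sk * m + b * w := fun h => by nlinarith
  simp only [quartic_eq_mul hn hk hw]
  have hu : 0 < sn * m - a * w := by linarith
  have hv : 0 < sn * m + a * w := by linarith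
  have hp : 0 < sk * m + b * w := by linarith
  generalize sk * m + b * w = p at *
  generalize sk * m - b * w = t at *
  generalize sn * m - a * w = u at *
  generalize sn * m + a * w = v at *
  rcases le_or_gt b m with hbm | hbm
  · have ht : 0 ≤ t := by
      by_contra! h
      nlinarith
    refine ⟨u / p, 1, p * v * ((p + v) * (t + u) / 4), by positivity, fun _ => ?_,
      fun h => absurd h hbm.not_gt, fun x hx hq => factors_lower_bound_of_nonneg hp ht hu htv hx hq⟩
    calc m ^ 2 * ((1 - b ^ 2) * (m ^ 2 - a ^ 2)) = (sk * m) ^ 2 * (v * u) := by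
          rw [huv, ← hk]; ring
      _ ≤ p ^ 2 * (v * u) := by gcongr
      _ = p * v * (p * u) := by ring
      _ ≤ p * v * ((p + v) * (t + u)) := by gcongr <;> linarith
      _ ≤ 8 * (p * v * ((p + v) * (t + u) / 4)) := by
          have : 0 < p * v * ((p + v) * (t + u)) := by positivity
          linarith
  · have hT : 0 < -t := by
      by_contra! h
      nlinarith
    obtain ⟨T, rfl⟩ : ∃ T, t = -T := ⟨-t, by ring⟩
    rw [neg_neg] at hT hTp
    have hZ : m ^ 2 * ((1 - m ^ 2) * (b ^ 2 - a ^ 2)) = (m * w) ^ 2 * (p * T + v * u) := by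
      rw [huv, show p * T = b ^ 2 - m ^ 2 by linarith, ← hw]; ring
    have he := hpw hbm
    rw [hZ]
    simp only [mul_neg, sub_neg_eq_add, neg_add_eq_sub]
    generalize m * w = e at *
    rcases le_total T u with hTu | hTu
    · refine ⟨u / p, 1, p * u * ((T + v) * (p + v) / 4), by positivity,
        fun h => absurd hbm h.not_gt, fun _ => ?_, fun x hx hq =>
        factors_lower_bound_of_neg hp hT hv hu hx ?_ hTp (fun _ => hx.2) hq⟩
      · have := sq_mul_le_of_le hp hT hu hv hmw he huv_sum hTu
        linarith only [this]
      · nlinarith only [hx.1, hx.2, hTu]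
    · refine ⟨u / p, u / T, p * T * ((T + v) * (p + v) / 4), by positivity,
        fun h => absurd hbm h.not_gt, fun _ => ?_, fun x hx hq =>
        factors_lower_bound_of_neg hp hT hv hT hx ?_ hTp
          (fun h => by rw [lt_div_iff₀ hT]; linarith) hq⟩
      · have := sq_mul_le_of_ge hp hT hu hv hmw he huv_sum hTu
        linarith only [this]
      · exact (by field_simp : T * (u / T - x) = u - x * T).le

lemma sorted_eq_of_multiset_eq {a b c x y z : ℝ} (h : ({x, y, z} : Multiset ℝ) = {a, b, c})
    (hyx : y < x) (hzy : z < y) (hab : a < b) (hac : a < c) :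
    (x = b ∧ y = c ∧ z = a) ∨ (x = c ∧ y = b ∧ z = a) := by
  have hx : x ∈ ({a, b, c} : Multiset ℝ) := h ▸ by simp
  have hy : y ∈ ({a, b, c} : Multiset ℝ) := h ▸ by simp
  have hz : z ∈ ({a, b, c} : Multiset ℝ) := h ▸ by simp
  simp only [Multiset.insert_eq_cons, Multiset.mem_cons, Multiset.mem_singleton] at hx hy hz
  grind

theorem stmt11 :
    ∃ C : ℝ, ∀ θn θk cm : ℝ,
    0 < θn → θn < Real.pi → 0 < θk → θk < Real.pi → -1 < cm → cm < 1 →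
    Real.cos θn * Real.cos θk * cm * (1 - Real.cos θn ^ 2) * (1 - Real.cos θk ^ 2) *
        (1 - cm ^ 2) * (cm ^ 2 - Real.cos θk ^ 2) * (Real.cos θk ^ 2 - Real.cos θn ^ 2) *
        (Real.cos θn ^ 2 - cm ^ 2) ≠ 0 →
    |Real.cos θn| < min |Real.cos θk| |cm| →
    ∀ ς₂ ς₃ ς₄ : ℝ,
    ({ς₂, ς₃, ς₄} : Multiset ℝ) = {Real.cos θn ^ 2, Real.cos θk ^ 2, cm ^ 2} →
    ς₂ < 1 → ς₃ < ς₂ → ς₄ < ς₃ →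
    Qint θn θk cm ≤ ENNReal.ofReal (C / Real.sqrt ((1 - ς₃) * (ς₂ - ς₄))) := by
  refine ⟨12, fun θn θk cm hn0 hnπ hk0 hkπ hm1 hm2 _ hlt ς₂ ς₃ ς₄ hς h21 h32 h43 => ?_⟩
  obtain ⟨hnk, hnm⟩ := lt_min_iff.1 hlt
  have hm0 : 0 < |cm| := (abs_nonneg _).trans_lt hnm
  have hsn := Real.sin_pos_of_pos_of_lt_pi hn0 hnπ
  have hsk := Real.sin_pos_of_pos_of_lt_pi hk0 hkπ
  have hw : 0 < 1 - |cm| ^ 2 := by rw [sq_abs]; nlinarith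
  have hZ : 0 < (1 - ς₃) * (ς₂ - ς₄) := mul_pos (by linarith) (by linarith)
  obtain ⟨r, s, Y, hY, hY1, hY2, hbound⟩ : ∃ r s Y, 0 < Y ∧
      (|Real.cos θk| ≤ |cm| →
        |cm| ^ 2 * ((1 - Real.cos θk ^ 2) * (|cm| ^ 2 - Real.cos θn ^ 2)) ≤ 8 * Y) ∧
      (|cm| < |Real.cos θk| →
        |cm| ^ 2 * ((1 - |cm| ^ 2) * (Real.cos θk ^ 2 - Real.cos θn ^ 2)) ≤ 8 * Y) ∧
      ∀ x ∈ Ioo (1 / 2 : ℝ) 1, 0 < qfun θn θk cm x →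
        r < x ∧ x < s ∧ Y * ((x - r) * (s - x)) ≤ qfun θn θk cm x := by
    rcases abs_cases (Real.cos θk) with ⟨hk, _⟩ | ⟨hk, _⟩
    · rw [hk] at hnk ⊢
      have := exists_quartic_lower_bound (Real.sin_sq θn) (Real.sin_sq θk) (Real.sq_sqrt hw.le)
        hsn hsk (Real.sqrt_pos.2 hw) hm0 hnk hnm
      simpa only [qfun, sq_abs] using this
    · rw [hk] at hnk ⊢
      have := exists_quartic_lower_bound (a := -Real.cos θn) (b := -Real.cos θk)
        (by rw [neg_sq]; exact Real.sin_sq θn) (by rw [neg_sq]; exact Real.sin_sq θk)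
        (Real.sq_sqrt hw.le) hsn hsk (Real.sqrt_pos.2 hw) hm0 (by rwa [abs_neg]) (by rwa [abs_neg])
      have heq : ∀ x, (-(x * Real.cos θk) + -Real.cos θn) ^ 2 =
          (x * Real.cos θk + Real.cos θn) ^ 2 := fun x => by ring
      simpa only [qfun, sq_abs, neg_sq, mul_neg, neg_mul, neg_neg, heq] using this
  have hZY : |cm| ^ 2 * ((1 - ς₃) * (ς₂ - ς₄)) ≤ 8 * Y := by
    rw [sq_abs] at hY1 hY2 ⊢
    rcases sorted_eq_of_multiset_eq hς h32 h43 (sq_lt_sq.2 hnk) (sq_lt_sq.2 hnm) with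
      ⟨rfl, rfl, rfl⟩ | ⟨rfl, rfl, rfl⟩
    · exact hY2 (sq_lt_sq.1 h32)
    · exact hY1 (sq_lt_sq.1 h32).le
  unfold Qint
  calc ENNReal.ofReal |cm| * ∫⁻ lam in Ioc (1 / 2 : ℝ) 1, ENNReal.ofReal (qstar θn θk cm lam)
      ≤ ENNReal.ofReal |cm| * ENNReal.ofReal (4 / √Y) := by
        gcongr
        exact lintegral_qstar_le_s11 hY hbound
    _ = ENNReal.ofReal (|cm| * (4 / √Y)) := (ENNReal.ofReal_mul hm0.le).symm
    _ ≤ _ := by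
        refine ENNReal.ofReal_le_ofReal ?_
        have hsqY := Real.sqrt_pos.2 hY
        have hsqZ := Real.sqrt_pos.2 hZ
        rw [mul_div_assoc', div_le_div_iff₀ hsqY hsqZ]
        refine abs_le_of_sq_le_sq' ?_ (by positivity) |>.2
        rw [mul_pow, mul_pow, mul_pow, Real.sq_sqrt hZ.le, Real.sq_sqrt hY.le]
        linarith
end
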